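/- For any constants a, b > 0 with a + b < 1/2 and any constant C₀ > 0, there exist ε > 0, C > 0 and N such that the following holds for all n ≥ N. Let d = (d_1,…,d_n) be a graphical degree sequence satisfying δ ≤ C₀ n^{1/2+ε} and min{d̄, n − d̄ − 1} ≥ n/(3a log n). Let h be a positive integer with h ≤ C₀ n^{2ε} and nh even, and let H be an h-regular graph on vertex set {1,…,n} with m = nh/2 edges. Then the expected number of copies of H in G ∼ 𝒢_d equals (n!/|Aut(H)|) λ^m exp( −((1−λ)/(4λ)) h(h−2) − Rh/(2λ²n) + E ) for some real E with |E| ≤ C n^{−b}. -/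

import Mathlib

open scoped BigOperators Classical

namespace Stmt12

/-- The degree of vertex `j` in the graph `G`. -/
noncomputable def deg {n : ℕ} (G : SimpleGraph (Fin n)) (j : Fin n) : ℕ :=
  (Finset.univ.filter (fun k => G.Adj j k)).card

/-- The set of simple graphs on `{1,…,n}` with degree sequence `d`. -/
noncomputable def degFinset (n : ℕ) (d : Fin n → ℕ) : Finset (SimpleGraph (Fin n)) :=
  Finset.univ.filter (fun G => ∀ j, deg G j = d j)

/-- The average degree `d̄`. -/
noncomputable def dbar (n : ℕ) (d : Fin n → ℕ) : ℝ := (∑ j, (d j : ℝ)) / n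

/-- The edge density `λ = d̄ / (n-1)`. -/
noncomputable def lam (n : ℕ) (d : Fin n → ℕ) : ℝ := dbar n d / ((n : ℝ) - 1)

/-- `R = (1/n) Σ_j (d_j - d̄)²`. -/
noncomputable def Rpar (n : ℕ) (d : Fin n → ℕ) : ℝ :=
  (∑ j, ((d j : ℝ) - dbar n d) ^ 2) / n

/-- `δ = max_j |d_j - d̄|`. -/
noncomputable def deltaPar (n : ℕ) (d : Fin n → ℕ) : ℝ :=
  ⨆ j : Fin n, |(d j : ℝ) - dbar n d|

/-- The number of automorphisms of `H`: permutations of the vertices preserving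
the edge set. -/
noncomputable def autCard {k : ℕ} (H : SimpleGraph (Fin k)) : ℕ :=
  (Finset.univ.filter
    (fun π : Equiv.Perm (Fin k) => ∀ i j, H.Adj (π i) (π j) ↔ H.Adj i j)).card

/-- The number of copies of `H` in `G`: spanning subgraphs of `G` isomorphic to `H`. -/
noncomputable def copyCount {n : ℕ} (H G : SimpleGraph (Fin n)) : ℕ :=
  (Finset.univ.filter
    (fun K : SimpleGraph (Fin n) => K ≤ G ∧ Nonempty (K ≃g H))).card

/-- The expected number of copies of `H` in a uniformly random graph with degree
sequence `d`. -/
noncomputable def expCopies (n : ℕ) (d : Fin n → ℕ) (H : SimpleGraph (Fin n)) : ℝ :=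
  (∑ G ∈ degFinset n d, (copyCount H G : ℝ)) / ((degFinset n d).card : ℝ)

/-- The real-valued indicator of the edge `av`. -/
noncomputable def ind {n : ℕ} (G : SimpleGraph (Fin n)) (a v : Fin n) : ℝ :=
  if G.Adj a v then 1 else 0

lemma ind_nonneg {n : ℕ} (G : SimpleGraph (Fin n)) (a v : Fin n) : 0 ≤ ind G a v := by
  unfold ind; split_ifs <;> norm_num

lemma ind_le_one {n : ℕ} (G : SimpleGraph (Fin n)) (a v : Fin n) : ind G a v ≤ 1 := by
  unfold ind; split_ifs <;> norm_num

lemma ind_comm {n : ℕ} (G : SimpleGraph (Fin n)) (a v : Fin n) : ind G a v = ind G v a := by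
  simp only [ind, G.adj_comm]

lemma ind_self {n : ℕ} (G : SimpleGraph (Fin n)) (a : Fin n) : ind G a a = 0 := by
  simp [ind]

lemma sum_ind {n : ℕ} (G : SimpleGraph (Fin n)) (a : Fin n) : ∑ v, ind G a v = deg G a := by
  simp [ind, deg]

/-- The graphs with degree sequence `d` that contain `Y`. -/
noncomputable def cls {n : ℕ} (d : Fin n → ℕ) (Y : SimpleGraph (Fin n)) :
    Finset (SimpleGraph (Fin n)) :=
  Finset.univ.filter fun G => (∀ j, deg G j = d j) ∧ Y ≤ G

lemma mem_cls {n : ℕ} {d : Fin n → ℕ} {Y G : SimpleGraph (Fin n)} :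
    G ∈ cls d Y ↔ (∀ j, deg G j = d j) ∧ Y ≤ G := by
  simp [cls]

/-- The graph joining each of `a`, `b` to each of `v`, `w`. -/
def fourCycle {n : ℕ} (a b v w : Fin n) : SimpleGraph (Fin n) where
  Adj x y := x ≠ y ∧ (((x = a ∨ x = b) ∧ (y = v ∨ y = w)) ∨ ((x = v ∨ x = w) ∧ (y = a ∨ y = b)))
  symm := ⟨by intro x y h; tauto⟩
  loopless := ⟨by intro x h; exact h.1 rfl⟩

/-- Toggle the four edges between `{a, b}` and `{v, w}`. -/
noncomputable def switch {n : ℕ} (G : SimpleGraph (Fin n)) (a b v w : Fin n) :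
    SimpleGraph (Fin n) :=
  symmDiff G (fourCycle a b v w)

lemma switch_switch {n : ℕ} (G : SimpleGraph (Fin n)) (a b v w : Fin n) :
    switch (switch G a b v w) b a v w = G := by
  have h : fourCycle b a v w = fourCycle a b v w := by
    ext x y; simp only [fourCycle]; tauto
  simp only [switch, h, symmDiff_symmDiff_cancel_right]

lemma switch_adj {n : ℕ} (G : SimpleGraph (Fin n)) (a b v w x y : Fin n) :
    (switch G a b v w).Adj x y ↔
      (G.Adj x y ∧ ¬ (fourCycle a b v w).Adj x y) ∨ ((fourCycle a b v w).Adj x y ∧ ¬ G.Adj x y) := by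
  simp [switch, symmDiff]

lemma switch_ind {n : ℕ} {G : SimpleGraph (Fin n)} {a b v w : Fin n}
    (hab : a ≠ b) (hav : G.Adj a v) (hbv : ¬ G.Adj b v) (hbw : G.Adj b w) (haw : ¬ G.Adj a w)
    (hvb : v ≠ b) (hwa : w ≠ a) (x y : Fin n) :
    ind (switch G a b v w) x y = ind G x y +
      (((if x = a then 1 else 0) - (if x = b then 1 else 0)) *
          ((if y = w then 1 else 0) - (if y = v then 1 else 0)) +
        ((if x = w then 1 else 0) - (if x = v then 1 else 0)) *
          ((if y = a then 1 else 0) - (if y = b then 1 else 0))) := by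
  have hva : v ≠ a := hav.ne'
  have hwb : w ≠ b := hbw.ne'
  have hvw : v ≠ w := by rintro rfl; exact haw hav
  have hva' := hav.symm
  have hvb' : ¬ G.Adj v b := fun h => hbv h.symm
  have hwb' := hbw.symm
  have hwa' : ¬ G.Adj w a := fun h => haw h.symm
  simp only [ind, switch_adj, fourCycle]
  by_cases x1 : x = a
  · subst x1
    by_cases y1 : y = v
    · subst y1; simp_all [eq_comm]
    · by_cases y2 : y = w
      · subst y2; simp_all [eq_comm]
      · simp_all [eq_comm]
  by_cases x2 : x = b
  · subst x2
    by_cases y1 : y = v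
    · subst y1; simp_all [eq_comm]
    · by_cases y2 : y = w
      · subst y2; simp_all [eq_comm]
      · simp_all [eq_comm]
  by_cases x3 : x = v
  · subst x3
    by_cases y1 : y = a
    · subst y1; simp_all [eq_comm]
    · by_cases y2 : y = b
      · subst y2; simp_all [eq_comm]
      · simp_all [eq_comm]
  by_cases x4 : x = w
  · subst x4
    by_cases y1 : y = a
    · subst y1; simp_all [eq_comm]
    · by_cases y2 : y = b
      · subst y2; simp_all [eq_comm]
      · simp_all [eq_comm]
  simp_all [eq_comm]

lemma deg_switch {n : ℕ} {G : SimpleGraph (Fin n)} {a b v w : Fin n}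
    (hab : a ≠ b) (hav : G.Adj a v) (hbv : ¬ G.Adj b v) (hbw : G.Adj b w) (haw : ¬ G.Adj a w)
    (hvb : v ≠ b) (hwa : w ≠ a) (x : Fin n) : deg (switch G a b v w) x = deg G x := by
  have h : (deg (switch G a b v w) x : ℝ) = deg G x := by
    rw [← sum_ind, ← sum_ind]
    simp only [switch_ind hab hav hbv hbw haw hvb hwa, Finset.sum_add_distrib, ← Finset.mul_sum,
      Finset.sum_sub_distrib]
    simp
  exact_mod_cast h

/-- `w` may take part in switchings between `a` and `b` that keep the edges of `Y`. -/
def Free {n : ℕ} (Y : SimpleGraph (Fin n)) (a b w : Fin n) : Prop :=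
  w ≠ a ∧ w ≠ b ∧ ¬ Y.Adj a w ∧ ¬ Y.Adj b w

lemma free_comm {n : ℕ} {Y : SimpleGraph (Fin n)} {a b w : Fin n} :
    Free Y a b w ↔ Free Y b a w := by unfold Free; tauto

/-- Free vertices adjacent to `a` and not to `b`. -/
noncomputable def dif {n : ℕ} (Y G : SimpleGraph (Fin n)) (a b : Fin n) : Finset (Fin n) :=
  Finset.univ.filter fun w => Free Y a b w ∧ G.Adj a w ∧ ¬ G.Adj b w

/-- Free vertices adjacent to exactly one of `a` and `b`. -/
noncomputable def sd {n : ℕ} (Y G : SimpleGraph (Fin n)) (a b : Fin n) : Finset (Fin n) :=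
  Finset.univ.filter fun w => Free Y a b w ∧ ¬ (G.Adj a w ↔ G.Adj b w)

lemma mem_dif {n : ℕ} {Y G : SimpleGraph (Fin n)} {a b w : Fin n} :
    w ∈ dif Y G a b ↔ Free Y a b w ∧ G.Adj a w ∧ ¬ G.Adj b w := by simp [dif]

lemma mem_sd {n : ℕ} {Y G : SimpleGraph (Fin n)} {a b w : Fin n} :
    w ∈ sd Y G a b ↔ Free Y a b w ∧ ¬ (G.Adj a w ↔ G.Adj b w) := by simp [sd]

lemma sd_eq_union {n : ℕ} (Y G : SimpleGraph (Fin n)) (a b : Fin n) :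
    sd Y G a b = dif Y G a b ∪ dif Y G b a := by
  ext w; simp only [Finset.mem_union, mem_sd, mem_dif, free_comm (a := b)]; tauto

lemma disjoint_dif {n : ℕ} (Y G : SimpleGraph (Fin n)) (a b : Fin n) :
    Disjoint (dif Y G a b) (dif Y G b a) := by
  rw [Finset.disjoint_left]; intro w; simp only [mem_dif]; tauto

lemma card_sd {n : ℕ} (Y G : SimpleGraph (Fin n)) (a b : Fin n) :
    (sd Y G a b).card = (dif Y G a b).card + (dif Y G b a).card := by
  rw [sd_eq_union, Finset.card_union_of_disjoint (disjoint_dif Y G a b)]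

lemma switch_spec {n : ℕ} {d : Fin n → ℕ} {Y G : SimpleGraph (Fin n)} {a b v w : Fin n}
    (hab : a ≠ b) (hG : G ∈ cls d Y) (hv : v ∈ dif Y G a b) (hw : w ∈ dif Y G b a) :
    switch G a b v w ∈ cls d Y ∧ v ∈ dif Y (switch G a b v w) b a ∧
      w ∈ dif Y (switch G a b v w) a b ∧ sd Y (switch G a b v w) a b = sd Y G a b := by
  rw [mem_dif] at hv hw
  obtain ⟨⟨hva, hvb, hYav, hYbv⟩, hav, hbv⟩ := hv
  obtain ⟨⟨hwb, hwa, hYbw, hYaw⟩, hbw, haw⟩ := hw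
  rw [mem_cls] at hG
  have hvw : v ≠ w := by rintro rfl; exact haw hav
  have hYva : ¬ Y.Adj v a := fun h => hYav h.symm
  have hYvb : ¬ Y.Adj v b := fun h => hYbv h.symm
  have hYwa : ¬ Y.Adj w a := fun h => hYaw h.symm
  have hYwb : ¬ Y.Adj w b := fun h => hYbw h.symm
  refine ⟨?_, ?_, ?_, ?_⟩
  · rw [mem_cls]
    refine ⟨fun j => ?_, fun x y hxy => ?_⟩
    · rw [deg_switch hab hav hbv hbw haw hvb hwa, hG.1]
    · rw [switch_adj]
      refine Or.inl ⟨hG.2 hxy, ?_⟩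
      rintro ⟨-, ⟨rfl | rfl, rfl | rfl⟩ | ⟨rfl | rfl, rfl | rfl⟩⟩ <;> contradiction
  · rw [mem_dif, switch_adj, switch_adj]
    refine ⟨⟨hvb, hva, hYbv, hYav⟩, ?_, ?_⟩ <;> simp [fourCycle, *, hvb.symm, hva.symm]
  · rw [mem_dif, switch_adj, switch_adj]
    refine ⟨⟨hwa, hwb, hYaw, hYbw⟩, ?_, ?_⟩ <;> simp [fourCycle, *, hwb.symm, hwa.symm]
  · ext x
    simp only [mem_sd, and_congr_right_iff]
    rintro ⟨hxa, hxb, -, -⟩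
    rw [switch_adj, switch_adj]
    simp only [fourCycle]
    by_cases h1 : x = v
    · subst h1; simp [*, hvb.symm, hva.symm]
    · by_cases h2 : x = w
      · subst h2; simp [*, hwb.symm, hwa.symm]
      · simp [*]

/-- Double counting of switchings between `a` and `b` through `v`. -/
lemma sum_switch {n : ℕ} {d : Fin n → ℕ} {Y : SimpleGraph (Fin n)} {a b : Fin n}
    (hab : a ≠ b) (v : Fin n) :
    ∑ G ∈ cls d Y, (if v ∈ dif Y G a b then
        ((dif Y G b a).card : ℝ) / (sd Y G a b).card else 0) =
      ∑ G ∈ cls d Y, (if v ∈ dif Y G b a then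
        ((dif Y G a b).card : ℝ) / (sd Y G a b).card else 0) := by
  have key : ∀ G a b, (if v ∈ dif Y G a b then
      ((dif Y G b a).card : ℝ) / (sd Y G a b).card else 0) =
      ∑ w, (if v ∈ dif Y G a b ∧ w ∈ dif Y G b a then (1 : ℝ) / (sd Y G a b).card else 0) := by
    intro G a b
    by_cases h : v ∈ dif Y G a b
    · simp [h, div_eq_mul_inv]
    · simp [h]
  have hsd : ∀ G, sd Y G b a = sd Y G a b := by
    intro G; ext x; simp only [mem_sd, free_comm (a := b)]; tauto
  have key2 := fun G => key G b a
  simp only [hsd] at key2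
  simp only [key, key2]
  rw [Finset.sum_comm, Finset.sum_comm (s := cls d Y)]
  refine Finset.sum_congr rfl fun w _ => ?_
  rw [← Finset.sum_filter, ← Finset.sum_filter]
  refine Finset.sum_bij' (fun G _ => switch G a b v w) (fun G _ => switch G b a v w) ?_ ?_ ?_ ?_ ?_
  · intro G hG
    rw [Finset.mem_filter] at hG ⊢
    obtain ⟨h1, h2, h3, -⟩ := switch_spec hab hG.1 hG.2.1 hG.2.2
    exact ⟨h1, h2, h3⟩
  · intro G hG
    rw [Finset.mem_filter] at hG ⊢
    obtain ⟨h1, h2, h3, -⟩ := switch_spec hab.symm hG.1 hG.2.1 hG.2.2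
    exact ⟨h1, h2, h3⟩
  · intro G _; exact switch_switch G a b v w
  · intro G _; exact switch_switch G b a v w
  · intro G hG
    rw [Finset.mem_filter] at hG
    rw [(switch_spec hab hG.1 hG.2.1 hG.2.2).2.2.2]

/-- The exact difference of two edge counts at a common vertex. -/
lemma sum_ind_sub {n : ℕ} {d : Fin n → ℕ} {Y : SimpleGraph (Fin n)} {a b : Fin n}
    (hab : a ≠ b) {v : Fin n} (hv : Free Y a b v) :
    ∑ G ∈ cls d Y, (ind G a v - ind G b v) =
      ∑ G ∈ cls d Y, (if v ∈ sd Y G a b then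
        (((dif Y G a b).card : ℝ) - (dif Y G b a).card) / (sd Y G a b).card else 0) := by
  have h := sum_switch (d := d) (Y := Y) hab v
  have hpt : ∀ G ∈ cls d Y, ind G a v - ind G b v - (if v ∈ sd Y G a b then
        (((dif Y G a b).card : ℝ) - (dif Y G b a).card) / (sd Y G a b).card else 0) =
      2 * (if v ∈ dif Y G a b then
        ((dif Y G b a).card : ℝ) / (sd Y G a b).card else 0) - 2 * (if v ∈ dif Y G b a then
        ((dif Y G a b).card : ℝ) / (sd Y G a b).card else 0) := by
    intro G _
    have hK : ((sd Y G a b).card : ℝ) = (dif Y G a b).card + (dif Y G b a).card := by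
      rw [card_sd]; push_cast; rfl
    have hv' := free_comm.1 hv
    by_cases h1 : G.Adj a v <;> by_cases h2 : G.Adj b v
    · have e1 : v ∉ sd Y G a b := by simp [mem_sd, h1, h2]
      have e2 : v ∉ dif Y G a b := by simp [mem_dif, h1, h2]
      have e3 : v ∉ dif Y G b a := by simp [mem_dif, h1, h2]
      simp [ind, *]
    · have e1 : v ∈ sd Y G a b := by simp [mem_sd, h1, h2, hv]
      have e2 : v ∈ dif Y G a b := by simp [mem_dif, h1, h2, hv]
      have e3 : v ∉ dif Y G b a := by simp [mem_dif, h1, h2]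
      have hpos : ((sd Y G a b).card : ℝ) ≠ 0 := by
        exact_mod_cast (Finset.card_pos.2 ⟨v, e1⟩).ne'
      simp only [ind, e1, e2, e3, h1, h2, if_true, if_false]
      field_simp
      rw [hK]; ring
    · have e1 : v ∈ sd Y G a b := by simp [mem_sd, h1, h2, hv]
      have e2 : v ∉ dif Y G a b := by simp [mem_dif, h1, h2]
      have e3 : v ∈ dif Y G b a := by simp [mem_dif, h1, h2, hv']
      have hpos : ((sd Y G a b).card : ℝ) ≠ 0 := by
        exact_mod_cast (Finset.card_pos.2 ⟨v, e1⟩).ne'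
      simp only [ind, e1, e2, e3, h1, h2, if_true, if_false]
      field_simp
      rw [hK]; ring
    · have e1 : v ∉ sd Y G a b := by simp [mem_sd, h1, h2]
      have e2 : v ∉ dif Y G a b := by simp [mem_dif, h1, h2]
      have e3 : v ∉ dif Y G b a := by simp [mem_dif, h1, h2]
      simp [ind, *]
  have hsum := Finset.sum_congr rfl hpt
  rw [Finset.sum_sub_distrib (f := fun G => ind G a v - ind G b v),
    Finset.sum_sub_distrib (f := fun G => 2 * _), ← Finset.mul_sum, ← Finset.mul_sum, h,
    sub_self] at hsum
  linarith

/-- Vertices other than `a`, `b` that are joined to `a` or `b` in `Y`. -/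
noncomputable def bound {n : ℕ} (Y : SimpleGraph (Fin n)) (a b : Fin n) : Finset (Fin n) :=
  Finset.univ.filter fun w => w ≠ a ∧ w ≠ b ∧ (Y.Adj a w ∨ Y.Adj b w)

lemma mem_bound {n : ℕ} {Y : SimpleGraph (Fin n)} {a b w : Fin n} :
    w ∈ bound Y a b ↔ w ≠ a ∧ w ≠ b ∧ (Y.Adj a w ∨ Y.Adj b w) := by simp [bound]

lemma card_bound_le {n : ℕ} (Y : SimpleGraph (Fin n)) (a b : Fin n) :
    (bound Y a b).card ≤ deg Y a + deg Y b := by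
  unfold deg
  refine (Finset.card_le_card ?_).trans (Finset.card_union_le _ _)
  intro w; simp only [mem_bound, Finset.mem_union, Finset.mem_filter, Finset.mem_univ, true_and]
  tauto

lemma card_not_free_le {n : ℕ} (Y : SimpleGraph (Fin n)) (a b : Fin n) :
    (Finset.univ.filter fun w => ¬ Free Y a b w).card ≤ 2 + deg Y a + deg Y b := by
  have h : (Finset.univ.filter fun w => ¬ Free Y a b w) ⊆ {a, b} ∪ bound Y a b := by
    intro w hw
    have hw := (Finset.mem_filter.1 hw).2
    simp only [Free, mem_bound, Finset.mem_union, Finset.mem_insert,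
      Finset.mem_singleton] at hw ⊢
    tauto
  have h2 := (Finset.card_le_card h).trans (Finset.card_union_le _ _)
  have h3 : ({a, b} : Finset (Fin n)).card ≤ 2 := Finset.card_le_two
  have h4 := card_bound_le Y a b
  omega

lemma dif_sub_dif {n : ℕ} {d : Fin n → ℕ} {Y G : SimpleGraph (Fin n)} {a b : Fin n}
    (hab : a ≠ b) (hG : G ∈ cls d Y) :
    ((dif Y G a b).card : ℝ) - (dif Y G b a).card =
      d a - d b - ∑ w ∈ bound Y a b, (ind G a w - ind G b w) := by
  have h1 : ((dif Y G a b).card : ℝ) - (dif Y G b a).card =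
      ∑ w, (if Free Y a b w then ind G a w - ind G b w else 0) := by
    rw [dif, dif, Finset.card_filter, Finset.card_filter]
    push_cast
    rw [← Finset.sum_sub_distrib]
    refine Finset.sum_congr rfl fun w _ => ?_
    have := free_comm (Y := Y) (a := a) (b := b) (w := w)
    by_cases h0 : Free Y a b w <;> by_cases h1 : G.Adj a w <;> by_cases h2 : G.Adj b w <;>
      simp_all [ind]
  have h2 : ∑ w, (ind G a w - ind G b w) = (d a : ℝ) - d b := by
    rw [Finset.sum_sub_distrib, sum_ind, sum_ind, (mem_cls.1 hG).1, (mem_cls.1 hG).1]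
  have h3 : ∑ w, (if w = a ∨ w = b then ind G a w - ind G b w else 0) = 0 := by
    have : ∀ w, (if w = a ∨ w = b then ind G a w - ind G b w else 0) =
        (if w = a then ind G a w - ind G b w else 0) +
        (if w = b then ind G a w - ind G b w else 0) := by
      intro w
      by_cases h : w = a
      · subst h; simp [hab]
      · simp [h]
    simp only [this, Finset.sum_add_distrib]
    simp [ind_self, ind_comm G b a]
  rw [h1, ← h2, bound, Finset.sum_filter, eq_sub_iff_add_eq, ← add_zero (_ + _), ← h3,
    ← Finset.sum_add_distrib, ← Finset.sum_add_distrib]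
  refine Finset.sum_congr rfl fun w _ => ?_
  by_cases e1 : w = a <;> by_cases e2 : w = b <;> by_cases e3 : Y.Adj a w <;>
    by_cases e4 : Y.Adj b w <;> simp [Free, e1, e2, e3, e4] <;> simp_all

lemma abs_dif_sub_dif_le {n : ℕ} {d : Fin n → ℕ} {Y G : SimpleGraph (Fin n)} {a b : Fin n}
    (hab : a ≠ b) (hG : G ∈ cls d Y) :
    |((dif Y G a b).card : ℝ) - (dif Y G b a).card| ≤
      |(d a : ℝ) - d b| + (deg Y a + deg Y b) := by
  rw [dif_sub_dif hab hG]
  refine (abs_sub _ _).trans ?_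
  gcongr
  calc |∑ w ∈ bound Y a b, (ind G a w - ind G b w)|
      ≤ ∑ w ∈ bound Y a b, |ind G a w - ind G b w| := Finset.abs_sum_le_sum_abs _ _
    _ ≤ ∑ w ∈ bound Y a b, 1 := by
        refine Finset.sum_le_sum fun w _ => ?_
        rw [abs_le]
        constructor <;>
          linarith [ind_nonneg G a w, ind_nonneg G b w, ind_le_one G a w, ind_le_one G b w]
    _ = ((bound Y a b).card : ℝ) := by simp
    _ ≤ _ := by exact_mod_cast card_bound_le Y a b

/-- Near-regular degree sequences of density bounded away from `0` and `1`, with all slack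
measured by a parameter `L` that is small compared with `n`. -/
structure Tame {n : ℕ} (d : Fin n → ℕ) (L : ℝ) : Prop where
  hL : 1000 ≤ L
  hn : L ^ 100 ≤ n
  lo : 1 / L ≤ lam n d
  hi : lam n d ≤ 1 - 1 / L
  dev : ∀ j, |(d j : ℝ) - dbar n d| ≤ L * √n

namespace Tame

variable {n : ℕ} {d : Fin n → ℕ} {L : ℝ}

lemma Lpos (T : Tame d L) : 0 < L := by linarith [T.hL]

lemma one_le (T : Tame d L) : 1 ≤ L := by linarith [T.hL]

lemma pow_le (T : Tame d L) {k : ℕ} (hk : k ≤ 100) : L ^ k ≤ n :=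
  (pow_le_pow_right₀ T.one_le hk).trans T.hn

lemma npos (T : Tame d L) : (0 : ℝ) < n := lt_of_lt_of_le (pow_pos T.Lpos _) T.hn

lemma n_ge (T : Tame d L) : (1000 : ℝ) ≤ n := by
  have := T.pow_le (k := 1) (by norm_num); rw [pow_one] at this; linarith [T.hL]

lemma pow_le_sqrt (T : Tame d L) {k : ℕ} (hk : k ≤ 50) : L ^ k ≤ √n := by
  apply Real.le_sqrt_of_sq_le
  rw [← pow_mul]; exact T.pow_le (by omega)

lemma sqrt_pos (T : Tame d L) : 0 < √(n : ℝ) := Real.sqrt_pos.2 T.npos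

lemma sqrt_mul (T : Tame d L) : √(n : ℝ) * √n = n := Real.mul_self_sqrt T.npos.le

lemma dbar_eq (T : Tame d L) : dbar n d = lam n d * (n - 1) := by
  have := T.n_ge
  rw [lam, div_mul_cancel₀]; linarith

/-- `k`-fold powers of `L` times `√n` are far below `n / L ^ j`. -/
lemma pow_mul_sqrt_le (T : Tame d L) {k : ℕ} (hk : k ≤ 50) : L ^ k * √n ≤ n := by
  calc L ^ k * √n ≤ √n * √n := by gcongr; exact T.pow_le_sqrt hk
    _ = n := T.sqrt_mul

lemma inv_L_nonneg (T : Tame d L) : 0 < 1 / L := by have := T.Lpos; positivity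

lemma deg_lo (T : Tame d L) (j : Fin n) : n / (2 * L) ≤ (d j : ℝ) := by
  have h1 := (abs_le.1 (T.dev j)).1
  rw [T.dbar_eq] at h1
  have hL := T.Lpos
  have h2 := T.lo
  have h3 := T.n_ge
  have h4 : L * √n ≤ n / (4 * L) := by
    rw [le_div_iff₀ (by positivity)]
    have := T.pow_mul_sqrt_le (k := 3) (by norm_num)
    have h5 := T.hL
    have : L * √n * (4 * L) ≤ L ^ 3 * √n := by
      have := T.sqrt_pos
      nlinarith [mul_pos (mul_pos hL hL) this]
    linarith
  have h5 : 1 / L * (n - 1) ≤ lam n d * (n - 1) := by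
    apply mul_le_mul_of_nonneg_right h2; linarith
  have h6 : n / (2 * L) + n / (4 * L) ≤ 1 / L * (n - 1) := by
    rw [div_add_div _ _ (by positivity) (by positivity), div_mul_eq_mul_div,
      div_le_div_iff₀ (by positivity) (by positivity)]
    nlinarith [mul_pos hL hL]
  linarith

lemma deg_hi (T : Tame d L) (j : Fin n) : (d j : ℝ) ≤ n - n / (2 * L) := by
  have h1 := (abs_le.1 (T.dev j)).2
  rw [T.dbar_eq] at h1
  have hL := T.Lpos
  have h2 := T.hi
  have h3 := T.n_ge
  have h4 : L * √n ≤ n / (4 * L) := by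
    rw [le_div_iff₀ (by positivity)]
    have := T.pow_mul_sqrt_le (k := 3) (by norm_num)
    have h5 := T.hL
    have : L * √n * (4 * L) ≤ L ^ 3 * √n := by
      have := T.sqrt_pos
      nlinarith [mul_pos (mul_pos hL hL) this]
    linarith
  have h5 : lam n d * (n - 1) ≤ (1 - 1 / L) * (n - 1) := by
    apply mul_le_mul_of_nonneg_right h2; linarith
  have h6 : n / (2 * L) + n / (4 * L) ≤ 1 / L * (n - 1) := by
    rw [div_add_div _ _ (by positivity) (by positivity), div_mul_eq_mul_div,
      div_le_div_iff₀ (by positivity) (by positivity)]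
    nlinarith [mul_pos hL hL]
  linarith

lemma abs_sub_le (T : Tame d L) (a b : Fin n) : |(d a : ℝ) - d b| ≤ 2 * L * √n := by
  have h1 := T.dev a
  have h2 := T.dev b
  rw [abs_le] at *
  constructor <;> linarith

end Tame

lemma exists_large_sd {n : ℕ} {d : Fin n → ℕ} {L : ℝ} (T : Tame d L)
    {Y G : SimpleGraph (Fin n)} (hY : ∀ j, (deg Y j : ℝ) ≤ L) (hG : G ∈ cls d Y) (a b : Fin n) :
    ∃ c, c ≠ a ∧ c ≠ b ∧ n / (5 * L ^ 2) ≤ ((sd Y G a c).card : ℝ) := by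
  by_contra! hcon
  have hL := T.Lpos
  have hdeg := (mem_cls.1 hG).1
  have hlow : (n / (2 * L)) * (n / (2 * L)) ≤ ∑ c, ∑ w, ind G a w * (1 - ind G c w) := by
    rw [Finset.sum_comm]
    have : ∀ w, ∑ c, ind G a w * (1 - ind G c w) = ind G a w * (n - d w) := by
      intro w
      rw [← Finset.mul_sum, Finset.sum_sub_distrib]
      simp only [ind_comm G _ w, sum_ind, hdeg]; simp
    simp only [this]
    calc (n / (2 * L)) * (n / (2 * L)) ≤ d a * (n / (2 * L)) := by
          gcongr; exact T.deg_lo a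
      _ = ∑ w, ind G a w * (n / (2 * L)) := by
          rw [← Finset.sum_mul, sum_ind, hdeg]
      _ ≤ _ := by
          refine Finset.sum_le_sum fun w _ => ?_
          apply mul_le_mul_of_nonneg_left _ (ind_nonneg G a w)
          linarith [T.deg_hi w]
  have hup : ∀ c, ∑ w, ind G a w * (1 - ind G c w) ≤
      (n / (5 * L ^ 2) + (2 + 2 * L)) + if c = b then (n : ℝ) else 0 := by
    intro c
    have hp : (0 : ℝ) ≤ n / (5 * L ^ 2) + (2 + 2 * L) := by positivity
    by_cases hcb : c = b
    · rw [if_pos hcb]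
      calc ∑ w, ind G a w * (1 - ind G c w) ≤ ∑ w : Fin n, (1 : ℝ) := by
            refine Finset.sum_le_sum fun w _ => ?_
            nlinarith [ind_nonneg G a w, ind_nonneg G c w, ind_le_one G a w, ind_le_one G c w]
        _ = n := by simp
        _ ≤ _ := by linarith
    by_cases hca : c = a
    · subst hca
      have : ∀ w, ind G c w * (1 - ind G c w) = 0 := by
        intro w; unfold ind; split_ifs <;> simp
      simp only [this, Finset.sum_const_zero]
      split_ifs; linarith
    · rw [if_neg hcb, add_zero]
      have h1 : ∑ w, ind G a w * (1 - ind G c w) ≤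
          ∑ w, ((if w ∈ sd Y G a c then (1 : ℝ) else 0) + if ¬ Free Y a c w then 1 else 0) := by
        refine Finset.sum_le_sum fun w _ => ?_
        by_cases h0 : Free Y a c w <;> by_cases h1 : G.Adj a w <;> by_cases h2 : G.Adj c w <;>
          simp [ind, mem_sd, h0, h1, h2]
      rw [Finset.sum_add_distrib, Finset.sum_boole, Finset.sum_boole] at h1
      have h2 : ((Finset.univ.filter fun w => ¬ Free Y a c w).card : ℝ) ≤
          2 + deg Y a + deg Y c := by exact_mod_cast card_not_free_le Y a c
      have h3 := hcon c hca hcb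
      have h4 : Finset.univ.filter (fun w => w ∈ sd Y G a c) = sd Y G a c := by ext; simp
      rw [h4] at h1
      linarith [hY a, hY c]
  have hsum := hlow.trans (Finset.sum_le_sum fun c _ => hup c)
  rw [Finset.sum_add_distrib] at hsum
  simp only [Finset.sum_const, Finset.card_univ, Fintype.card_fin, nsmul_eq_mul,
    Finset.sum_ite_eq', Finset.mem_univ, if_true] at hsum
  have hn := T.npos
  have e1 : (n : ℝ) / (2 * L) * (n / (2 * L)) = n * (n / (4 * L ^ 2)) := by field_simp; ring
  rw [e1] at hsum
  have e2 : (n : ℝ) / (4 * L ^ 2) ≤ n / (5 * L ^ 2) + (2 + 2 * L) + 1 := by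
    have : (n : ℝ) * (n / (4 * L ^ 2)) ≤ n * (n / (5 * L ^ 2) + (2 + 2 * L) + 1) := by linarith
    exact le_of_mul_le_mul_left this hn
  have e3 : (n : ℝ) / (4 * L ^ 2) - n / (5 * L ^ 2) = n / (20 * L ^ 2) := by field_simp; ring
  have e4 : 3 + 2 * L < n / (20 * L ^ 2) := by
    rw [lt_div_iff₀ (by positivity)]
    have h5 := T.pow_le (k := 5) (by norm_num)
    have hL' := T.hL
    have h6 : (3 + 2 * L) * (20 * L ^ 2) < L ^ 5 := by
      have h7 : (3 + 2 * L) * 20 < L ^ 3 := by nlinarith [sq_nonneg L]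
      nlinarith [pow_pos hL 2]
    linarith
  linarith

/-- Graphs where `a` and `b` differ in at most `i` free places and `a` and `c` in at least `k`. -/
noncomputable def twin {n : ℕ} (d : Fin n → ℕ) (Y : SimpleGraph (Fin n)) (a b c : Fin n)
    (i : ℕ) (k : ℝ) : Finset (SimpleGraph (Fin n)) :=
  (cls d Y).filter fun G => (sd Y G a b).card ≤ i ∧ k ≤ ((sd Y G a c).card : ℝ)

lemma twin_switch {n : ℕ} {d : Fin n → ℕ} {Y G : SimpleGraph (Fin n)} {a b c v w : Fin n}
    (hac : a ≠ c) {i : ℕ} {k : ℝ} (hG : G ∈ twin d Y a b c i k)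
    (hv : v ∈ dif Y G a c) (hw : w ∈ dif Y G c a) (fv : Free Y a b v) (fw : Free Y a b w)
    (sv : v ∉ sd Y G a b) (sw : w ∉ sd Y G a b) (hbc : b ≠ c) (hab : a ≠ b) :
    switch G a c v w ∈ twin d Y a b c (i + 2) k ∧ v ∈ sd Y (switch G a c v w) a b ∧
      w ∈ sd Y (switch G a c v w) a b := by
  rw [twin, Finset.mem_filter] at hG
  obtain ⟨hG, h1, h2⟩ := hG
  obtain ⟨g1, g2, g3, g4⟩ := switch_spec hac hG hv hw
  have hb : ∀ x, (switch G a c v w).Adj b x ↔ G.Adj b x := by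
    intro x
    rw [switch_adj]
    have : ¬ (fourCycle a c v w).Adj b x := by
      have e1 := fv.2.1.symm
      have e2 := fw.2.1.symm
      have e3 := hab.symm
      simp [fourCycle, e1, e2, e3, hbc]
    simp [this]
  rw [mem_dif] at hv hw g2 g3
  have sv' : v ∈ sd Y (switch G a c v w) a b := by
    rw [mem_sd] at sv ⊢
    rw [hb]
    refine ⟨fv, ?_⟩
    have h3 : G.Adj a v ↔ G.Adj b v := by by_contra h; exact sv ⟨fv, h⟩
    rw [← h3]
    simp [g2.2.2, hv.2.1]
  have sw' : w ∈ sd Y (switch G a c v w) a b := by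
    rw [mem_sd] at sw ⊢
    rw [hb]
    refine ⟨fw, ?_⟩
    have h3 : G.Adj a w ↔ G.Adj b w := by by_contra h; exact sw ⟨fw, h⟩
    rw [← h3]
    simp [g3.2.1, hw.2.2]
  refine ⟨?_, sv', sw'⟩
  rw [twin, Finset.mem_filter]
  refine ⟨g1, ?_, by rw [g4]; exact h2⟩
  have hsub : sd Y (switch G a c v w) a b ⊆ sd Y G a b ∪ {v, w} := by
    intro x hx
    rw [Finset.mem_union, Finset.mem_insert, Finset.mem_singleton]
    by_cases hxv : x = v
    · exact Or.inr (Or.inl hxv)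
    by_cases hxw : x = w
    · exact Or.inr (Or.inr hxw)
    left
    rw [mem_sd] at hx ⊢
    rw [hb] at hx
    have : (switch G a c v w).Adj a x ↔ G.Adj a x := by
      rw [switch_adj]
      have : ¬ (fourCycle a c v w).Adj a x := by
        have e1 : a ≠ v := fun h => hv.1.1 h.symm
        have e2 : a ≠ w := fun h => hw.1.2.1 h.symm
        simp [fourCycle, e1, e2, hxv, hxw]
      simp [this]
    rw [this] at hx
    exact hx
  have c1 := (Finset.card_le_card hsub).trans (Finset.card_union_le _ _)
  have c2 : ({v, w} : Finset (Fin n)).card ≤ 2 := Finset.card_le_two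
  omega

lemma le_card_dif_of_twin {n : ℕ} {d : Fin n → ℕ} {L : ℝ} (T : Tame d L)
    {Y : SimpleGraph (Fin n)} (hY : ∀ j, (deg Y j : ℝ) ≤ L) {a b c : Fin n}
    (hac : a ≠ c) {i : ℕ} {k : ℝ} (hsmall : 2 + 4 * L + L * √n ≤ k / 8)
    (hi : 8 * ((i : ℝ) + 2) ≤ k) {G : SimpleGraph (Fin n)}
    (hG : G ∈ twin d Y a b c i k) (x y : Fin n) (hxy : x = a ∧ y = c ∨ x = c ∧ y = a) :
    k / 4 ≤ (((dif Y G x y).filter fun v => Free Y a b v ∧ v ∉ sd Y G a b).card : ℝ) := by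
  rw [twin, Finset.mem_filter] at hG
  obtain ⟨hG, h1, h2⟩ := hG
  have hcs : (dif Y G x y).card ≤
      ((dif Y G x y).filter fun v => Free Y a b v ∧ v ∉ sd Y G a b).card +
        ((Finset.univ.filter fun w => ¬ Free Y a b w).card + (sd Y G a b).card) := by
    rw [← Finset.card_filter_add_card_filter_not (s := dif Y G x y)
      (fun v => Free Y a b v ∧ v ∉ sd Y G a b)]
    gcongr
    refine (Finset.card_le_card ?_).trans (Finset.card_union_le _ _)
    intro v; simp only [Finset.mem_filter, Finset.mem_union, Finset.mem_univ, true_and]; tauto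
  have hnf : ((Finset.univ.filter fun w => ¬ Free Y a b w).card : ℝ) ≤
      2 + deg Y a + deg Y b := by exact_mod_cast card_not_free_le Y a b
  have hcs' : ((dif Y G x y).card : ℝ) ≤
      ((dif Y G x y).filter fun v => Free Y a b v ∧ v ∉ sd Y G a b).card +
        ((Finset.univ.filter fun w => ¬ Free Y a b w).card + (sd Y G a b).card) := by
    exact_mod_cast hcs
  have hsdac : ((sd Y G a c).card : ℝ) = (dif Y G a c).card + (dif Y G c a).card := by
    rw [card_sd]; push_cast; rfl
  have habs := abs_dif_sub_dif_le hac hG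
  have hdd := T.abs_sub_le a c
  have h1' : ((sd Y G a b).card : ℝ) ≤ i := by exact_mod_cast h1
  rw [abs_le] at habs
  have := hY a
  have := hY b
  have := hY c
  rcases hxy with ⟨rfl, rfl⟩ | ⟨rfl, rfl⟩ <;> linarith [habs.1, habs.2]

lemma twin_step {n : ℕ} {d : Fin n → ℕ} {L : ℝ} (T : Tame d L)
    {Y : SimpleGraph (Fin n)} (hY : ∀ j, (deg Y j : ℝ) ≤ L) {a b c : Fin n}
    (hab : a ≠ b) (hac : a ≠ c) (hbc : b ≠ c) {i : ℕ} {k : ℝ}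
    (hk : n / (5 * L ^ 2) ≤ k) (hi : 8 * ((i : ℝ) + 2) ≤ k) :
    4 * ((twin d Y a b c i k).card : ℝ) ≤ (twin d Y a b c (i + 2) k).card := by
  classical
  have hL := T.Lpos
  have hkpos : 0 < k := lt_of_lt_of_le (div_pos T.npos (by positivity)) hk
  have hsmall : 2 + 4 * L + L * √n ≤ k / 8 := by
    refine le_trans ?_ (div_le_div_of_nonneg_right hk (by norm_num))
    rw [div_div, le_div_iff₀ (by positivity)]
    have h5 := T.pow_mul_sqrt_le (k := 5) (by norm_num)
    have h1 := T.pow_le_sqrt (k := 1) (by norm_num)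
    have hL' := T.hL
    rw [pow_one] at h1
    have h6 : 2 + 4 * L + L * √n ≤ 6 * L * √n := by nlinarith
    have h7 : 6 * L * √n * (5 * L ^ 2 * 8) ≤ L ^ 5 * √n := by
      have : 6 * L * (5 * L ^ 2 * 8) ≤ L ^ 5 := by nlinarith [pow_pos hL 3, pow_pos hL 4]
      nlinarith [T.sqrt_pos]
    nlinarith [mul_pos (pow_pos hL 2) hL]
  -- the set of usable pairs
  let good : SimpleGraph (Fin n) → Fin n → Fin n → Prop := fun G v w =>
    v ∈ dif Y G a c ∧ w ∈ dif Y G c a ∧ Free Y a b v ∧ Free Y a b w ∧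
      v ∉ sd Y G a b ∧ w ∉ sd Y G a b
  have hdifcard := fun G hG x y hxy => le_card_dif_of_twin (i := i) (k := k) T hY hac hsmall hi
    (b := b) (G := G) hG x y hxy
  have hlow : (k / 4) ^ 2 * ((twin d Y a b c i k).card : ℝ) ≤
      ∑ G ∈ twin d Y a b c i k, ∑ v, ∑ w, (if good G v w then (1 : ℝ) else 0) := by
    rw [mul_comm, ← nsmul_eq_mul]
    refine Finset.card_nsmul_le_sum _ _ _ fun G hG => ?_
    have e1 := hdifcard G hG a c (Or.inl ⟨rfl, rfl⟩)
    have e2 := hdifcard G hG c a (Or.inr ⟨rfl, rfl⟩)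
    have e3 : ∑ v, ∑ w, (if good G v w then (1 : ℝ) else 0) =
        (((dif Y G a c).filter fun v => Free Y a b v ∧ v ∉ sd Y G a b).card : ℝ) *
        (((dif Y G c a).filter fun v => Free Y a b v ∧ v ∉ sd Y G a b).card : ℝ) := by
      have : ∀ v w, (if good G v w then (1 : ℝ) else 0) =
          (if v ∈ (dif Y G a c).filter fun v => Free Y a b v ∧ v ∉ sd Y G a b then 1 else 0) *
          (if w ∈ (dif Y G c a).filter fun v => Free Y a b v ∧ v ∉ sd Y G a b then 1 else 0) := by
        intro v w
        rw [ite_zero_mul_ite_zero, mul_one]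
        refine if_congr ?_ rfl rfl
        simp only [good, Finset.mem_filter]; tauto
      simp only [this, ← Finset.mul_sum, ← Finset.sum_mul]
      rw [Finset.sum_boole, Finset.sum_boole]
      congr 3 <;> (ext; simp)
    rw [e3, sq]
    exact mul_le_mul e1 e2 (by positivity) (by positivity)
  have hup : ∑ G ∈ twin d Y a b c i k, ∑ v, ∑ w, (if good G v w then (1 : ℝ) else 0) ≤
      ((i : ℝ) + 2) ^ 2 * (twin d Y a b c (i + 2) k).card := by
    calc ∑ G ∈ twin d Y a b c i k, ∑ v, ∑ w, (if good G v w then (1 : ℝ) else 0)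
        = ∑ v, ∑ w, ∑ G ∈ twin d Y a b c i k, (if good G v w then (1 : ℝ) else 0) := by
          rw [Finset.sum_comm]
          exact Finset.sum_congr rfl fun v _ => Finset.sum_comm
      _ ≤ ∑ v, ∑ w, ∑ G ∈ twin d Y a b c (i + 2) k,
            (if v ∈ sd Y G a b ∧ w ∈ sd Y G a b then (1 : ℝ) else 0) := by
          refine Finset.sum_le_sum fun v _ => Finset.sum_le_sum fun w _ => ?_
          rw [Finset.sum_boole, Finset.sum_boole]
          norm_cast
          refine Finset.card_le_card_of_injOn (fun G => switch G a c v w) ?_ ?_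
          · intro G hG
            have hG := Finset.mem_filter.1 (Finset.mem_coe.1 hG)
            obtain ⟨e1, e2, e3⟩ := twin_switch hac hG.1 hG.2.1 hG.2.2.1 hG.2.2.2.1 hG.2.2.2.2.1
              hG.2.2.2.2.2.1 hG.2.2.2.2.2.2 hbc hab
            exact Finset.mem_coe.2 (Finset.mem_filter.2 ⟨e1, e2, e3⟩)
          · intro G _ G' _ h
            have := congrArg (fun H => switch H c a v w) h
            simpa only [switch_switch] using this
      _ = ∑ G ∈ twin d Y a b c (i + 2) k, ∑ v, ∑ w,
            (if v ∈ sd Y G a b ∧ w ∈ sd Y G a b then (1 : ℝ) else 0) := by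
          rw [Finset.sum_comm (s := twin d Y a b c (i + 2) k)]
          exact Finset.sum_congr rfl fun v _ => Finset.sum_comm
      _ ≤ ∑ G ∈ twin d Y a b c (i + 2) k, ((i : ℝ) + 2) ^ 2 := by
          refine Finset.sum_le_sum fun G hG => ?_
          have e : ∀ v w, (if v ∈ sd Y G a b ∧ w ∈ sd Y G a b then (1 : ℝ) else 0) =
              (if v ∈ sd Y G a b then 1 else 0) * (if w ∈ sd Y G a b then 1 else 0) := by
            intro v w
            rw [ite_zero_mul_ite_zero, mul_one]
          simp only [e, ← Finset.mul_sum, ← Finset.sum_mul]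
          rw [Finset.sum_boole]
          have h4 : Finset.univ.filter (fun w => w ∈ sd Y G a b) = sd Y G a b := by ext; simp
          rw [h4, ← sq]
          rw [twin, Finset.mem_filter] at hG
          have : ((sd Y G a b).card : ℝ) ≤ (i : ℝ) + 2 := by exact_mod_cast hG.2.1
          gcongr
      _ = _ := by rw [Finset.sum_const, nsmul_eq_mul, mul_comm]
  have hmain := hlow.trans hup
  have hsq : 4 * ((i : ℝ) + 2) ^ 2 ≤ (k / 4) ^ 2 := by nlinarith
  have hipos : (0 : ℝ) < ((i : ℝ) + 2) ^ 2 := by positivity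
  have hc : (0 : ℝ) ≤ (twin d Y a b c i k).card := by positivity
  have : ((i : ℝ) + 2) ^ 2 * (4 * (twin d Y a b c i k).card) ≤
      ((i : ℝ) + 2) ^ 2 * (twin d Y a b c (i + 2) k).card := by nlinarith
  exact le_of_mul_le_mul_left this hipos

lemma twin_iter {n : ℕ} {d : Fin n → ℕ} {L : ℝ} (T : Tame d L)
    {Y : SimpleGraph (Fin n)} (hY : ∀ j, (deg Y j : ℝ) ≤ L) {a b c : Fin n}
    (hab : a ≠ b) (hac : a ≠ c) (hbc : b ≠ c) {k : ℝ} (hk : n / (5 * L ^ 2) ≤ k) (t : ℕ) :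
    ∀ i : ℕ, 8 * ((i : ℝ) + 2 * t) ≤ k →
      4 ^ t * ((twin d Y a b c i k).card : ℝ) ≤ (cls d Y).card := by
  induction t with
  | zero =>
    intro i _
    rw [pow_zero, one_mul]
    exact_mod_cast Finset.card_filter_le _ _
  | succ t ih =>
    intro i hi
    push_cast at hi
    have h1 := ih (i + 2) (by push_cast; linarith)
    have h2 := twin_step T hY hab hac hbc hk (i := i) (by
      have : (0 : ℝ) ≤ t := by positivity
      linarith)
    have h3 : (0 : ℝ) < 4 ^ t := by positivity
    calc (4 : ℝ) ^ (t + 1) * ((twin d Y a b c i k).card : ℝ)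
        = 4 ^ t * (4 * (twin d Y a b c i k).card) := by ring
      _ ≤ 4 ^ t * (twin d Y a b c (i + 2) k).card := by gcongr
      _ ≤ _ := h1

lemma pow_four_le {n t : ℕ} (hn : 0 < n) (ht : 8 * √(n : ℝ) ≤ t) : (n : ℝ) ^ 4 ≤ 4 ^ t := by
  have hn' : (0 : ℝ) < n := by exact_mod_cast hn
  have h1 : Real.log n ≤ 2 * √n := by
    have h2 := Real.log_le_sub_one_of_pos (Real.sqrt_pos.2 hn')
    rw [Real.log_sqrt hn'.le] at h2
    linarith
  calc (n : ℝ) ^ 4 = Real.exp (4 * Real.log n) := by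
        rw [mul_comm, Real.exp_mul, Real.exp_log hn']; norm_cast
    _ ≤ Real.exp t := by apply Real.exp_le_exp.2; linarith
    _ = Real.exp 1 ^ t := by rw [← Real.exp_nat_mul, mul_one]
    _ ≤ 4 ^ t := by
        gcongr
        linarith [Real.exp_one_lt_d9]

/-- Two vertices very rarely have almost the same neighbourhood. -/
lemma card_small_sd {n : ℕ} {d : Fin n → ℕ} {L : ℝ} (T : Tame d L)
    {Y : SimpleGraph (Fin n)} (hY : ∀ j, (deg Y j : ℝ) ≤ L) {a b : Fin n} (hab : a ≠ b) :
    (((cls d Y).filter fun G => ((sd Y G a b).card : ℝ) < n / L ^ 4).card : ℝ) ≤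
      (cls d Y).card / n ^ 3 := by
  have hL := T.Lpos
  have hn := T.npos
  set r : ℝ := n / L ^ 4 with hr
  have hr0 : 0 < r := by positivity
  set t : ℕ := ⌊r⌋₊
  set k : ℝ := n / (5 * L ^ 2) with hk
  have ht1 : (t : ℝ) ≤ r := Nat.floor_le hr0.le
  have ht2 : r < t + 1 := Nat.lt_floor_add_one r
  have hrk : 24 * r ≤ k := by
    rw [hr, hk, mul_div_assoc', div_le_div_iff₀ (by positivity) (by positivity)]
    have h1 : 1000000 ≤ L ^ 2 := by nlinarith [T.hL]
    have : 24 * (5 * L ^ 2) ≤ L ^ 4 := by nlinarith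
    nlinarith
  have h8 : 8 * √(n : ℝ) ≤ t := by
    have h1 : 9 * √(n : ℝ) ≤ r := by
      rw [hr, le_div_iff₀ (by positivity)]
      have := T.pow_mul_sqrt_le (k := 5) (by norm_num)
      have h3 : 9 * √(n : ℝ) * L ^ 4 ≤ L ^ 5 * √n := by
        have : 9 * L ^ 4 ≤ L ^ 5 := by nlinarith [T.hL, pow_pos hL 4]
        nlinarith [T.sqrt_pos]
      linarith
    have h2 := T.pow_le_sqrt (k := 0) (by norm_num)
    rw [pow_zero] at h2
    linarith
  have hsub : ((cls d Y).filter fun G => ((sd Y G a b).card : ℝ) < r) ⊆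
      (Finset.univ.filter fun c => c ≠ a ∧ c ≠ b).biUnion fun c => twin d Y a b c t k := by
    intro G hG
    rw [Finset.mem_filter] at hG
    obtain ⟨c, hca, hcb, hc⟩ := exists_large_sd T hY hG.1 a b
    rw [Finset.mem_biUnion]
    refine ⟨c, by simp [hca, hcb], ?_⟩
    rw [twin, Finset.mem_filter]
    exact ⟨hG.1, Nat.le_floor hG.2.le, hc⟩
  have h4 := pow_four_le (n := n) (by exact_mod_cast hn) h8
  have hc : ∀ c ∈ Finset.univ.filter (fun c => c ≠ a ∧ c ≠ b),
      ((twin d Y a b c t k).card : ℝ) ≤ (cls d Y).card / n ^ 4 := by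
    intro c hc
    rw [Finset.mem_filter] at hc
    have := twin_iter T hY hab (Ne.symm hc.2.1) (Ne.symm hc.2.2) (k := k) le_rfl t t (by linarith)
    rw [le_div_iff₀ (by positivity), mul_comm]
    refine le_trans ?_ this
    gcongr
  calc (((cls d Y).filter fun G => ((sd Y G a b).card : ℝ) < r).card : ℝ)
      ≤ ∑ c ∈ Finset.univ.filter (fun c => c ≠ a ∧ c ≠ b), ((twin d Y a b c t k).card : ℝ) := by
        exact_mod_cast (Finset.card_le_card hsub).trans Finset.card_biUnion_le
    _ ≤ ∑ c ∈ Finset.univ.filter (fun c => c ≠ a ∧ c ≠ b), ((cls d Y).card : ℝ) / n ^ 4 :=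
        Finset.sum_le_sum hc
    _ ≤ n * ((cls d Y).card / n ^ 4) := by
        rw [Finset.sum_const, nsmul_eq_mul]
        gcongr
        exact (Finset.card_le_univ _).trans (by simp)
    _ = _ := by field_simp

/-- The mean of `f` over the graphs with degree sequence `d` containing `Y`. -/
noncomputable def ev {n : ℕ} (d : Fin n → ℕ) (Y : SimpleGraph (Fin n))
    (f : SimpleGraph (Fin n) → ℝ) : ℝ := (∑ G ∈ cls d Y, f G) / (cls d Y).card

section ev

variable {n : ℕ} {d : Fin n → ℕ} {Y : SimpleGraph (Fin n)} {f g : SimpleGraph (Fin n) → ℝ}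

lemma ev_congr (h : ∀ G ∈ cls d Y, f G = g G) : ev d Y f = ev d Y g := by
  rw [ev, ev, Finset.sum_congr rfl h]

lemma ev_add : ev d Y (fun G => f G + g G) = ev d Y f + ev d Y g := by
  simp only [ev, Finset.sum_add_distrib, add_div]

lemma ev_sub : ev d Y (fun G => f G - g G) = ev d Y f - ev d Y g := by
  simp only [ev, Finset.sum_sub_distrib, sub_div]

lemma ev_const_mul (c : ℝ) : ev d Y (fun G => c * f G) = c * ev d Y f := by
  simp only [ev, ← Finset.mul_sum, mul_div_assoc]

lemma ev_mul_const (c : ℝ) : ev d Y (fun G => f G * c) = ev d Y f * c := by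
  simp only [mul_comm _ c, ev_const_mul]

lemma ev_sum {ι : Type*} (s : Finset ι) (F : ι → SimpleGraph (Fin n) → ℝ) :
    ev d Y (fun G => ∑ i ∈ s, F i G) = ∑ i ∈ s, ev d Y (F i) := by
  simp only [ev]
  rw [Finset.sum_comm, Finset.sum_div]

lemma ev_const (hY : (cls d Y).Nonempty) (c : ℝ) : ev d Y (fun _ => c) = c := by
  have : ((cls d Y).card : ℝ) ≠ 0 := by exact_mod_cast hY.card_pos.ne'
  rw [ev, Finset.sum_const, nsmul_eq_mul, mul_div_cancel_left₀ _ this]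

lemma ev_mono (h : ∀ G ∈ cls d Y, f G ≤ g G) : ev d Y f ≤ ev d Y g := by
  unfold ev; gcongr; exact h _ ‹_›

lemma abs_ev_le : |ev d Y f| ≤ ev d Y fun G => |f G| := by
  unfold ev
  rw [abs_div, Nat.abs_cast]
  gcongr
  exact Finset.abs_sum_le_sum_abs _ _

lemma ev_nonneg (h : ∀ G ∈ cls d Y, 0 ≤ f G) : 0 ≤ ev d Y f :=
  div_nonneg (Finset.sum_nonneg h) (Nat.cast_nonneg _)

lemma ev_le_of_le (hY : (cls d Y).Nonempty) {c : ℝ} (h : ∀ G ∈ cls d Y, f G ≤ c) :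
    ev d Y f ≤ c := by
  rw [← ev_const hY c]; exact ev_mono h

lemma abs_ev_le_of_le (hY : (cls d Y).Nonempty) {c : ℝ} (h : ∀ G ∈ cls d Y, |f G| ≤ c) :
    |ev d Y f| ≤ c := abs_ev_le.trans (ev_le_of_le hY h)

lemma ev_indicator (P : SimpleGraph (Fin n) → Prop) :
    ev d Y (fun G => if P G then 1 else 0) = ((cls d Y).filter P).card / (cls d Y).card := by
  rw [ev, Finset.sum_boole]

end ev

lemma cls_sup_edge {n : ℕ} (d : Fin n → ℕ) (Y : SimpleGraph (Fin n)) {a v : Fin n} (h : a ≠ v) :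
    cls d (Y ⊔ SimpleGraph.edge a v) = (cls d Y).filter fun G => G.Adj a v := by
  ext G
  rw [Finset.mem_filter, mem_cls, mem_cls, sup_le_iff, and_assoc]
  refine and_congr_right fun _ => and_congr_right fun _ => ?_
  rw [SimpleGraph.edge_le_iff]
  simp [h]

lemma ev_ind_mul {n : ℕ} (d : Fin n → ℕ) (Y : SimpleGraph (Fin n)) {a v : Fin n} (h : a ≠ v)
    (f : SimpleGraph (Fin n) → ℝ) :
    ev d Y (fun G => ind G a v * f G) =
      ev d Y (fun G => ind G a v) * ev d (Y ⊔ SimpleGraph.edge a v) f := by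
  have h1 : ∑ G ∈ cls d Y, ind G a v * f G = ∑ G ∈ cls d (Y ⊔ SimpleGraph.edge a v), f G := by
    rw [cls_sup_edge d Y h, Finset.sum_filter]
    exact Finset.sum_congr rfl fun G _ => by unfold ind; split_ifs <;> simp
  have h2 : ∑ G ∈ cls d Y, ind G a v = (cls d (Y ⊔ SimpleGraph.edge a v)).card := by
    rw [cls_sup_edge d Y h, Finset.card_filter]
    push_cast
    rfl
  rw [ev, ev, ev, h1, h2]
  by_cases h0 : ((cls d (Y ⊔ SimpleGraph.edge a v)).card : ℝ) = 0
  · have : cls d (Y ⊔ SimpleGraph.edge a v) = ∅ := by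
      rw [← Finset.card_eq_zero]; exact_mod_cast h0
    simp [this]
  · field_simp

lemma deg_sup_edge {n : ℕ} {Y : SimpleGraph (Fin n)} {a v : Fin n} (h : a ≠ v)
    (hY : ¬ Y.Adj a v) (j : Fin n) :
    deg (Y ⊔ SimpleGraph.edge a v) j = deg Y j + (if j = a then 1 else 0) +
      (if j = v then 1 else 0) := by
  have h1 : ∀ x y, ind (Y ⊔ SimpleGraph.edge a v) x y = ind Y x y +
      ((if x = a then 1 else 0) * (if y = v then 1 else 0)) +
      ((if x = v then 1 else 0) * (if y = a then 1 else 0)) := by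
    intro x y
    have hY' : ¬ Y.Adj v a := fun h => hY h.symm
    have e1 : x = a ∧ y = v ∨ x = v ∧ y = a ∨ (¬ (x = a ∧ y = v) ∧ ¬ (x = v ∧ y = a)) := by tauto
    simp only [ind, SimpleGraph.sup_adj, SimpleGraph.edge_adj]
    rcases e1 with ⟨rfl, rfl⟩ | ⟨rfl, rfl⟩ | ⟨e1, e2⟩
    · simp [hY, h, h.symm]
    · simp [hY', h, h.symm]
    · rw [ite_zero_mul_ite_zero, ite_zero_mul_ite_zero, if_neg e1, if_neg e2]
      have : ¬ ((a = x ∧ v = y ∨ a = y ∧ v = x) ∧ x ≠ y) := by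
        rintro ⟨⟨rfl, rfl⟩ | ⟨rfl, rfl⟩, _⟩ <;> simp at e1 e2
      have : ((x = a ∧ y = v ∨ x = v ∧ y = a) ∧ x ≠ y) ↔ False := by tauto
      simp [this]
  have h2 : (deg (Y ⊔ SimpleGraph.edge a v) j : ℝ) = deg Y j + (if j = a then 1 else 0) +
      (if j = v then 1 else 0) := by
    rw [← sum_ind, ← sum_ind]
    simp only [h1, Finset.sum_add_distrib, ← Finset.mul_sum]
    simp
  exact_mod_cast h2

lemma deg_sup_edge_le {n : ℕ} {Y : SimpleGraph (Fin n)} {a v : Fin n} (h : a ≠ v)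
    (hY : ¬ Y.Adj a v) {M : ℕ} (hM : ∀ j, deg Y j ≤ M) (j : Fin n) :
    deg (Y ⊔ SimpleGraph.edge a v) j ≤ M + 1 := by
  have := hM j
  rw [deg_sup_edge h hY]
  by_cases h1 : j = a <;> by_cases h2 : j = v
  · exact absurd (h1.symm.trans h2) h
  all_goals simp [h1, h2]
  · rw [h1] at this; simp [h]; omega
  · rw [h2] at this; simp [h.symm]; omega
  · omega

/-- The deviation of the degree of `j` from the mean. -/
noncomputable def dl {n : ℕ} (d : Fin n → ℕ) (j : Fin n) : ℝ := d j - dbar n d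

/-- First-order approximation of the probability of the edge `av`. -/
noncomputable def pp {n : ℕ} (d : Fin n → ℕ) (a v : Fin n) : ℝ :=
  lam n d + (dl d a + dl d v) / n

lemma pp_bounds {n : ℕ} {d : Fin n → ℕ} {L : ℝ} (T : Tame d L) (a v : Fin n) :
    1 / (2 * L) ≤ pp d a v ∧ pp d a v ≤ 1 - 1 / (2 * L) := by
  have h1 := abs_le.1 (T.dev a)
  have h2 := abs_le.1 (T.dev v)
  have hL := T.Lpos
  have hn := T.npos
  have h3 : 2 * L * √n / n ≤ 1 / (2 * L) := by
    rw [div_le_div_iff₀ hn (by positivity)]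
    have := T.pow_mul_sqrt_le (k := 3) (by norm_num)
    have h5 : 2 * L * √n * (2 * L) ≤ L ^ 3 * √n := by
      have := T.sqrt_pos
      have := T.hL
      nlinarith [mul_pos (mul_pos hL hL) T.sqrt_pos]
    linarith
  have h4 : 1 / L = 1 / (2 * L) + 1 / (2 * L) := by field_simp; norm_num
  have h5 : (dl d a + dl d v) / n ≤ 2 * L * √n / n := by
    apply div_le_div_of_nonneg_right _ hn.le; unfold dl; linarith
  have h6 : -(2 * L * √n / n) ≤ (dl d a + dl d v) / n := by
    rw [← neg_div]
    apply div_le_div_of_nonneg_right _ hn.le; unfold dl; linarith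
  have := T.lo
  have := T.hi
  unfold pp
  constructor <;> linarith

lemma pp_mem {n : ℕ} {d : Fin n → ℕ} {L : ℝ} (T : Tame d L) (a v : Fin n) :
    0 ≤ pp d a v ∧ pp d a v ≤ 1 := by
  have h := pp_bounds T a v
  have := T.Lpos
  have : 0 < 1 / (2 * L) := by positivity
  constructor <;> linarith

/-- All conditional edge probabilities given a subgraph of maximum degree `M` are within `ξ`
of their first-order approximations. -/
def Lev {n : ℕ} (d : Fin n → ℕ) (M : ℕ) (ξ : ℝ) : Prop :=
  ∀ Y : SimpleGraph (Fin n), (∀ j, deg Y j ≤ M) → (cls d Y).Nonempty →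
    ∀ a v, a ≠ v → ¬ Y.Adj a v → |ev d Y (fun G => ind G a v) - pp d a v| ≤ ξ

/-- The pairs in the list are distinct potential edges outside `Y`. -/
def Good {n : ℕ} : SimpleGraph (Fin n) → List (Fin n × Fin n) → Prop
  | _, [] => True
  | Y, e :: E => e.1 ≠ e.2 ∧ ¬ Y.Adj e.1 e.2 ∧ Good (Y ⊔ SimpleGraph.edge e.1 e.2) E

lemma joint {n : ℕ} {d : Fin n → ℕ} {L : ℝ} (T : Tame d L) {ξ : ℝ} (hξ : 0 ≤ ξ)
    (E : List (Fin n × Fin n)) : ∀ (M : ℕ) (Y : SimpleGraph (Fin n)), Lev d (M + E.length) ξ →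
    (∀ j, deg Y j ≤ M) → (cls d Y).Nonempty → Good Y E →
    |ev d Y (fun G => (E.map fun e => ind G e.1 e.2).prod) - (E.map fun e => pp d e.1 e.2).prod| ≤
      E.length * ξ := by
  induction E with
  | nil =>
    intro M Y _ _ hne _
    simp [ev_const hne]
  | cons e E ih =>
    intro M Y hLev hM hne hG
    obtain ⟨h1, h2, h3⟩ := hG
    have hp := pp_mem T e.1 e.2
    have hprod : 0 ≤ (E.map fun e => pp d e.1 e.2).prod ∧
        (E.map fun e => pp d e.1 e.2).prod ≤ 1 := by
      clear ih hLev h3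
      induction E with
      | nil => simp
      | cons e' E ih' =>
        have := pp_mem T e'.1 e'.2
        simp only [List.map_cons, List.prod_cons]
        exact ⟨mul_nonneg this.1 ih'.1, mul_le_one₀ this.2 ih'.1 ih'.2⟩
    have hP := hLev Y (fun j => (hM j).trans (Nat.le_add_right _ _)) hne e.1 e.2 h1 h2
    simp only [List.map_cons, List.prod_cons, List.length_cons]
    rw [ev_ind_mul d Y h1]
    set P := ev d Y fun G => ind G e.1 e.2
    set B := (E.map fun e => pp d e.1 e.2).prod
    by_cases hne' : (cls d (Y ⊔ SimpleGraph.edge e.1 e.2)).Nonempty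
    · have := ih (M + 1) (Y ⊔ SimpleGraph.edge e.1 e.2)
        (by rw [List.length_cons] at hLev; convert hLev using 1; ring)
        (deg_sup_edge_le h1 h2 hM) hne' h3
      have hA : |ev d (Y ⊔ SimpleGraph.edge e.1 e.2)
          (fun G => (E.map fun e => ind G e.1 e.2).prod)| ≤ 1 := by
        refine abs_ev_le_of_le hne' fun G _ => ?_
        have : 0 ≤ (E.map fun e => ind G e.1 e.2).prod ∧
            (E.map fun e => ind G e.1 e.2).prod ≤ 1 := by
          clear ih hLev h3 this hprod
          induction E with
          | nil => simp
          | cons e' E ih' =>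
            simp only [List.map_cons, List.prod_cons]
            exact ⟨mul_nonneg (ind_nonneg _ _ _) ih'.1,
              mul_le_one₀ (ind_le_one _ _ _) ih'.1 ih'.2⟩
        rw [abs_le]; constructor <;> linarith
      set A := ev d (Y ⊔ SimpleGraph.edge e.1 e.2) fun G => (E.map fun e => ind G e.1 e.2).prod
      calc |P * A - pp d e.1 e.2 * B| = |(P - pp d e.1 e.2) * A + pp d e.1 e.2 * (A - B)| := by
            congr 1; ring
        _ ≤ |P - pp d e.1 e.2| * |A| + |pp d e.1 e.2| * |A - B| := by
            rw [← abs_mul, ← abs_mul]; exact abs_add_le _ _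
        _ ≤ ξ * 1 + 1 * (E.length * ξ) := by
            gcongr
            rw [abs_le]; constructor <;> linarith
        _ = _ := by push_cast; ring
    · have h0 : ev d (Y ⊔ SimpleGraph.edge e.1 e.2)
          (fun G => (E.map fun e => ind G e.1 e.2).prod) = 0 := by
        rw [ev, Finset.not_nonempty_iff_eq_empty.1 hne']; simp
      have hP0 : P = 0 := by
        have : ∑ G ∈ cls d Y, ind G e.1 e.2 = 0 := by
          refine Finset.sum_eq_zero fun G hG => ?_
          rw [ind, if_neg]
          intro hadj
          apply hne'
          rw [cls_sup_edge d Y h1]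
          exact ⟨G, Finset.mem_filter.2 ⟨hG, hadj⟩⟩
        simp only [P, ev, this, zero_div]
      rw [hP0, zero_sub, abs_neg] at hP
      rw [h0, mul_zero, zero_sub, abs_neg, abs_mul, abs_of_nonneg hprod.1]
      push_cast
      have : 0 ≤ (E.length : ℝ) * ξ := by positivity
      have : |pp d e.1 e.2| * B ≤ ξ * 1 := mul_le_mul hP hprod.2 hprod.1 hξ
      linarith

/-- The probability of the edge `av` given that the edges of `Y` are present. -/
noncomputable def pr {n : ℕ} (d : Fin n → ℕ) (Y : SimpleGraph (Fin n)) (a v : Fin n) : ℝ :=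
  ev d Y fun G => ind G a v

/-- The vertices that can be joined to `v` by an edge outside `Y`. -/
noncomputable def avail {n : ℕ} (Y : SimpleGraph (Fin n)) (v : Fin n) : Finset (Fin n) :=
  Finset.univ.filter fun b => b ≠ v ∧ ¬ Y.Adj v b

lemma mem_avail {n : ℕ} {Y : SimpleGraph (Fin n)} {v b : Fin n} :
    b ∈ avail Y v ↔ b ≠ v ∧ ¬ Y.Adj v b := by simp [avail]

lemma sum_avail {n : ℕ} (Y : SimpleGraph (Fin n)) (v : Fin n) (f : Fin n → ℝ) :
    ∑ b ∈ avail Y v, f b = ∑ b, f b - f v - ∑ b, ind Y v b * f b := by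
  rw [avail, Finset.sum_filter]
  have : f v = ∑ b, (if b = v then f b else 0) := by simp
  rw [this, ← Finset.sum_sub_distrib, ← Finset.sum_sub_distrib]
  refine Finset.sum_congr rfl fun b _ => ?_
  by_cases h : b = v
  · subst h; simp [ind]
  · by_cases h2 : Y.Adj v b <;> simp [ind, h, h2]

lemma card_avail {n : ℕ} (Y : SimpleGraph (Fin n)) (v : Fin n) :
    ((avail Y v).card : ℝ) = n - 1 - deg Y v := by
  have h := sum_avail Y v fun _ => 1
  simpa [sum_ind] using h

lemma sum_pr_avail {n : ℕ} {d : Fin n → ℕ} {Y : SimpleGraph (Fin n)} (hne : (cls d Y).Nonempty)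
    (v : Fin n) : ∑ b ∈ avail Y v, pr d Y b v = d v - deg Y v := by
  simp only [pr]
  rw [← ev_sum, ← ev_const hne ((d v : ℝ) - deg Y v)]
  refine ev_congr fun G hG => ?_
  rw [mem_cls] at hG
  rw [sum_avail, ind_self]
  have h1 : ∀ b, ind Y v b * ind G b v = ind Y v b := by
    intro b
    by_cases h : Y.Adj v b
    · have := (hG.2 h).symm
      simp [ind, h, this]
    · simp [ind, h]
  rw [Finset.sum_congr rfl fun b _ => h1 b]
  simp only [ind_comm G _ v, sum_ind, hG.1]
  ring

lemma avail_rule {n : ℕ} {d : Fin n → ℕ} {L : ℝ} (T : Tame d L)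
    {Y : SimpleGraph (Fin n)} (hne : (cls d Y).Nonempty) (a v : Fin n) :
    ((n : ℝ) - 1 - deg Y v) * (pr d Y a v - lam n d) =
      dl d v - (1 - lam n d) * deg Y v + ∑ b ∈ avail Y v, (pr d Y a v - pr d Y b v) := by
  rw [Finset.sum_sub_distrib, sum_pr_avail hne, Finset.sum_const, nsmul_eq_mul, card_avail, dl,
    T.dbar_eq]
  ring

/-- The indicator that `v` is adjacent to exactly one of `a`, `b`. -/
noncomputable def one {n : ℕ} (Y : SimpleGraph (Fin n)) (a b v : Fin n)
    (G : SimpleGraph (Fin n)) : ℝ := if v ∈ sd Y G a b then 1 else 0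

lemma one_nonneg {n : ℕ} (Y : SimpleGraph (Fin n)) (a b v : Fin n) (G : SimpleGraph (Fin n)) :
    0 ≤ one Y a b v G := by unfold one; split_ifs <;> norm_num

lemma one_le_one {n : ℕ} (Y : SimpleGraph (Fin n)) (a b v : Fin n) (G : SimpleGraph (Fin n)) :
    one Y a b v G ≤ 1 := by unfold one; split_ifs <;> norm_num

lemma pr_sub {n : ℕ} {d : Fin n → ℕ} {Y : SimpleGraph (Fin n)} {a b v : Fin n}
    (hab : a ≠ b) (hv : Free Y a b v) :
    pr d Y a v - pr d Y b v = ev d Y fun G => one Y a b v G *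
      ((d a - d b - ∑ w ∈ bound Y a b, (ind G a w - ind G b w)) / (sd Y G a b).card) := by
  rw [pr, pr, ← ev_sub, ev, ev, sum_ind_sub hab hv]
  congr 1
  refine Finset.sum_congr rfl fun G hG => ?_
  rw [dif_sub_dif hab hG, one]
  split_ifs <;> simp

lemma ev_div_sd {n : ℕ} {d : Fin n → ℕ} {L : ℝ} (T : Tame d L)
    {Y : SimpleGraph (Fin n)} (hY : ∀ j, (deg Y j : ℝ) ≤ L) (hne : (cls d Y).Nonempty)
    {a b v : Fin n} (hab : a ≠ b) {f : SimpleGraph (Fin n) → ℝ} {F : ℝ}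
    (hf : ∀ G ∈ cls d Y, 0 ≤ f G ∧ f G ≤ F) :
    ev d Y (fun G => one Y a b v G * (f G / (sd Y G a b).card)) ≤
      L ^ 4 / n * ev d Y f + F / n ^ 3 := by
  have hL := T.Lpos
  have hn := T.npos
  have hF : 0 ≤ F := by obtain ⟨G, hG⟩ := hne; exact (hf G hG).1.trans (hf G hG).2
  have h1 : ev d Y (fun G => if ((sd Y G a b).card : ℝ) < n / L ^ 4 then 1 else 0) ≤ 1 / n ^ 3 := by
    rw [ev_indicator]
    have := card_small_sd T hY hab
    have h0 : (0 : ℝ) < (cls d Y).card := by exact_mod_cast hne.card_pos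
    rw [div_le_div_iff₀ h0 (by positivity)]
    rw [le_div_iff₀ (by positivity)] at this
    linarith
  have h2 : ev d Y (fun G => one Y a b v G * (f G / (sd Y G a b).card)) ≤
      ev d Y (fun G => L ^ 4 / n * f G +
        F * (if ((sd Y G a b).card : ℝ) < n / L ^ 4 then 1 else 0)) := by
    refine ev_mono fun G hG => ?_
    obtain ⟨f0, f1⟩ := hf G hG
    have e0 : 0 ≤ L ^ 4 / n * f G := by positivity
    by_cases hv : v ∈ sd Y G a b
    · have hK : (1 : ℝ) ≤ (sd Y G a b).card := by exact_mod_cast Finset.card_pos.2 ⟨v, hv⟩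
      rw [one, if_pos hv, one_mul]
      split_ifs with hs
      · have : f G / (sd Y G a b).card ≤ F := (div_le_self f0 hK).trans f1
        linarith
      · rw [not_lt, div_le_iff₀ (by positivity)] at hs
        rw [mul_zero, add_zero, div_le_iff₀ (by positivity), mul_assoc, mul_comm (f G), ← mul_assoc]
        refine le_mul_of_one_le_left f0 ?_
        rw [div_mul_eq_mul_div, le_div_iff₀ hn]
        linarith
    · rw [one, if_neg hv, zero_mul]
      have : 0 ≤ F * (if ((sd Y G a b).card : ℝ) < n / L ^ 4 then 1 else 0) := by
        split_ifs <;> simp [hF]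
      linarith
  rw [ev_add, ev_const_mul, ev_const_mul] at h2
  calc _ ≤ _ := h2
    _ ≤ L ^ 4 / n * ev d Y f + F * (1 / n ^ 3) := by gcongr
    _ = _ := by ring

lemma free_of_avail {n : ℕ} {Y : SimpleGraph (Fin n)} {a b v : Fin n} (ha : a ∈ avail Y v)
    (hb : b ∈ avail Y v) : Free Y a b v := by
  rw [mem_avail] at ha hb
  exact ⟨ha.1.symm, hb.1.symm, fun h => ha.2 h.symm, fun h => hb.2 h.symm⟩

lemma sum_ind_sub_abs_le {n : ℕ} (G : SimpleGraph (Fin n)) (a b w : Fin n) :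
    |ind G a w - ind G b w| ≤ 1 := by
  rw [abs_le]
  constructor <;>
    linarith [ind_nonneg G a w, ind_nonneg G b w, ind_le_one G a w, ind_le_one G b w]

lemma coarse_sub {n : ℕ} {d : Fin n → ℕ} {L : ℝ} (T : Tame d L)
    {Y : SimpleGraph (Fin n)} (hY : ∀ j, (deg Y j : ℝ) ≤ L) (hne : (cls d Y).Nonempty)
    {a b v : Fin n} (hab : a ≠ b) (hv : Free Y a b v) :
    |pr d Y a v - pr d Y b v| ≤ L ^ 6 / √n := by
  have hL := T.Lpos
  have hn := T.npos
  have hs := T.sqrt_pos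
  have h1 := T.pow_le_sqrt (k := 0) (by norm_num)
  rw [pow_zero] at h1
  rw [pr_sub hab hv]
  have key := ev_div_sd T hY hne (v := v) hab (f := fun _ => 4 * L * √n) (F := 4 * L * √n)
    (fun G _ => ⟨by positivity, le_rfl⟩)
  rw [ev_const hne] at key
  have h2 : |ev d Y fun G => one Y a b v G *
      ((d a - d b - ∑ w ∈ bound Y a b, (ind G a w - ind G b w)) / (sd Y G a b).card)| ≤
      ev d Y (fun G => one Y a b v G * ((4 * L * √n) / (sd Y G a b).card)) := by
    refine abs_ev_le.trans (ev_mono fun G hG => ?_)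
    rw [abs_mul, abs_div, abs_of_nonneg (one_nonneg _ _ _ _ _), Nat.abs_cast]
    have e0 := one_nonneg Y a b v G
    gcongr
    rw [← dif_sub_dif hab hG]
    have e1 := abs_dif_sub_dif_le hab hG
    have e2 := T.abs_sub_le a b
    have := hY a
    have := hY b
    nlinarith
  refine h2.trans (key.trans ?_)
  have h3 : 4 * L * √n / n ^ 3 ≤ 4 * L * √n / n := by
    gcongr
    have := T.n_ge
    nlinarith [sq_nonneg ((n : ℝ) - 1), pow_pos hn 2]
  have h4 : √(n : ℝ) / n = 1 / √n := by
    rw [div_eq_div_iff hn.ne' hs.ne']; linarith [T.sqrt_mul]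
  calc L ^ 4 / n * (4 * L * √n) + 4 * L * √n / n ^ 3
      ≤ L ^ 4 / n * (4 * L * √n) + 4 * L * √n / n := by gcongr
    _ = (4 * L ^ 5 + 4 * L) * (√n / n) := by ring
    _ = (4 * L ^ 5 + 4 * L) / √n := by rw [h4]; ring
    _ ≤ L ^ 6 / √n := by
        gcongr
        have hL' := T.hL
        have : L ≤ L ^ 5 := by
          calc L = L ^ 1 := (pow_one L).symm
            _ ≤ L ^ 5 := pow_le_pow_right₀ T.one_le (by norm_num)
        nlinarith [pow_pos hL 5]

lemma lev_coarse {n : ℕ} {d : Fin n → ℕ} {L : ℝ} (T : Tame d L) {M : ℕ} (hM : (M : ℝ) ≤ L) :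
    Lev d M (L ^ 7 / √n) := by
  intro Y hYM hne a v hav hYav
  have hY : ∀ j, (deg Y j : ℝ) ≤ L := fun j => by
    have : (deg Y j : ℝ) ≤ M := by exact_mod_cast hYM j
    linarith
  have hL := T.Lpos
  have hL' := T.hL
  have hn := T.npos
  have hs := T.sqrt_pos
  have hss := T.sqrt_mul
  have h1 := T.pow_le_sqrt (k := 3) (by norm_num)
  have ha : a ∈ avail Y v := mem_avail.2 ⟨hav, fun h => hYav h.symm⟩
  have hrule := avail_rule T hne a v
  have hsum : |∑ b ∈ avail Y v, (pr d Y a v - pr d Y b v)| ≤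
      ((n : ℝ) - 1 - deg Y v) * (L ^ 6 / √n) := by
    rw [← card_avail, ← nsmul_eq_mul]
    refine (Finset.abs_sum_le_sum_abs _ _).trans (Finset.sum_le_card_nsmul _ _ _ fun b hb => ?_)
    by_cases hab : a = b
    · subst hab; rw [sub_self, abs_zero]; positivity
    · exact coarse_sub T hY hne hab (free_of_avail ha hb)
  have hN : (n : ℝ) / 2 ≤ n - 1 - deg Y v := by
    have := hY v
    have : L ^ 2 ≤ n := T.pow_le (by norm_num)
    nlinarith
  set N : ℝ := n - 1 - deg Y v
  have hlam : 0 ≤ lam n d ∧ lam n d ≤ 1 := by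
    have := T.lo; have := T.hi; have := T.inv_L_nonneg; constructor <;> linarith
  have hNpos : 0 < N := by linarith
  have h2 : |dl d v - (1 - lam n d) * deg Y v| ≤ 2 * L * √n := by
    have e1 := T.dev v
    have e2 : |(1 - lam n d) * deg Y v| ≤ 1 * L := by
      rw [abs_mul, Nat.abs_cast]
      gcongr
      · rw [abs_le]; constructor <;> linarith
      · exact hY v
    have e3 : L ≤ L * √n := by
      have : 1 ≤ √(n : ℝ) := by have := T.pow_le_sqrt (k := 0) (by norm_num); simpa using this
      nlinarith
    refine (abs_sub _ _).trans ?_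
    unfold dl; linarith
  have h3 : |pr d Y a v - lam n d| ≤ 4 * L / √n + L ^ 6 / √n := by
    have e1 : N * |pr d Y a v - lam n d| ≤ 2 * L * √n + N * (L ^ 6 / √n) := by
      rw [← abs_of_pos hNpos, ← abs_mul, hrule, abs_of_pos hNpos]
      exact (abs_add_le _ _).trans (add_le_add h2 hsum)
    have e2 : 2 * L * √n ≤ N * (4 * L / √n) := by
      calc 2 * L * √n = n / 2 * (4 * L / √n) := by
            field_simp
            nlinarith
        _ ≤ _ := by gcongr
    have : N * |pr d Y a v - lam n d| ≤ N * (4 * L / √n + L ^ 6 / √n) := by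
      rw [mul_add]; linarith
    exact le_of_mul_le_mul_left this hNpos
  have h4 : |(dl d a + dl d v) / n| ≤ 2 * L / √n := by
    rw [abs_div, abs_of_pos hn, div_le_div_iff₀ hn hs]
    have e : |dl d a + dl d v| ≤ 2 * L * √n := by
      refine (abs_add_le _ _).trans ?_
      have := T.dev a
      have := T.dev v
      unfold dl; linarith
    calc |dl d a + dl d v| * √n ≤ 2 * L * √n * √n := by gcongr
      _ = 2 * L * n := by rw [mul_assoc, hss]
  change |pr d Y a v - pp d a v| ≤ _
  have h5 : pr d Y a v - pp d a v = (pr d Y a v - lam n d) - (dl d a + dl d v) / n := by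
    unfold pp; ring
  rw [h5]
  refine (abs_sub _ _).trans ((add_le_add h3 h4).trans ?_)
  rw [← add_div, ← add_div]
  gcongr
  have : L ≤ L ^ 6 := by
    calc L = L ^ 1 := (pow_one L).symm
      _ ≤ L ^ 6 := pow_le_pow_right₀ T.one_le (by norm_num)
  nlinarith [pow_pos hL 6]

lemma Lev.mono {n : ℕ} {d : Fin n → ℕ} {M M' : ℕ} {ξ : ℝ} (h : Lev d M' ξ) (hM : M ≤ M') :
    Lev d M ξ := fun Y hY => h Y fun j => (hY j).trans hM

/-- First-order approximation of the probability that `v` is joined to exactly one of `a`, `b`. -/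
noncomputable def pone {n : ℕ} (d : Fin n → ℕ) (a b v : Fin n) : ℝ :=
  pp d a v + pp d b v - 2 * (pp d a v * pp d b v)

lemma one_eq {n : ℕ} {Y : SimpleGraph (Fin n)} {a b v : Fin n} (hv : Free Y a b v)
    (G : SimpleGraph (Fin n)) :
    one Y a b v G = ind G a v + ind G b v - 2 * (ind G a v * ind G b v) := by
  by_cases h1 : G.Adj a v <;> by_cases h2 : G.Adj b v <;> simp [one, ind, mem_sd, hv, h1, h2]
  norm_num

lemma pone_mem {n : ℕ} {d : Fin n → ℕ} {L : ℝ} (T : Tame d L) (a b v : Fin n) :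
    0 ≤ pone d a b v ∧ pone d a b v ≤ 1 := by
  have h1 := pp_mem T a v
  have h2 := pp_mem T b v
  unfold pone
  constructor <;> nlinarith [mul_nonneg h1.1 (sub_nonneg.2 h2.2),
    mul_nonneg h2.1 (sub_nonneg.2 h1.2), mul_nonneg (sub_nonneg.2 h1.2) (sub_nonneg.2 h2.2),
    mul_nonneg h1.1 h2.1]

lemma le_pone {n : ℕ} {d : Fin n → ℕ} {L : ℝ} (T : Tame d L) (a b v : Fin n) :
    1 / (2 * L) ≤ pone d a b v := by
  have h1 := pp_bounds T a v
  have h2 := pp_bounds T b v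
  have := T.Lpos
  have h3 : 0 < 1 / (2 * L) := by positivity
  unfold pone
  nlinarith [mul_nonneg (sub_nonneg.2 h1.1) (sub_nonneg.2 h2.2),
    mul_nonneg (sub_nonneg.2 h2.1) (sub_nonneg.2 h1.2)]

lemma joint_le_four {n : ℕ} {d : Fin n → ℕ} {L : ℝ} (T : Tame d L) {ξ : ℝ} (hξ : 0 ≤ ξ) {M : ℕ}
    (hLev : Lev d (M + 4) ξ) {Y : SimpleGraph (Fin n)} (hY : ∀ j, deg Y j ≤ M)
    (hne : (cls d Y).Nonempty) (E : List (Fin n × Fin n)) (hE : E.length ≤ 4) (hG : Good Y E) :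
    |ev d Y (fun G => (E.map fun e => ind G e.1 e.2).prod) - (E.map fun e => pp d e.1 e.2).prod| ≤
      E.length * ξ :=
  joint T hξ E M Y (hLev.mono (by omega)) hY hne hG

section step

variable {n : ℕ} {d : Fin n → ℕ} {L : ℝ} {ξ : ℝ} {M : ℕ} {Y : SimpleGraph (Fin n)} {a b : Fin n}

lemma abs_ev_one_sub_le (T : Tame d L) (hξ : 0 ≤ ξ) (hLev : Lev d (M + 4) ξ)
    (hY : ∀ j, deg Y j ≤ M) (hne : (cls d Y).Nonempty) (hab : a ≠ b) {v : Fin n}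
    (hv : Free Y a b v) : |ev d Y (one Y a b v) - pone d a b v| ≤ 6 * ξ := by
  obtain ⟨h1, h2, h3, h4⟩ := id hv
  have hs1 := h1.symm
  have hs2 := h2.symm
  have hs3 := hab.symm
  have J := joint_le_four T hξ hLev hY hne
  have e1 := J [(a, v)] (by simp) (by simp [Good, *])
  have e2 := J [(b, v)] (by simp) (by simp [Good, *])
  have e3 := J [(a, v), (b, v)] (by simp)
    (by simp [Good, SimpleGraph.edge_adj, *])
  simp only [List.map_cons, List.prod_cons, List.map_nil, List.prod_nil, mul_one,
    List.length_cons, List.length_nil] at e1 e2 e3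
  have : ev d Y (one Y a b v) = ev d Y (fun G => ind G a v) + ev d Y (fun G => ind G b v) -
      2 * ev d Y (fun G => ind G a v * ind G b v) := by
    rw [← ev_const_mul, ← ev_add, ← ev_sub]
    exact ev_congr fun G _ => one_eq hv G
  rw [this, pone]
  push_cast at e1 e2 e3
  rw [abs_le] at *
  constructor <;> linarith [e1.1, e1.2, e2.1, e2.2, e3.1, e3.2]

lemma abs_ev_one_mul_one_sub_le (T : Tame d L) (hξ : 0 ≤ ξ) (hLev : Lev d (M + 4) ξ)
    (hY : ∀ j, deg Y j ≤ M) (hne : (cls d Y).Nonempty) (hab : a ≠ b) {v w : Fin n}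
    (hv : Free Y a b v) (hw : Free Y a b w) (hvw : v ≠ w) :
    |ev d Y (fun G => one Y a b v G * one Y a b w G) - pone d a b v * pone d a b w| ≤ 48 * ξ := by
  obtain ⟨h1, h2, h3, h4⟩ := id hv
  obtain ⟨g1, g2, g3, g4⟩ := id hw
  have hs1 := h1.symm
  have hs2 := h2.symm
  have hs3 := hab.symm
  have hs4 := g1.symm
  have hs5 := g2.symm
  have hs6 := hvw.symm
  have J := joint_le_four T hξ hLev hY hne
  have e1 := J [(a, v), (a, w)] (by simp)
    (by simp [Good, SimpleGraph.edge_adj, *])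
  have e2 := J [(a, v), (b, w)] (by simp)
    (by simp [Good, SimpleGraph.edge_adj, *])
  have e3 := J [(b, v), (a, w)] (by simp)
    (by simp [Good, SimpleGraph.edge_adj, *])
  have e4 := J [(b, v), (b, w)] (by simp)
    (by simp [Good, SimpleGraph.edge_adj, *])
  have e5 := J [(a, v), (a, w), (b, w)] (by simp)
    (by simp [Good, SimpleGraph.edge_adj, *])
  have e6 := J [(b, v), (a, w), (b, w)] (by simp)
    (by simp [Good, SimpleGraph.edge_adj, *])
  have e7 := J [(a, v), (b, v), (a, w)] (by simp)
    (by simp [Good, SimpleGraph.edge_adj, *])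
  have e8 := J [(a, v), (b, v), (b, w)] (by simp)
    (by simp [Good, SimpleGraph.edge_adj, *])
  have e9 := J [(a, v), (b, v), (a, w), (b, w)] (by simp)
    (by simp [Good, SimpleGraph.edge_adj, *])
  simp only [List.map_cons, List.prod_cons, List.map_nil, List.prod_nil, mul_one,
    List.length_cons, List.length_nil] at e1 e2 e3 e4 e5 e6 e7 e8 e9
  have : ev d Y (fun G => one Y a b v G * one Y a b w G) =
      ev d Y (fun G => ind G a v * ind G a w) + ev d Y (fun G => ind G a v * ind G b w) +
      ev d Y (fun G => ind G b v * ind G a w) + ev d Y (fun G => ind G b v * ind G b w) -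
      2 * ev d Y (fun G => ind G a v * (ind G a w * ind G b w)) -
      2 * ev d Y (fun G => ind G b v * (ind G a w * ind G b w)) -
      2 * ev d Y (fun G => ind G a v * (ind G b v * ind G a w)) -
      2 * ev d Y (fun G => ind G a v * (ind G b v * ind G b w)) +
      4 * ev d Y (fun G => ind G a v * (ind G b v * (ind G a w * ind G b w))) := by
    simp only [← ev_const_mul, ← ev_add, ← ev_sub]
    exact ev_congr fun G _ => by rw [one_eq hv, one_eq hw]; ring
  rw [this, pone, pone]
  push_cast at e1 e2 e3 e4 e5 e6 e7 e8 e9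
  rw [abs_le] at *
  constructor <;> linarith [e1.1, e1.2, e2.1, e2.2, e3.1, e3.2, e4.1, e4.2, e5.1, e5.2,
    e6.1, e6.2, e7.1, e7.2, e8.1, e8.2, e9.1, e9.2]

/-- The probability, to leading order, that `aw` is an edge. -/
noncomputable def tt (d : Fin n → ℕ) (Y : SimpleGraph (Fin n)) (a w : Fin n) : ℝ :=
  lam n d + (1 - lam n d) * ind Y a w

lemma abs_ev_one_mul_ind_sub_le (T : Tame d L) (hξ : 0 ≤ ξ) (hLev : Lev d (M + 4) ξ)
    (hY : ∀ j, deg Y j ≤ M) (hne : (cls d Y).Nonempty) (hab : a ≠ b) {v w c : Fin n}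
    (hv : Free Y a b v) (hw : w ∈ bound Y a b) (hc : c = a ∨ c = b) :
    |ev d Y (fun G => one Y a b v G * ind G c w) - pone d a b v * tt d Y c w| ≤
      10 * ξ + 2 * L / √n := by
  have hL := T.Lpos
  have hs := T.sqrt_pos
  obtain ⟨h1, h2, h3, h4⟩ := id hv
  obtain ⟨g1, g2, g3⟩ := mem_bound.1 hw
  have hvw : v ≠ w := by rintro rfl; tauto
  have hp := pone_mem T a b v
  by_cases hadj : Y.Adj c w
  · have e1 : ev d Y (fun G => one Y a b v G * ind G c w) = ev d Y (one Y a b v) := by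
      refine ev_congr fun G hG => ?_
      rw [ind, if_pos ((mem_cls.1 hG).2 hadj), mul_one]
    have e2 : tt d Y c w = 1 := by rw [tt, ind, if_pos hadj]; ring
    rw [e1, e2, mul_one]
    have := abs_ev_one_sub_le T hξ hLev hY hne hab hv
    have : 0 ≤ 2 * L / √(n : ℝ) := by positivity
    linarith
  · have hcw : c ≠ w := by rcases hc with rfl | rfl; exacts [g1.symm, g2.symm]
    have hvc : v ≠ c := by rcases hc with rfl | rfl; exacts [h1, h2]
    have hs1 := h1.symm
    have hs2 := h2.symm
    have hs3 := hab.symm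
    have hs4 := hvc.symm
    have hs6 := hvw.symm
    have J := joint_le_four T hξ hLev hY hne
    have e1 := J [(a, v), (c, w)] (by simp)
      (by simp [Good, SimpleGraph.edge_adj, *])
    have e2 := J [(b, v), (c, w)] (by simp)
      (by simp [Good, SimpleGraph.edge_adj, *])
    have e3 := J [(a, v), (b, v), (c, w)] (by simp)
      (by simp [Good, SimpleGraph.edge_adj, *])
    simp only [List.map_cons, List.prod_cons, List.map_nil, List.prod_nil, mul_one,
      List.length_cons, List.length_nil] at e1 e2 e3
    have : ev d Y (fun G => one Y a b v G * ind G c w) =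
        ev d Y (fun G => ind G a v * ind G c w) + ev d Y (fun G => ind G b v * ind G c w) -
        2 * ev d Y (fun G => ind G a v * (ind G b v * ind G c w)) := by
      simp only [← ev_const_mul, ← ev_add, ← ev_sub]
      exact ev_congr fun G _ => by rw [one_eq hv]; ring
    have e4 : |ev d Y (fun G => one Y a b v G * ind G c w) - pone d a b v * pp d c w| ≤
        10 * ξ := by
      rw [this, pone]
      push_cast at e1 e2 e3
      rw [abs_le] at *
      constructor <;> linarith [e1.1, e1.2, e2.1, e2.2, e3.1, e3.2]
    have e5 : |pone d a b v * (pp d c w - tt d Y c w)| ≤ 1 * (2 * L / √n) := by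
      rw [abs_mul, abs_of_nonneg hp.1]
      gcongr
      · exact hp.2
      · rw [tt, ind, if_neg hadj, pp]
        have : lam n d + (dl d c + dl d w) / n - (lam n d + (1 - lam n d) * 0) =
          (dl d c + dl d w) / n := by ring
        rw [this, abs_div, abs_of_pos T.npos, div_le_div_iff₀ T.npos hs]
        have e : |dl d c + dl d w| ≤ 2 * L * √n := by
          refine (abs_add_le _ _).trans ?_
          have := T.dev c
          have := T.dev w
          unfold dl; linarith
        calc |dl d c + dl d w| * √n ≤ 2 * L * √n * √n := by gcongr
          _ = 2 * L * n := by rw [mul_assoc, T.sqrt_mul]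
    have e6 : ev d Y (fun G => one Y a b v G * ind G c w) - pone d a b v * tt d Y c w =
      (ev d Y (fun G => one Y a b v G * ind G c w) - pone d a b v * pp d c w) +
        pone d a b v * (pp d c w - tt d Y c w) := by ring
    rw [e6]
    refine (abs_add_le _ _).trans ?_
    linarith

lemma sum_bound_tt (hab : a ≠ b) :
    ∑ w ∈ bound Y a b, (tt d Y a w - tt d Y b w) =
      (1 - lam n d) * ((deg Y a : ℝ) - deg Y b) := by
  have h0 : ∀ w, tt d Y a w - tt d Y b w = (1 - lam n d) * (ind Y a w - ind Y b w) := by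
    intro w; unfold tt; ring
  simp only [h0, ← Finset.mul_sum]
  congr 1
  rw [← sum_ind, ← sum_ind, ← Finset.sum_sub_distrib, bound, Finset.sum_filter]
  have h3 : ∑ w, (if w = a ∨ w = b then ind Y a w - ind Y b w else 0) = 0 := by
    have : ∀ w, (if w = a ∨ w = b then ind Y a w - ind Y b w else 0) =
        (if w = a then ind Y a w - ind Y b w else 0) +
        (if w = b then ind Y a w - ind Y b w else 0) := by
      intro w
      by_cases h : w = a
      · subst h; simp [hab]
      · simp [h]
    simp only [this, Finset.sum_add_distrib]
    simp [ind_self, ind_comm Y b a]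
  refine (sub_eq_zero.1 (Eq.trans ?_ h3)).symm
  rw [← Finset.sum_sub_distrib]
  refine Finset.sum_congr rfl fun w _ => ?_
  by_cases e1 : w = a <;> by_cases e2 : w = b <;> by_cases e3 : Y.Adj a w <;>
    by_cases e4 : Y.Adj b w <;> simp [ind, e1, e2, e3, e4]

end step

section moments

variable {n : ℕ} {d : Fin n → ℕ} {L : ℝ} {ξ : ℝ} {M : ℕ} {Y : SimpleGraph (Fin n)} {a b : Fin n}

/-- The vertices free for `a`, `b`. -/
noncomputable def frees (Y : SimpleGraph (Fin n)) (a b : Fin n) : Finset (Fin n) :=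
  Finset.univ.filter (Free Y a b)

lemma mem_frees {w : Fin n} : w ∈ frees Y a b ↔ Free Y a b w := by simp [frees]

lemma card_frees_le : ((frees Y a b).card : ℝ) ≤ n := by
  have := Finset.card_le_univ (frees Y a b)
  rw [Fintype.card_fin] at this
  exact_mod_cast this

/-- The predicted size of `sd`. -/
noncomputable def kbar (d : Fin n → ℕ) (Y : SimpleGraph (Fin n)) (a b : Fin n) : ℝ :=
  ∑ w ∈ frees Y a b, pone d a b w

lemma card_sd_eq (G : SimpleGraph (Fin n)) :
    ((sd Y G a b).card : ℝ) = ∑ w ∈ frees Y a b, one Y a b w G := by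
  simp only [one]
  rw [Finset.sum_boole]
  congr 2
  ext w; simp only [Finset.mem_filter, mem_frees, mem_sd]; tauto

lemma card_sd_le (G : SimpleGraph (Fin n)) : ((sd Y G a b).card : ℝ) ≤ n := by
  have := Finset.card_le_univ (sd Y G a b)
  rw [Fintype.card_fin] at this
  exact_mod_cast this

lemma kbar_le (T : Tame d L) : kbar d Y a b ≤ n := by
  calc kbar d Y a b ≤ ∑ w ∈ frees Y a b, 1 := Finset.sum_le_sum fun w _ => (pone_mem T a b w).2
    _ ≤ n := by simpa using card_frees_le

lemma card_frees_ge (hY : ∀ j, (deg Y j : ℝ) ≤ L) :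
    (n : ℝ) - (2 + 2 * L) ≤ (frees Y a b).card := by
  have h1 := Finset.card_filter_add_card_filter_not (s := Finset.univ) (Free Y a b)
  rw [Finset.card_univ, Fintype.card_fin] at h1
  have h2 := card_not_free_le Y a b
  have h1' : ((frees Y a b).card : ℝ) + (Finset.univ.filter fun w => ¬ Free Y a b w).card = n := by
    exact_mod_cast h1
  have h2' : ((Finset.univ.filter fun w => ¬ Free Y a b w).card : ℝ) ≤ 2 + deg Y a + deg Y b := by
    exact_mod_cast h2
  linarith [hY a, hY b]

lemma le_kbar (T : Tame d L) (hY : ∀ j, (deg Y j : ℝ) ≤ L) : n / L ^ 2 ≤ kbar d Y a b := by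
  have hL := T.Lpos
  have hL' := T.hL
  have h1 : (frees Y a b).card • (1 / (2 * L)) ≤ kbar d Y a b :=
    Finset.card_nsmul_le_sum _ _ _ fun w _ => le_pone T a b w
  rw [nsmul_eq_mul] at h1
  refine le_trans ?_ h1
  have h2 := card_frees_ge (a := a) (b := b) hY
  have h3 : (n : ℝ) / 2 ≤ (frees Y a b).card := by
    have := T.pow_le (k := 2) (by norm_num)
    nlinarith
  calc (n : ℝ) / L ^ 2 ≤ n / 2 * (1 / (2 * L)) := by
        rw [div_mul_div_comm, div_le_div_iff₀ (by positivity) (by positivity)]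
        nlinarith [mul_pos hL T.npos]
    _ ≤ _ := by gcongr

lemma kbar_pos (T : Tame d L) (hY : ∀ j, (deg Y j : ℝ) ≤ L) : 0 < kbar d Y a b := by
  have := T.Lpos
  have := T.npos
  exact lt_of_lt_of_le (by positivity) (le_kbar T hY)

lemma abs_card_sd_sub_kbar_le (T : Tame d L) (hY : ∀ j, (deg Y j : ℝ) ≤ L)
    (G : SimpleGraph (Fin n)) : |((sd Y G a b).card : ℝ) - kbar d Y a b| ≤ n := by
  have h1 := card_sd_le (Y := Y) (a := a) (b := b) G
  have h2 := kbar_le (Y := Y) (a := a) (b := b) T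
  have h3 := kbar_pos (a := a) (b := b) T hY
  have h4 : (0 : ℝ) ≤ (sd Y G a b).card := Nat.cast_nonneg _
  rw [abs_le]; constructor <;> linarith

lemma abs_cov_le (T : Tame d L) (hξ : 1 / n ≤ ξ) (hLev : Lev d (M + 4) ξ)
    (hY : ∀ j, deg Y j ≤ M) (hne : (cls d Y).Nonempty) (hab : a ≠ b) {v : Fin n}
    (hv : Free Y a b v) :
    |ev d Y (fun G => one Y a b v G * (((sd Y G a b).card : ℝ) - kbar d Y a b))| ≤
      56 * n * ξ := by
  have hn := T.npos
  have hξ0 : 0 ≤ ξ := le_trans (by positivity) hξ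
  have e1 : ev d Y (fun G => one Y a b v G * (((sd Y G a b).card : ℝ) - kbar d Y a b)) =
      ∑ w ∈ frees Y a b, ev d Y (fun G => one Y a b v G * (one Y a b w G - pone d a b w)) := by
    rw [← ev_sum]
    refine ev_congr fun G _ => ?_
    rw [card_sd_eq, kbar, ← Finset.sum_sub_distrib, Finset.mul_sum]
  rw [e1]
  have hpt : ∀ w ∈ frees Y a b,
      |ev d Y (fun G => one Y a b v G * (one Y a b w G - pone d a b w))| ≤
      54 * ξ + if w = v then 1 else 0 := by
    intro w hw
    rw [mem_frees] at hw
    have hp := pone_mem T a b w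
    by_cases hwv : w = v
    · rw [if_pos hwv]
      have : |ev d Y (fun G => one Y a b v G * (one Y a b w G - pone d a b w))| ≤ 1 := by
        refine abs_ev_le_of_le hne fun G _ => ?_
        rw [abs_mul]
        refine mul_le_one₀ ?_ (abs_nonneg _) ?_ <;> rw [abs_le]
        · constructor <;> linarith [one_nonneg Y a b v G, one_le_one Y a b v G]
        · constructor <;> linarith [one_nonneg Y a b w G, one_le_one Y a b w G]
      linarith
    · rw [if_neg hwv, add_zero]
      have h1 := abs_ev_one_mul_one_sub_le T hξ0 hLev hY hne hab hv hw (Ne.symm hwv)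
      have h2 := abs_ev_one_sub_le T hξ0 hLev hY hne hab hv
      have e2 : ev d Y (fun G => one Y a b v G * (one Y a b w G - pone d a b w)) =
          (ev d Y (fun G => one Y a b v G * one Y a b w G) - pone d a b v * pone d a b w) -
          (ev d Y (one Y a b v) - pone d a b v) * pone d a b w := by
        have : ev d Y (fun G => one Y a b v G * (one Y a b w G - pone d a b w)) =
            ev d Y (fun G => one Y a b v G * one Y a b w G - one Y a b v G * pone d a b w) :=
          ev_congr fun G _ => by ring
        rw [this, ev_sub, ev_mul_const]
        ring
      rw [e2]
      refine (abs_sub _ _).trans ?_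
      rw [abs_mul, abs_of_nonneg hp.1]
      have : |ev d Y (one Y a b v) - pone d a b v| * pone d a b w ≤ 6 * ξ * 1 := by
        exact mul_le_mul h2 hp.2 hp.1 (by positivity)
      linarith
  refine (Finset.abs_sum_le_sum_abs _ _).trans ((Finset.sum_le_sum hpt).trans ?_)
  rw [Finset.sum_add_distrib, Finset.sum_const, nsmul_eq_mul, Finset.sum_ite_eq',
    if_pos (mem_frees.2 hv)]
  have h1 : 1 ≤ n * ξ := by rwa [div_le_iff₀ hn, mul_comm] at hξ
  have h2 : ((frees Y a b).card : ℝ) * (54 * ξ) ≤ n * (54 * ξ) := by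
    gcongr; exact_mod_cast card_frees_le (Y := Y) (a := a) (b := b)
  linarith

lemma ev_sq_le (T : Tame d L) (hξ : 1 / n ≤ ξ) (hLev : Lev d (M + 4) ξ)
    (hY : ∀ j, deg Y j ≤ M) (hne : (cls d Y).Nonempty) (hab : a ≠ b) :
    ev d Y (fun G => (((sd Y G a b).card : ℝ) - kbar d Y a b) ^ 2) ≤ 64 * n ^ 2 * ξ := by
  have hn := T.npos
  have hξ0 : 0 ≤ ξ := le_trans (by positivity) hξ
  have e1 : ev d Y (fun G => (((sd Y G a b).card : ℝ) - kbar d Y a b) ^ 2) =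
      ∑ w ∈ frees Y a b, (ev d Y (fun G => one Y a b w G *
        (((sd Y G a b).card : ℝ) - kbar d Y a b)) -
        pone d a b w * ev d Y (fun G => ((sd Y G a b).card : ℝ) - kbar d Y a b)) := by
    simp only [← ev_const_mul, ← ev_sub]
    rw [← ev_sum]
    refine ev_congr fun G _ => ?_
    have : ∀ w, one Y a b w G * (((sd Y G a b).card : ℝ) - kbar d Y a b) -
        pone d a b w * (((sd Y G a b).card : ℝ) - kbar d Y a b) =
        (one Y a b w G - pone d a b w) * (((sd Y G a b).card : ℝ) - kbar d Y a b) := by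
      intro w; ring
    simp only [this]
    rw [← Finset.sum_mul, Finset.sum_sub_distrib, ← card_sd_eq, ← kbar, sq]
  have h2 : |ev d Y (fun G => ((sd Y G a b).card : ℝ) - kbar d Y a b)| ≤ n * (6 * ξ) := by
    have : ev d Y (fun G => ((sd Y G a b).card : ℝ) - kbar d Y a b) =
        ∑ w ∈ frees Y a b, (ev d Y (one Y a b w) - pone d a b w) := by
      rw [ev_sub, ev_const hne, Finset.sum_sub_distrib, ← kbar, ← ev_sum]
      congr 1
      exact ev_congr fun G _ => card_sd_eq G
    rw [this]
    refine (Finset.abs_sum_le_sum_abs _ _).trans ?_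
    refine (Finset.sum_le_card_nsmul _ _ (6 * ξ) fun w hw =>
      abs_ev_one_sub_le T hξ0 hLev hY hne hab (mem_frees.1 hw)).trans ?_
    rw [nsmul_eq_mul]
    gcongr
    exact_mod_cast card_frees_le (Y := Y) (a := a) (b := b)
  rw [e1]
  calc _ ≤ ∑ w ∈ frees Y a b, (62 * n * ξ) := by
        refine Finset.sum_le_sum fun w hw => ?_
        have h3 := le_of_abs_le (abs_cov_le T hξ hLev hY hne hab (mem_frees.1 hw))
        have hp := pone_mem T a b w
        have h4 : |pone d a b w *
            ev d Y (fun G => ((sd Y G a b).card : ℝ) - kbar d Y a b)| ≤ 1 * (n * (6 * ξ)) := by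
          rw [abs_mul, abs_of_nonneg hp.1]
          gcongr
          exact hp.2
        linarith [neg_le_of_abs_le h4]
    _ ≤ n * (62 * n * ξ) := by
        rw [Finset.sum_const, nsmul_eq_mul]
        gcongr
        exact_mod_cast card_frees_le (Y := Y) (a := a) (b := b)
    _ ≤ _ := by nlinarith [mul_nonneg (mul_pos hn hn).le hξ0]

end moments

section inverse

variable {n : ℕ} {d : Fin n → ℕ} {L : ℝ} {ξ : ℝ} {M : ℕ} {Y : SimpleGraph (Fin n)} {a b : Fin n}

lemma one_eq_zero_of_card {v : Fin n} {G : SimpleGraph (Fin n)}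
    (h : ((sd Y G a b).card : ℝ) = 0) : one Y a b v G = 0 := by
  have : sd Y G a b = ∅ := by
    rw [← Finset.card_eq_zero]; exact_mod_cast h
  simp [one, this]

lemma inv_kbar_le (T : Tame d L) (hY : ∀ j, (deg Y j : ℝ) ≤ L) :
    1 / kbar d Y a b ≤ L ^ 2 / n := by
  have := T.Lpos
  have := T.npos
  rw [div_le_div_iff₀ (kbar_pos T hY) T.npos]
  have h := le_kbar (a := a) (b := b) T hY
  rw [div_le_iff₀ (by positivity)] at h
  linarith

lemma ev_sq_div_sd_le (T : Tame d L) (hM : (M : ℝ) ≤ L) (hξ : 1 / n ≤ ξ)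
    (hLev : Lev d (M + 4) ξ) (hY : ∀ j, deg Y j ≤ M) (hne : (cls d Y).Nonempty) (hab : a ≠ b)
    {v : Fin n} :
    ev d Y (fun G => one Y a b v G * ((((sd Y G a b).card : ℝ) - kbar d Y a b) ^ 2 /
      (sd Y G a b).card)) ≤ 65 * L ^ 4 * n * ξ := by
  have hL := T.Lpos
  have hL' := T.hL
  have hn := T.npos
  have hY' : ∀ j, (deg Y j : ℝ) ≤ L := fun j => le_trans (by exact_mod_cast hY j) hM
  refine (ev_div_sd T hY' hne hab (F := (n : ℝ) ^ 2) fun G _ => ⟨sq_nonneg _, ?_⟩).trans ?_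
  · rw [← sq_abs]
    exact pow_le_pow_left₀ (abs_nonneg _) (abs_card_sd_sub_kbar_le T hY' G) 2
  have h1 := ev_sq_le T hξ hLev hY hne hab
  have h2 : L ^ 4 / n * ev d Y (fun G => (((sd Y G a b).card : ℝ) - kbar d Y a b) ^ 2) ≤
      L ^ 4 / n * (64 * n ^ 2 * ξ) := by gcongr
  have h3 : L ^ 4 / n * (64 * n ^ 2 * ξ) = 64 * L ^ 4 * n * ξ := by field_simp
  have h4 : (n : ℝ) ^ 2 / n ^ 3 = 1 / n := by field_simp
  have h5 : ξ ≤ L ^ 4 * n * ξ := by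
    have : 0 ≤ ξ := le_trans (by positivity) hξ
    have h6 : 1 ≤ L ^ 4 * n := one_le_mul_of_one_le_of_one_le
      (one_le_pow₀ T.one_le) (by linarith [T.n_ge])
    nlinarith
  linarith

lemma abs_ev_one_div_sub_le (T : Tame d L) (hM : (M : ℝ) ≤ L) (hξ : 1 / n ≤ ξ)
    (hLev : Lev d (M + 4) ξ) (hY : ∀ j, deg Y j ≤ M) (hne : (cls d Y).Nonempty) (hab : a ≠ b)
    {v : Fin n} (hv : Free Y a b v) :
    |ev d Y (fun G => one Y a b v G / (sd Y G a b).card) - ev d Y (one Y a b v) / kbar d Y a b| ≤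
      L ^ 9 * ξ / n := by
  have hL := T.Lpos
  have hL' := T.hL
  have hn := T.npos
  have hξ0 : 0 ≤ ξ := le_trans (by positivity) hξ
  have hY' : ∀ j, (deg Y j : ℝ) ≤ L := fun j => le_trans (by exact_mod_cast hY j) hM
  have hK := kbar_pos (a := a) (b := b) T hY'
  have e1 : ev d Y (fun G => one Y a b v G / (sd Y G a b).card) -
      ev d Y (one Y a b v) / kbar d Y a b =
      (ev d Y (fun G => one Y a b v G * ((((sd Y G a b).card : ℝ) - kbar d Y a b) ^ 2 /
      (sd Y G a b).card)) -
      ev d Y (fun G => one Y a b v G * (((sd Y G a b).card : ℝ) - kbar d Y a b))) *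
      (1 / kbar d Y a b) ^ 2 := by
    have : ev d Y (one Y a b v) / kbar d Y a b =
      ev d Y (fun G => one Y a b v G * (1 / kbar d Y a b)) := by
      rw [ev_mul_const]; ring
    rw [this]
    simp only [← ev_mul_const, ← ev_sub]
    refine ev_congr fun G _ => ?_
    by_cases h0 : ((sd Y G a b).card : ℝ) = 0
    · rw [one_eq_zero_of_card h0]; simp
    · field_simp; ring
  rw [e1, abs_mul, abs_of_nonneg (sq_nonneg (1 / kbar d Y a b))]
  have h1 := abs_cov_le T hξ hLev hY hne hab hv
  have h2 := ev_sq_div_sd_le T hM hξ hLev hY hne hab (v := v)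
  have h2' : 0 ≤ ev d Y (fun G => one Y a b v G * ((((sd Y G a b).card : ℝ) - kbar d Y a b) ^ 2 /
      (sd Y G a b).card)) :=
    ev_nonneg fun G _ => mul_nonneg (one_nonneg _ _ _ _ _) (by positivity)
  have h3 : (1 / kbar d Y a b) ^ 2 ≤ (L ^ 2 / n) ^ 2 :=
    pow_le_pow_left₀ (by positivity) (inv_kbar_le T hY') 2
  have h4 : |ev d Y (fun G => one Y a b v G * ((((sd Y G a b).card : ℝ) - kbar d Y a b) ^ 2 /
      (sd Y G a b).card)) -
      ev d Y (fun G => one Y a b v G * (((sd Y G a b).card : ℝ) - kbar d Y a b))| ≤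
      L ^ 5 * (n * ξ) := by
    refine (abs_sub _ _).trans ?_
    rw [abs_of_nonneg h2']
    have h5 : 65 * L ^ 4 + 56 ≤ L ^ 5 := by
      have : 1 ≤ L ^ 4 := one_le_pow₀ T.one_le
      calc 65 * L ^ 4 + 56 ≤ 1000 * L ^ 4 := by linarith
        _ ≤ L * L ^ 4 := by gcongr
        _ = L ^ 5 := by ring
    have : (65 * L ^ 4 + 56) * (n * ξ) ≤ L ^ 5 * (n * ξ) := by gcongr
    linarith
  refine (mul_le_mul h4 h3 (by positivity) (by positivity)).trans (le_of_eq ?_)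
  field_simp

lemma abs_ev_one_mul_div_sub_le (T : Tame d L) (hM : (M : ℝ) ≤ L) (hξ : 1 / n ≤ ξ)
    (hLev : Lev d (M + 4) ξ) (hY : ∀ j, deg Y j ≤ M) (hne : (cls d Y).Nonempty) (hab : a ≠ b)
    {v : Fin n} (U : SimpleGraph (Fin n) → ℝ) (hU : ∀ G, |U G| ≤ 1) :
    |ev d Y (fun G => one Y a b v G * U G / (sd Y G a b).card) -
      ev d Y (fun G => one Y a b v G * U G) / kbar d Y a b| ≤ L ^ 8 * ξ / √n := by
  have hL := T.Lpos
  have hL' := T.hL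
  have hn := T.npos
  have hs := T.sqrt_pos
  have hξ0 : 0 ≤ ξ := le_trans (by positivity) hξ
  have hY' : ∀ j, (deg Y j : ℝ) ≤ L := fun j => le_trans (by exact_mod_cast hY j) hM
  have hK := kbar_pos (a := a) (b := b) T hY'
  have e1 : ev d Y (fun G => one Y a b v G * U G / (sd Y G a b).card) -
      ev d Y (fun G => one Y a b v G * U G) / kbar d Y a b =
      ev d Y (fun G => one Y a b v G * ((kbar d Y a b - ((sd Y G a b).card : ℝ)) * U G /
      (sd Y G a b).card) * (1 / kbar d Y a b)) := by
    have : ev d Y (fun G => one Y a b v G * U G) / kbar d Y a b =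
      ev d Y (fun G => one Y a b v G * U G * (1 / kbar d Y a b)) := by
      rw [ev_mul_const]; ring
    rw [this]
    simp only [← ev_sub]
    refine ev_congr fun G _ => ?_
    by_cases h0 : ((sd Y G a b).card : ℝ) = 0
    · rw [one_eq_zero_of_card h0]; simp
    · field_simp
  rw [e1, ev_mul_const, abs_mul, abs_of_pos (by positivity : 0 < 1 / kbar d Y a b)]
  have h1 : |ev d Y (fun G => one Y a b v G * ((kbar d Y a b - ((sd Y G a b).card : ℝ)) * U G /
      (sd Y G a b).card))| ≤ ev d Y (fun G => one Y a b v G *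
        (((((sd Y G a b).card : ℝ) - kbar d Y a b) ^ 2 / √n + √n) / (sd Y G a b).card)) := by
    refine abs_ev_le.trans (ev_mono fun G _ => ?_)
    rw [abs_mul, abs_of_nonneg (one_nonneg _ _ _ _ _), abs_div, abs_mul, Nat.abs_cast]
    refine mul_le_mul_of_nonneg_left ?_ (one_nonneg _ _ _ _ _)
    refine div_le_div_of_nonneg_right ?_ (Nat.cast_nonneg _)
    refine (mul_le_of_le_one_right (abs_nonneg _) (hU G)).trans ?_
    rw [abs_sub_comm]
    set x := |((sd Y G a b).card : ℝ) - kbar d Y a b| with hx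
    rw [← sq_abs, ← hx]
    have hx0 : 0 ≤ x := abs_nonneg _
    have : x * √n ≤ x ^ 2 + √n * √n := by nlinarith [sq_nonneg (x - √n)]
    calc x = x * √n / √n := by field_simp
      _ ≤ (x ^ 2 + √n * √n) / √n := by gcongr
      _ = _ := by field_simp
  have hsn : 1 ≤ √(n : ℝ) := by
    rw [Real.one_le_sqrt]; linarith [T.n_ge]
  have hs2 := T.sqrt_mul
  have h2 := ev_div_sd T hY' hne hab (v := v) (F := 2 * (n : ℝ) ^ 2)
    (f := fun G => (((sd Y G a b).card : ℝ) - kbar d Y a b) ^ 2 / √n + √n) fun G _ => by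
      refine ⟨by positivity, ?_⟩
      have h3 : (((sd Y G a b).card : ℝ) - kbar d Y a b) ^ 2 ≤ n ^ 2 := by
        rw [← sq_abs]
        exact pow_le_pow_left₀ (abs_nonneg _) (abs_card_sd_sub_kbar_le T hY' G) 2
      have h4 : (((sd Y G a b).card : ℝ) - kbar d Y a b) ^ 2 / √n ≤ n ^ 2 :=
        (div_le_self (sq_nonneg _) hsn).trans h3
      have h5 : √n ≤ (n : ℝ) ^ 2 := by nlinarith [T.n_ge]
      show _ ≤ _
      linarith
  have h3 : ev d Y (fun G => (((sd Y G a b).card : ℝ) - kbar d Y a b) ^ 2 / √n + √n) ≤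
      65 * n * √n * ξ := by
    rw [ev_add, ev_const hne]
    have e : ev d Y (fun G => (((sd Y G a b).card : ℝ) - kbar d Y a b) ^ 2 / √n) =
      ev d Y (fun G => (((sd Y G a b).card : ℝ) - kbar d Y a b) ^ 2) / √n := by
      simp only [div_eq_mul_inv]; rw [ev_mul_const]
    rw [e]
    have h6 := ev_sq_le T hξ hLev hY hne hab
    have h7 : ev d Y (fun G => (((sd Y G a b).card : ℝ) - kbar d Y a b) ^ 2) / √n ≤
      64 * n ^ 2 * ξ / √n := by gcongr
    have h8 : 64 * n ^ 2 * ξ / √n = 64 * n * √n * ξ := by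
      rw [div_eq_iff hs.ne']
      linear_combination (- 64 * n * ξ) * hs2
    have h9 : 1 ≤ n * ξ := by rwa [div_le_iff₀ hn, mul_comm] at hξ
    nlinarith
  have h4 : ev d Y (fun G => one Y a b v G *
        (((((sd Y G a b).card : ℝ) - kbar d Y a b) ^ 2 / √n + √n) / (sd Y G a b).card)) ≤
        L ^ 5 * √n * ξ := by
    refine h2.trans ?_
    have h5 : L ^ 4 / n * ev d Y (fun G => (((sd Y G a b).card : ℝ) - kbar d Y a b) ^ 2 / √n + √n)
      ≤ L ^ 4 / n * (65 * n * √n * ξ) := by gcongr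
    have h6 : L ^ 4 / n * (65 * n * √n * ξ) = 65 * L ^ 4 * √n * ξ := by field_simp
    have h7 : 2 * (n : ℝ) ^ 2 / n ^ 3 = 2 * (1 / n) := by field_simp
    have h8 : ξ ≤ √n * ξ := le_mul_of_one_le_left hξ0 hsn
    have h9 : 65 * L ^ 4 + 2 ≤ L ^ 5 := by
      have : 1 ≤ L ^ 4 := one_le_pow₀ T.one_le
      calc 65 * L ^ 4 + 2 ≤ 1000 * L ^ 4 := by linarith
        _ ≤ L * L ^ 4 := by gcongr
        _ = L ^ 5 := by ring
    have : (65 * L ^ 4 + 2) * (√n * ξ) ≤ L ^ 5 * (√n * ξ) := by gcongr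
    linarith
  have h5 := mul_le_mul (h1.trans h4) (inv_kbar_le (a := a) (b := b) T hY') (by positivity)
    (by positivity)
  refine h5.trans ?_
  have e : L ^ 5 * √n * ξ * (L ^ 2 / n) = L ^ 7 * ξ / √n := by
    have : L ^ 5 * √n * ξ * (L ^ 2 / n) = L ^ 7 * ξ * (√n / n) := by ring
    rw [this, Real.sqrt_div_self]; ring
  rw [e]
  gcongr
  · exact T.one_le
  · norm_num

/-- The predicted difference of edge probabilities. -/
lemma abs_pr_sub_le (T : Tame d L) (hM : (M : ℝ) ≤ L) (hξ : 1 / n ≤ ξ)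
    (hLev : Lev d (M + 4) ξ) (hY : ∀ j, deg Y j ≤ M) (hne : (cls d Y).Nonempty) (hab : a ≠ b)
    {v : Fin n} (hv : Free Y a b v) :
    |pr d Y a v - pr d Y b v - (dl d a - dl d b - (1 - lam n d) * ((deg Y a : ℝ) - deg Y b)) *
      (pone d a b v / kbar d Y a b)| ≤ L ^ 12 * ξ / √n := by
  have hL := T.Lpos
  have hL' := T.hL
  have hn := T.npos
  have hs := T.sqrt_pos
  have hs2 := T.sqrt_mul
  have hξ0 : 0 ≤ ξ := le_trans (by positivity) hξ
  have hY' : ∀ j, (deg Y j : ℝ) ≤ L := fun j => le_trans (by exact_mod_cast hY j) hM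
  have hK := kbar_pos (a := a) (b := b) T hY'
  have hik := inv_kbar_le (a := a) (b := b) T hY'
  have hsn : 1 ≤ √(n : ℝ) := by
    rw [Real.one_le_sqrt]; linarith [T.n_ge]
  set U : Fin n → SimpleGraph (Fin n) → ℝ := fun w G => ind G a w - ind G b w with hU
  set X := L * ξ / √n with hX
  have hX0 : 0 ≤ X := by positivity
  have hxin : ξ / n ≤ ξ / √n / √n := by rw [div_div, hs2]
  have hnx : 1 / √n / √n ≤ ξ := by rw [div_div, hs2]; exact hξ
  rw [pr_sub hab hv]
  have e1 : (ev d Y fun G => one Y a b v G *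
      ((d a - d b - ∑ w ∈ bound Y a b, (ind G a w - ind G b w)) / (sd Y G a b).card)) =
      (dl d a - dl d b) * ev d Y (fun G => one Y a b v G / (sd Y G a b).card) -
      ∑ w ∈ bound Y a b, ev d Y (fun G => one Y a b v G * U w G / (sd Y G a b).card) := by
    rw [← ev_const_mul, ← ev_sum, ← ev_sub]
    refine ev_congr fun G _ => ?_
    simp only [dl]
    rw [← Finset.sum_div, ← Finset.mul_sum]
    ring
  have e2 : (1 - lam n d) * ((deg Y a : ℝ) - deg Y b) * (pone d a b v / kbar d Y a b) =
      ∑ w ∈ bound Y a b, pone d a b v * (tt d Y a w - tt d Y b w) / kbar d Y a b := by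
    rw [← sum_bound_tt hab, ← Finset.sum_div, ← Finset.mul_sum]; ring
  rw [e1, sub_mul _ ((1 - lam n d) * _), e2]
  have k1 : |(dl d a - dl d b) * ev d Y (fun G => one Y a b v G / (sd Y G a b).card) -
      (dl d a - dl d b) * (pone d a b v / kbar d Y a b)| ≤ 2 * L * √n * (L ^ 9 * ξ / n) +
        2 * L * √n * (6 * ξ * (L ^ 2 / n)) := by
    have h1 := abs_ev_one_div_sub_le T hM hξ hLev hY hne hab hv
    have h2 := abs_ev_one_sub_le T hξ0 hLev hY hne hab hv
    have h3 : |dl d a - dl d b| ≤ 2 * L * √n := by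
      have := T.abs_sub_le a b
      unfold dl; convert this using 2; ring
    have h4 : |ev d Y (one Y a b v) / kbar d Y a b - pone d a b v / kbar d Y a b| ≤
        6 * ξ * (L ^ 2 / n) := by
      rw [← sub_div, abs_div, abs_of_pos hK, div_eq_mul_one_div]
      gcongr
    have h5 : |ev d Y (fun G => one Y a b v G / (sd Y G a b).card) - pone d a b v / kbar d Y a b|
        ≤ L ^ 9 * ξ / n + 6 * ξ * (L ^ 2 / n) := (abs_sub_le _ _ _).trans (add_le_add h1 h4)
    rw [← mul_sub, abs_mul, ← mul_add]
    gcongr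
  have k2 : ∀ w ∈ bound Y a b, |ev d Y (fun G => one Y a b v G * U w G / (sd Y G a b).card) -
      pone d a b v * (tt d Y a w - tt d Y b w) / kbar d Y a b| ≤
      L ^ 8 * ξ / √n + (2 * (10 * ξ + 2 * L / √n)) * (L ^ 2 / n) := by
    intro w hw
    have h1 := abs_ev_one_mul_div_sub_le T hM hξ hLev hY hne hab (v := v) (U w)
      (fun G => sum_ind_sub_abs_le G a b w)
    have h2 := abs_ev_one_mul_ind_sub_le T hξ0 hLev hY hne hab hv hw (c := a) (Or.inl rfl)
    have h3 := abs_ev_one_mul_ind_sub_le T hξ0 hLev hY hne hab hv hw (c := b) (Or.inr rfl)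
    have e3 : ev d Y (fun G => one Y a b v G * U w G) =
        ev d Y (fun G => one Y a b v G * ind G a w) - ev d Y (fun G => one Y a b v G * ind G b w) := by
      rw [← ev_sub]; exact ev_congr fun G _ => by simp only [hU]; ring
    refine (abs_sub_le _ _ _).trans (add_le_add h1 ?_)
    rw [← sub_div, abs_div, abs_of_pos hK, div_eq_mul_one_div]
    gcongr
    rw [e3]
    rw [abs_le] at *
    constructor <;> linarith [h2.1, h2.2, h3.1, h3.2]
  have k3 : |∑ w ∈ bound Y a b, ev d Y (fun G => one Y a b v G * U w G / (sd Y G a b).card) -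
      ∑ w ∈ bound Y a b, pone d a b v * (tt d Y a w - tt d Y b w) / kbar d Y a b| ≤
      2 * L * (L ^ 8 * ξ / √n + (2 * (10 * ξ + 2 * L / √n)) * (L ^ 2 / n)) := by
    rw [← Finset.sum_sub_distrib]
    refine (Finset.abs_sum_le_sum_abs _ _).trans ((Finset.sum_le_sum k2).trans ?_)
    rw [Finset.sum_const, nsmul_eq_mul]
    gcongr
    have h1 := card_bound_le Y a b
    have h1' : ((bound Y a b).card : ℝ) ≤ deg Y a + deg Y b := by exact_mod_cast h1
    linarith [hY' a, hY' b]
  have m1 : 2 * L * √n * (L ^ 9 * ξ / n) = 2 * L ^ 9 * X := by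
    have : 2 * L * √n * (L ^ 9 * ξ / n) = 2 * L ^ 10 * ξ * (√n / n) := by ring
    rw [hX, this, Real.sqrt_div_self]; ring
  have m2 : 2 * L * √n * (6 * ξ * (L ^ 2 / n)) = 12 * L ^ 2 * X := by
    have : 2 * L * √n * (6 * ξ * (L ^ 2 / n)) = 12 * L ^ 3 * ξ * (√n / n) := by ring
    rw [hX, this, Real.sqrt_div_self]; ring
  have m3 : 2 * L * (L ^ 8 * ξ / √n + (2 * (10 * ξ + 2 * L / √n)) * (L ^ 2 / n)) ≤
      2 * L ^ 8 * X + 40 * L ^ 2 * X + 8 * L ^ 3 * X := by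
    have q1 : 2 * L * (L ^ 8 * ξ / √n) = 2 * L ^ 8 * X := by rw [hX]; ring
    have q2 : 2 * L * (2 * (10 * ξ) * (L ^ 2 / n)) ≤ 40 * L ^ 2 * X := by
      have : 40 * L ^ 3 * (ξ / n) ≤ 40 * L ^ 3 * (ξ / √n) := by
        refine mul_le_mul_of_nonneg_left ?_ (by positivity)
        exact hxin.trans (div_le_self (by positivity) hsn)
      calc 2 * L * (2 * (10 * ξ) * (L ^ 2 / n)) = 40 * L ^ 3 * (ξ / n) := by ring
        _ ≤ _ := this
        _ = _ := by rw [hX]; ring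
    have q3 : 2 * L * (2 * (2 * L / √n) * (L ^ 2 / n)) ≤ 8 * L ^ 3 * X := by
      have : 8 * L ^ 4 * (1 / n) / √n ≤ 8 * L ^ 4 * ξ / √n := by gcongr
      calc 2 * L * (2 * (2 * L / √n) * (L ^ 2 / n)) = 8 * L ^ 4 * (1 / n) / √n := by ring
        _ ≤ _ := this
        _ = _ := by rw [hX]; ring
    have : 2 * L * (L ^ 8 * ξ / √n + (2 * (10 * ξ + 2 * L / √n)) * (L ^ 2 / n)) =
      2 * L * (L ^ 8 * ξ / √n) + 2 * L * (2 * (10 * ξ) * (L ^ 2 / n)) +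
      2 * L * (2 * (2 * L / √n) * (L ^ 2 / n)) := by ring
    rw [this]; linarith
  have m4 : (2 * L ^ 9 + 12 * L ^ 2 + 2 * L ^ 8 + 40 * L ^ 2 + 8 * L ^ 3) * X ≤ L ^ 11 * X := by
    gcongr
    have g2 : L ^ 2 ≤ L ^ 9 := pow_le_pow_right₀ T.one_le (by norm_num)
    have g3 : L ^ 3 ≤ L ^ 9 := pow_le_pow_right₀ T.one_le (by norm_num)
    have g8 : L ^ 8 ≤ L ^ 9 := pow_le_pow_right₀ T.one_le (by norm_num)
    have g9 : 64 ≤ L ^ 2 := by nlinarith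
    have g10 : 64 * L ^ 9 ≤ L ^ 2 * L ^ 9 := by gcongr
    have g11 : L ^ 2 * L ^ 9 = L ^ 11 := by ring
    linarith
  have m5 : L ^ 11 * X = L ^ 12 * ξ / √n := by rw [hX]; ring
  rw [abs_le] at *
  constructor <;> linarith [k1.1, k1.2, k3.1, k3.2]

end inverse

section refined

variable {n : ℕ} {d : Fin n → ℕ} {L : ℝ} {ξ : ℝ} {M : ℕ} {Y : SimpleGraph (Fin n)} {a b : Fin n}

lemma abs_mul_le_mul {x y A B : ℝ} (hx : |x| ≤ A) (hy : |y| ≤ B) : |x * y| ≤ A * B := by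
  rw [abs_mul]
  exact mul_le_mul hx hy (abs_nonneg _) ((abs_nonneg _).trans hx)

lemma sum_dl (T : Tame d L) : ∑ j, dl d j = 0 := by
  have := T.npos
  simp only [dl, Finset.sum_sub_distrib, Finset.sum_const, Finset.card_univ, Fintype.card_fin,
    nsmul_eq_mul, dbar]
  field_simp
  ring

lemma abs_dl_le (T : Tame d L) (j : Fin n) : |dl d j| ≤ L * √n := T.dev j

lemma lam_pos (T : Tame d L) : 0 < lam n d :=
  lt_of_lt_of_le (by have := T.Lpos; positivity) T.lo

lemma one_sub_lam_pos (T : Tame d L) : 0 < 1 - lam n d := by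
  have : 0 < 1 / L := by have := T.Lpos; positivity
  linarith [T.hi]

lemma lam_mul_ge (T : Tame d L) : 1 / (2 * L) ≤ lam n d * (1 - lam n d) := by
  have hL := T.Lpos
  have hL' := T.hL
  have h1 := T.lo
  have h2 := T.hi
  have h3 : 1 / (2 * L) = 1 / L / 2 := by field_simp
  have h4 : 1 / L ≤ 1 / 2 := one_div_le_one_div_of_le (by norm_num) (by linarith)
  have h5 : 0 < 1 / L := by positivity
  rw [h3]
  nlinarith [mul_nonneg (sub_nonneg.2 h1) (sub_nonneg.2 h2), mul_nonneg h5.le (sub_nonneg.2 h4)]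

lemma one_sub_two_lam_abs (T : Tame d L) : |1 - 2 * lam n d| ≤ 1 := by
  have := lam_pos T
  have := one_sub_lam_pos T
  rw [abs_le]; constructor <;> linarith

/-- The skewness coefficient of the edge probability. -/
noncomputable def kap {n : ℕ} (d : Fin n → ℕ) : ℝ :=
  (1 - 2 * lam n d) / (lam n d * (1 - lam n d))

lemma abs_kap_le (T : Tame d L) : |kap d| ≤ 2 * L := by
  have hL := T.Lpos
  have h1 := lam_mul_ge T
  have h2 : 0 < lam n d * (1 - lam n d) := mul_pos (lam_pos T) (one_sub_lam_pos T)
  rw [kap, abs_div, abs_of_pos h2, div_le_iff₀ h2]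
  have : 2 * L * (1 / (2 * L)) = 1 := by field_simp
  nlinarith [one_sub_two_lam_abs T]

/-- The relative skewness at the vertex `v`. -/
noncomputable def tau {n : ℕ} (d : Fin n → ℕ) (v : Fin n) : ℝ := kap d * dl d v / n

lemma abs_tau_le (T : Tame d L) (v : Fin n) : |tau d v| ≤ 2 * L ^ 2 / √n := by
  have hn := T.npos
  have h := abs_mul_le_mul (abs_kap_le T) (abs_dl_le T v)
  rw [tau, abs_div, Nat.abs_cast, div_le_iff₀ hn]
  refine h.trans (le_of_eq ?_)
  have e : 2 * L ^ 2 / √n * n = 2 * L ^ 2 * (n / √n) := by ring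
  rw [e, Real.div_sqrt]
  ring

lemma abs_tau_le_one (T : Tame d L) (v : Fin n) : |tau d v| ≤ 1 := by
  refine (abs_tau_le T v).trans ?_
  rw [div_le_one T.sqrt_pos]
  have h1 := T.pow_le_sqrt (k := 3) (by norm_num)
  have hL' := T.hL
  nlinarith [sq_nonneg L]

lemma abs_xy_le (T : Tame d L) (a b v : Fin n) :
    |(dl d a + dl d v) / n * ((dl d b + dl d v) / n)| ≤ 4 * L ^ 2 / n := by
  have hn := T.npos
  have h (j : Fin n) : |(dl d j + dl d v) / n| ≤ 2 * L * √n / n := by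
    rw [abs_div, Nat.abs_cast]
    gcongr
    refine (abs_add_le _ _).trans ?_
    linarith [abs_dl_le T j, abs_dl_le T v]
  refine (abs_mul_le_mul (h a) (h b)).trans (le_of_eq ?_)
  have e : 2 * L * √n / n * (2 * L * √n / n) = 4 * L ^ 2 * (√n * √n) / n / n := by ring
  rw [e, T.sqrt_mul]
  field_simp

lemma pone_expand (d : Fin n → ℕ) (a b v : Fin n) :
    pone d a b v = 2 * (lam n d * (1 - lam n d)) +
      (1 - 2 * lam n d) * (dl d a + dl d b + 2 * dl d v) / n -
      2 * ((dl d a + dl d v) / n * ((dl d b + dl d v) / n)) := by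
  unfold pone pp; ring

lemma abs_kbar_sub_le (T : Tame d L) (hY : ∀ j, (deg Y j : ℝ) ≤ L) :
    |kbar d Y a b - (2 * (lam n d * (1 - lam n d)) * n +
      (1 - 2 * lam n d) * (dl d a + dl d b))| ≤ 9 * L ^ 2 := by
  have hn := T.npos
  have hL' := T.hL
  have e1 : ∑ v, pone d a b v - kbar d Y a b =
      ∑ v ∈ Finset.univ.filter (fun w => ¬ Free Y a b w), pone d a b v := by
    rw [kbar, frees, ← Finset.sum_filter_add_sum_filter_not Finset.univ (Free Y a b)]
    ring
  have e2 : ∑ v, pone d a b v = (2 * (lam n d * (1 - lam n d)) * n +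
      (1 - 2 * lam n d) * (dl d a + dl d b)) -
      2 * ∑ v, (dl d a + dl d v) / n * ((dl d b + dl d v) / n) := by
    have e3 : ∑ v, (dl d a + dl d b + 2 * dl d v) = n * (dl d a + dl d b) := by
      rw [Finset.sum_add_distrib, ← Finset.mul_sum, sum_dl T]
      simp [mul_add]
    have e4 : ∑ v, (1 - 2 * lam n d) * (dl d a + dl d b + 2 * dl d v) / n =
        (1 - 2 * lam n d) * (dl d a + dl d b) := by
      rw [← Finset.sum_div, ← Finset.mul_sum, e3]
      field_simp
    simp only [pone_expand]
    rw [Finset.sum_sub_distrib, Finset.sum_add_distrib, e4, Finset.mul_sum]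
    simp only [Finset.sum_const, Finset.card_univ, Fintype.card_fin, nsmul_eq_mul]
    ring
  have h1 : |∑ v, (dl d a + dl d v) / n * ((dl d b + dl d v) / n)| ≤ 4 * L ^ 2 := by
    refine (Finset.abs_sum_le_sum_abs _ _).trans
      ((Finset.sum_le_sum fun v _ => abs_xy_le T a b v).trans (le_of_eq ?_))
    simp only [Finset.sum_const, Finset.card_univ, Fintype.card_fin, nsmul_eq_mul]
    field_simp
  have h2 : |∑ v ∈ Finset.univ.filter (fun w => ¬ Free Y a b w), pone d a b v| ≤ 2 + 2 * L := by
    refine (Finset.abs_sum_le_sum_abs _ _).trans ((Finset.sum_le_sum (g := fun _ => 1)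
      fun v _ => ?_).trans ?_)
    · rw [abs_of_nonneg (pone_mem T a b v).1]; exact (pone_mem T a b v).2
    · simp only [Finset.sum_const, nsmul_eq_mul, mul_one]
      have : ((Finset.univ.filter fun w => ¬ Free Y a b w).card : ℝ) ≤ 2 + deg Y a + deg Y b := by
        exact_mod_cast card_not_free_le Y a b
      linarith [hY a, hY b]
  rw [← e1, e2] at h2
  rw [abs_le] at *
  constructor <;> nlinarith [h1.1, h1.2, h2.1, h2.2]

lemma abs_pone_div_kbar_sub_le (T : Tame d L) (hY : ∀ j, (deg Y j : ℝ) ≤ L) (a b v : Fin n) :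
    |pone d a b v / kbar d Y a b - (1 + tau d v) / n| ≤ L ^ 6 / n ^ 2 := by
  have hn := T.npos
  have hL := T.Lpos
  have hL' := T.hL
  have hK := kbar_pos (a := a) (b := b) T hY
  have hs : 0 < lam n d * (1 - lam n d) := mul_pos (lam_pos T) (one_sub_lam_pos T)
  set s := lam n d * (1 - lam n d) with hsdef
  set B := (1 - 2 * lam n d) * (dl d a + dl d b) with hB
  have hB' : |B| ≤ 2 * L * √n := by
    have : |dl d a + dl d b| ≤ 2 * L * √n := (abs_add_le _ _).trans (by
      linarith [abs_dl_le T a, abs_dl_le T b])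
    exact (abs_mul_le_mul (one_sub_two_lam_abs T) this).trans (by rw [one_mul])
  have hk := abs_kbar_sub_le (a := a) (b := b) T hY
  rw [← hsdef, ← hB] at hk
  have ht := abs_tau_le T v
  have ht1 := abs_tau_le_one T v
  have htA : tau d v * (2 * s * n) = 2 * (1 - 2 * lam n d) * dl d v := by
    rw [tau, kap, ← hsdef]; field_simp
  have e1 : pone d a b v * n = 2 * s * n + B + tau d v * (2 * s * n) -
      2 * n * ((dl d a + dl d v) / n * ((dl d b + dl d v) / n)) := by
    rw [htA, pone_expand, ← hsdef, hB]; field_simp; ring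
  have h2 : |2 * n * ((dl d a + dl d v) / n * ((dl d b + dl d v) / n))| ≤ 8 * L ^ 2 := by
    rw [abs_mul, abs_of_pos (by positivity : 0 < 2 * (n : ℝ))]
    calc 2 * (n : ℝ) * |(dl d a + dl d v) / n * ((dl d b + dl d v) / n)| ≤
        2 * n * (4 * L ^ 2 / n) := by gcongr; exact abs_xy_le T a b v
      _ = 8 * L ^ 2 := by field_simp; ring
  have h3 : |B * tau d v| ≤ 4 * L ^ 3 := by
    refine (abs_mul_le_mul hB' ht).trans (le_of_eq ?_)
    have := T.sqrt_pos
    field_simp; ring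
  have h4 : |(kbar d Y a b - (2 * s * n + B)) * (1 + tau d v)| ≤ 9 * L ^ 2 * 2 := by
    refine abs_mul_le_mul hk ?_
    rw [abs_le] at *; constructor <;> linarith [ht1.1, ht1.2]
  have h5 : |pone d a b v * n - kbar d Y a b * (1 + tau d v)| ≤ L ^ 4 := by
    have e : pone d a b v * n - kbar d Y a b * (1 + tau d v) =
      - (2 * n * ((dl d a + dl d v) / n * ((dl d b + dl d v) / n))) - B * tau d v -
      (kbar d Y a b - (2 * s * n + B)) * (1 + tau d v) := by rw [e1]; ring
    rw [e]
    have : 30 * L ^ 2 + 4 * L ^ 3 ≤ L ^ 4 := by nlinarith [pow_pos hL 2, pow_pos hL 3]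
    have := pow_pos hL 2
    rw [abs_le] at h2 h3 h4 ⊢
    constructor <;> linarith [h2.1, h2.2, h3.1, h3.2, h4.1, h4.2]
  have e2 : pone d a b v / kbar d Y a b - (1 + tau d v) / n =
    (pone d a b v * n - kbar d Y a b * (1 + tau d v)) * (1 / kbar d Y a b) / n := by
    field_simp
  have h6 : |1 / kbar d Y a b| ≤ L ^ 2 / n := by
    rw [abs_of_pos (by positivity)]; exact inv_kbar_le T hY
  rw [e2, abs_div, Nat.abs_cast, div_le_iff₀ hn]
  refine (abs_mul_le_mul h5 h6).trans (le_of_eq ?_)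
  field_simp

lemma abs_pr_sub_sub_le (T : Tame d L) (hM : (M : ℝ) ≤ L) (hξ : 1 / n ≤ ξ)
    (hLev : Lev d (M + 4) ξ) (hY : ∀ j, deg Y j ≤ M) (hne : (cls d Y).Nonempty) {v : Fin n}
    (ha : a ∈ avail Y v) (hb : b ∈ avail Y v) :
    |pr d Y a v - pr d Y b v - (dl d a - dl d b - (1 - lam n d) * ((deg Y a : ℝ) - deg Y b)) *
      ((1 + tau d v) / n)| ≤ L ^ 13 * ξ / √n := by
  have hL := T.Lpos
  have hL' := T.hL
  have hn := T.npos
  have hs := T.sqrt_pos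
  have hξ0 : 0 ≤ ξ := le_trans (by positivity) hξ
  by_cases hab : a = b
  · subst hab
    simp only [sub_self, mul_zero, zero_mul, abs_zero]
    positivity
  have hY' : ∀ j, (deg Y j : ℝ) ≤ L := fun j => le_trans (by exact_mod_cast hY j) hM
  have h1 := abs_pr_sub_le T hM hξ hLev hY hne hab (free_of_avail ha hb)
  have h2 := abs_pone_div_kbar_sub_le T hY' a b v
  have h3 : |dl d a - dl d b - (1 - lam n d) * ((deg Y a : ℝ) - deg Y b)| ≤ 3 * L * √n := by
    have k1 : |(1 - lam n d) * ((deg Y a : ℝ) - deg Y b)| ≤ 1 * L := by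
      refine abs_mul_le_mul ?_ ?_
      · rw [abs_of_pos (one_sub_lam_pos T)]; linarith [lam_pos T]
      · rw [abs_le]
        have : (0:ℝ) ≤ deg Y a := Nat.cast_nonneg _
        have : (0:ℝ) ≤ deg Y b := Nat.cast_nonneg _
        constructor <;> linarith [hY' a, hY' b]
    have k2 : L ≤ L * √n := le_mul_of_one_le_right hL.le (by
      rw [Real.one_le_sqrt]; linarith [T.n_ge])
    have k3 := abs_dl_le T a
    have k4 := abs_dl_le T b
    rw [abs_le] at *
    constructor <;> linarith [k1.1, k1.2, k3.1, k3.2, k4.1, k4.2]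
  have h4 := abs_mul_le_mul h3 h2
  have h5 : 3 * L * √n * (L ^ 6 / n ^ 2) ≤ L ^ 8 * ξ / √n := by
    have e : 3 * L * √n * (L ^ 6 / n ^ 2) = 3 * L ^ 7 * (1 / n) * (√n / n) := by
      field_simp
    rw [e, Real.sqrt_div_self, ← div_eq_mul_inv]
    gcongr
    nlinarith [pow_pos hL 7]
  have h6 : L ^ 12 * ξ / √n + L ^ 8 * ξ / √n ≤ L ^ 13 * ξ / √n := by
    rw [← add_div, ← add_mul]
    gcongr
    have : L ^ 8 ≤ L ^ 12 := pow_le_pow_right₀ T.one_le (by norm_num)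
    nlinarith [pow_pos hL 12]
  have e : pr d Y a v - pr d Y b v -
      (dl d a - dl d b - (1 - lam n d) * ((deg Y a : ℝ) - deg Y b)) * ((1 + tau d v) / n) =
      (pr d Y a v - pr d Y b v -
      (dl d a - dl d b - (1 - lam n d) * ((deg Y a : ℝ) - deg Y b)) *
        (pone d a b v / kbar d Y a b)) +
      (dl d a - dl d b - (1 - lam n d) * ((deg Y a : ℝ) - deg Y b)) *
        (pone d a b v / kbar d Y a b - (1 + tau d v) / n) := by ring
  rw [e]
  refine (abs_add_le _ _).trans ?_
  linarith

/-- The average degree of `Y`. -/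
noncomputable def ybar {n : ℕ} (Y : SimpleGraph (Fin n)) : ℝ := (∑ j, (deg Y j : ℝ)) / n

/-- The refined prediction of the edge probability. -/
noncomputable def qq {n : ℕ} (d : Fin n → ℕ) (Y : SimpleGraph (Fin n)) (a v : Fin n) : ℝ :=
  lam n d + (dl d a + dl d v) / n - (1 - lam n d) * (deg Y a + deg Y v - ybar Y) / n +
    tau d v * dl d a / n

set_option maxHeartbeats 1000000 in
lemma sum_rule_bound {n r L t δa δv ya yv yb τ S1 S2 S3 z X μ : ℝ} (hL : 1000 ≤ L) (hr : 1 ≤ r)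
    (hn : r * r = n) (hLn : 4 * L ≤ n) (ht : |t| ≤ 2 * L) (hδa : |δa| ≤ L * r)
    (hδv : |δv| ≤ L * r) (hya : |ya| ≤ L) (hyv : |yv| ≤ L) (hyb : |yb| ≤ L) (hμ : |μ| ≤ 1)
    (hτ : |τ| ≤ 2 * L ^ 2 / r) (hτ1 : |τ| ≤ 1) (hS1 : |S1| ≤ L ^ 2 * r) (hS2 : |S2| ≤ L ^ 2)
    (hS3 : |S3| ≤ n * X)
    (hz : (n - t) * z = δv - μ * yv + (1 + τ) / n *
      ((n - t) * δa + δv + S1 - μ * ((n - t) * ya - n * yb + yv + S2)) + S3) :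
    |z - ((δa + δv) / n - μ * (ya + yv - yb) / n + τ * δa / n)| ≤ L ^ 4 / (n * r) + 2 * X := by
  have hr0 : 0 < r := by linarith
  have hn0 : 0 < n := by rw [← hn]; positivity
  have hL0 : 0 < L := by linarith
  set q := (δa + δv) / n - μ * (ya + yv - yb) / n + τ * δa / n with hq
  have e : (n - t) * (z - q) =
      - ((1 + τ) / n * (t * δa)) + (1 + τ) / n * (δv + S1) - μ * (τ * (ya - yb)) +
        μ * ((1 + τ) / n * (t * ya)) - μ * ((1 + τ) / n * (yv + S2)) +
        (1 / n) * (t * (δa + δv - μ * (ya + yv - yb) + τ * δa)) + S3 := by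
    rw [mul_sub, hz, hq]
    field_simp
    ring
  have hρ : |(1 + τ) / n| ≤ 2 / n := by
    rw [abs_div, abs_of_pos hn0]
    gcongr
    refine (abs_add_le _ _).trans ?_
    rw [abs_one]; linarith
  have hinv : |1 / n| ≤ 1 / n := by rw [abs_of_pos (by positivity)]
  have hrn : r / n = 1 / r := by rw [← hn]; field_simp
  have hn1 : 1 / n ≤ 1 / r := by
    apply one_div_le_one_div_of_le hr0; rw [← hn]; nlinarith
  have add2 {x y A B : ℝ} (hx : |x| ≤ A) (hy : |y| ≤ B) : |x + y| ≤ A + B :=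
    (abs_add_le _ _).trans (add_le_add hx hy)
  have sub2 {x y A B : ℝ} (hx : |x| ≤ A) (hy : |y| ≤ B) : |x - y| ≤ A + B :=
    (abs_sub _ _).trans (add_le_add hx hy)
  have b1 := abs_mul_le_mul hρ (abs_mul_le_mul ht hδa)
  have b2 := abs_mul_le_mul hρ (add2 hδv hS1)
  have b3 := abs_mul_le_mul hμ (abs_mul_le_mul hτ (sub2 hya hyb))
  have b4 := abs_mul_le_mul hμ (abs_mul_le_mul hρ (abs_mul_le_mul ht hya))
  have b5 := abs_mul_le_mul hμ (abs_mul_le_mul hρ (add2 hyv hS2))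
  have b6 := abs_mul_le_mul hinv (abs_mul_le_mul ht
    (add2 (sub2 (add2 hδa hδv) (abs_mul_le_mul hμ (sub2 (add2 hya hyv) hyb)))
      (abs_mul_le_mul hτ1 hδa)))
  have c1 : 2 / n * (2 * L * (L * r)) = 4 * L ^ 2 * (1 / r) := by rw [← hrn]; ring
  have c2 : 2 / n * (L * r + L ^ 2 * r) = (2 * L + 2 * L ^ 2) * (1 / r) := by rw [← hrn]; ring
  have c3 : 1 * (2 * L ^ 2 / r * (L + L)) = 4 * L ^ 3 * (1 / r) := by ring
  have c4 : 1 * (2 / n * (2 * L * L)) ≤ 4 * L ^ 2 * (1 / r) := by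
    have : 4 * L ^ 2 * (1 / n) ≤ 4 * L ^ 2 * (1 / r) := by gcongr
    calc _ = 4 * L ^ 2 * (1 / n) := by ring
      _ ≤ _ := this
  have c5 : 1 * (2 / n * (L + L ^ 2)) ≤ (2 * L + 2 * L ^ 2) * (1 / r) := by
    have : (2 * L + 2 * L ^ 2) * (1 / n) ≤ (2 * L + 2 * L ^ 2) * (1 / r) := by gcongr
    calc _ = (2 * L + 2 * L ^ 2) * (1 / n) := by ring
      _ ≤ _ := this
  have c6 : 1 / n * (2 * L * (L * r + L * r + 1 * (L + L + L) + 1 * (L * r))) ≤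
      (12 * L ^ 2) * (1 / r) := by
    have : 6 * L ^ 2 * (1 / n) ≤ 6 * L ^ 2 * (1 / r) := by gcongr
    calc _ = 6 * L ^ 2 * (r / n) + 6 * L ^ 2 * (1 / n) := by ring
      _ ≤ _ := by rw [hrn]; linarith
  have c7 : 4 * L ^ 2 * (1 / r) + (2 * L + 2 * L ^ 2) * (1 / r) + 4 * L ^ 3 * (1 / r) +
      4 * L ^ 2 * (1 / r) + (2 * L + 2 * L ^ 2) * (1 / r) + 12 * L ^ 2 * (1 / r) ≤
      L ^ 4 / 2 * (1 / r) := by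
    rw [← add_mul, ← add_mul, ← add_mul, ← add_mul, ← add_mul]
    gcongr
    nlinarith [pow_pos hL0 2, pow_pos hL0 3]
  have h1 : |(n - t) * (z - q)| ≤ L ^ 4 / 2 * (1 / r) + n * X := by
    rw [e]
    refine (add2 (add2 (sub2 (add2 (sub2 (add2 ((abs_neg _).trans_le b1) b2) b3) b4) b5) b6)
      hS3).trans ?_
    rw [c1, c2, c3]
    linarith only [c4, c5, c6, c7]
  have h2 : n / 2 ≤ |n - t| := by
    have := abs_le.1 ht
    exact le_trans (by linarith [this.2]) (le_abs_self _)
  rw [abs_mul] at h1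
  have h3 : n / 2 * |z - q| ≤ L ^ 4 / 2 * (1 / r) + n * X :=
    (mul_le_mul_of_nonneg_right h2 (abs_nonneg _)).trans h1
  have h4 : |z - q| = (2 / n) * (n / 2 * |z - q|) := by field_simp
  rw [h4]
  calc 2 / n * (n / 2 * |z - q|) ≤ 2 / n * (L ^ 4 / 2 * (1 / r) + n * X) := by gcongr
    _ = _ := by field_simp

lemma abs_pr_sub_qq_le (T : Tame d L) (hM : (M : ℝ) ≤ L) (hξ : 1 / n ≤ ξ)
    (hLev : Lev d (M + 4) ξ) (hY : ∀ j, deg Y j ≤ M) (hne : (cls d Y).Nonempty) {v : Fin n}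
    (ha : a ∈ avail Y v) : |pr d Y a v - qq d Y a v| ≤ L ^ 14 * ξ / √n := by
  have hL := T.Lpos
  have hL' := T.hL
  have hn := T.npos
  have hs := T.sqrt_pos
  have hs2 := T.sqrt_mul
  have hξ0 : 0 ≤ ξ := le_trans (by positivity) hξ
  have hY' : ∀ j, (deg Y j : ℝ) ≤ L := fun j => le_trans (by exact_mod_cast hY j) hM
  have hY0 : ∀ j, (0 : ℝ) ≤ deg Y j := fun j => Nat.cast_nonneg _
  have hYa : ∀ j, |(deg Y j : ℝ)| ≤ L := fun j => by rw [Nat.abs_cast]; exact hY' j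
  have hsn : 1 ≤ √(n : ℝ) := by
    rw [Real.one_le_sqrt]; linarith [T.n_ge]
  set P := fun b => pr d Y a v - pr d Y b v -
    (dl d a - dl d b - (1 - lam n d) * ((deg Y a : ℝ) - deg Y b)) * ((1 + tau d v) / n) with hP
  have hrule := avail_rule T hne a v
  have hcard := card_avail Y v
  have e1 : ∑ b ∈ avail Y v, (pr d Y a v - pr d Y b v) = ∑ b ∈ avail Y v, P b +
      (1 + tau d v) / n * (((n : ℝ) - 1 - deg Y v) * dl d a - ∑ b ∈ avail Y v, dl d b -
        (1 - lam n d) * (((n : ℝ) - 1 - deg Y v) * deg Y a - ∑ b ∈ avail Y v, (deg Y b : ℝ))) := by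
    rw [← hcard]
    simp only [hP, Finset.sum_sub_distrib, ← Finset.sum_mul, ← Finset.mul_sum, Finset.sum_const,
      nsmul_eq_mul]
    ring
  have hS (f : Fin n → ℝ) (F : ℝ) (hf : ∀ j, |f j| ≤ F) :
      |∑ b, ind Y v b * f b| ≤ L * F := by
    have hF : 0 ≤ F := (abs_nonneg _).trans (hf v)
    calc |∑ b, ind Y v b * f b| ≤ ∑ b, ind Y v b * F := by
          refine (Finset.abs_sum_le_sum_abs _ _).trans (Finset.sum_le_sum fun b _ => ?_)
          rw [abs_mul, abs_of_nonneg (ind_nonneg Y v b)]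
          exact mul_le_mul_of_nonneg_left (hf b) (ind_nonneg Y v b)
      _ = deg Y v * F := by rw [← Finset.sum_mul, sum_ind]
      _ ≤ L * F := by gcongr; exact hY' v
  have hS1 := hS (dl d) _ (abs_dl_le T)
  have hS2 := hS (fun j => (deg Y j : ℝ)) _ hYa
  have hS3 : |∑ b ∈ avail Y v, P b| ≤ n * (L ^ 13 * ξ / √n) := by
    refine (Finset.abs_sum_le_sum_abs _ _).trans ((Finset.sum_le_sum fun b hb =>
      abs_pr_sub_sub_le T hM hξ hLev hY hne ha hb).trans ?_)
    rw [Finset.sum_const, nsmul_eq_mul, hcard]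
    gcongr
    linarith [hY0 v]
  rw [sum_avail Y v (dl d), sum_avail Y v (fun j => (deg Y j : ℝ)), sum_dl T] at e1
  have hyb : (∑ j, (deg Y j : ℝ)) = n * ybar Y := by rw [ybar]; field_simp
  have hybar : |ybar Y| ≤ L := by
    have h0 : 0 ≤ ybar Y := div_nonneg (Finset.sum_nonneg fun j _ => hY0 j) hn.le
    rw [abs_of_nonneg h0, ybar, div_le_iff₀ hn]
    refine (Finset.sum_le_sum fun j _ => hY' j).trans (le_of_eq ?_)
    simp [mul_comm]
  have hmain := sum_rule_bound (n := n) (r := √n) (L := L) (t := 1 + deg Y v) (δa := dl d a)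
    (δv := dl d v) (ya := deg Y a) (yv := deg Y v) (yb := ybar Y) (τ := tau d v)
    (S1 := ∑ b, ind Y v b * dl d b) (S2 := ∑ b, ind Y v b * deg Y b)
    (S3 := ∑ b ∈ avail Y v, P b) (z := pr d Y a v - lam n d) (X := L ^ 13 * ξ / √n)
    (μ := 1 - lam n d) hL' hsn hs2
    (by have := T.pow_le (k := 2) (by norm_num); nlinarith)
    (by rw [abs_of_pos (by linarith [hY0 v])]; linarith [hY' v])
    (abs_dl_le T a) (abs_dl_le T v) (hYa a) (hYa v) hybar
    (by rw [abs_of_pos (one_sub_lam_pos T)]; linarith [lam_pos T])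
    (abs_tau_le T v) (abs_tau_le_one T v) (hS1.trans (le_of_eq (by ring)))
    (hS2.trans (le_of_eq (by ring))) hS3
    (by
      rw [← sub_sub, hrule, e1, hyb]; ring)
  have e2 : pr d Y a v - qq d Y a v = pr d Y a v - lam n d -
    ((dl d a + dl d v) / n - (1 - lam n d) * (deg Y a + deg Y v - ybar Y) / n +
      tau d v * dl d a / n) := by rw [qq]; ring
  rw [e2]
  refine hmain.trans ?_
  have k1 : L ^ 4 / (n * √n) ≤ L ^ 4 * ξ / √n := by
    have : L ^ 4 / (n * √n) = L ^ 4 * (1 / n) / √n := by field_simp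
    rw [this]; gcongr
  have k2 : L ^ 4 * ξ / √n + 2 * (L ^ 13 * ξ / √n) ≤ L ^ 14 * ξ / √n := by
    have : L ^ 4 + 2 * L ^ 13 ≤ L ^ 14 := by
      have : L ^ 4 ≤ L ^ 13 := pow_le_pow_right₀ T.one_le (by norm_num)
      nlinarith [pow_pos hL 13]
    calc L ^ 4 * ξ / √n + 2 * (L ^ 13 * ξ / √n) = (L ^ 4 + 2 * L ^ 13) * ξ / √n := by ring
      _ ≤ _ := by gcongr
  linarith

lemma abs_qq_sub_pp_le (T : Tame d L) (hY : ∀ j, (deg Y j : ℝ) ≤ L) (a v : Fin n) :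
    |qq d Y a v - pp d a v| ≤ L ^ 4 / n := by
  have hL := T.Lpos
  have hL' := T.hL
  have hn := T.npos
  have hs := T.sqrt_pos
  have hY0 : ∀ j, (0 : ℝ) ≤ deg Y j := fun j => Nat.cast_nonneg _
  have h0 : 0 ≤ ybar Y := div_nonneg (Finset.sum_nonneg fun j _ => hY0 j) hn.le
  have hybar : ybar Y ≤ L := by
    rw [ybar, div_le_iff₀ hn]
    refine (Finset.sum_le_sum fun j _ => hY j).trans (le_of_eq ?_)
    simp [mul_comm]
  have e : qq d Y a v - pp d a v =
      (tau d v * dl d a - (1 - lam n d) * (deg Y a + deg Y v - ybar Y)) / n := by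
    unfold qq pp; ring
  have h1 : |tau d v * dl d a| ≤ 2 * L ^ 3 := by
    refine (abs_mul_le_mul (abs_tau_le T v) (abs_dl_le T a)).trans (le_of_eq ?_)
    field_simp
  have h2 : |(1 - lam n d) * (deg Y a + deg Y v - ybar Y)| ≤ 1 * (2 * L) := by
    refine abs_mul_le_mul ?_ ?_
    · rw [abs_of_pos (one_sub_lam_pos T)]; linarith [lam_pos T]
    · rw [abs_le]; constructor <;> linarith [hY a, hY v, hY0 a, hY0 v]
  rw [e, abs_div, Nat.abs_cast]
  gcongr
  refine (abs_sub _ _).trans ?_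
  nlinarith [pow_pos hL 2, pow_pos hL 3]

lemma mem_avail_of {a v : Fin n} (hav : a ≠ v) (h : ¬ Y.Adj a v) : a ∈ avail Y v :=
  mem_avail.2 ⟨hav, fun h' => h h'.symm⟩

lemma lev_fine (T : Tame d L) (hM : ((M + 4 : ℕ) : ℝ) ≤ L) : Lev d M (L ^ 22 / n) := by
  have hL := T.Lpos
  have hL' := T.hL
  have hn := T.npos
  have hs := T.sqrt_pos
  have hs2 := T.sqrt_mul
  have hM' : (M : ℝ) ≤ L := by push_cast at hM; linarith
  intro Y hY hne a v hav hadj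
  have hξ : 1 / (n : ℝ) ≤ L ^ 7 / √n := by
    rw [div_le_div_iff₀ hn hs]
    have : 1 ≤ L ^ 7 := one_le_pow₀ T.one_le
    have h1 : 1 ≤ √(n : ℝ) := by
      rw [Real.one_le_sqrt]; linarith [T.n_ge]
    have h2 : √(n : ℝ) ≤ n := by nlinarith
    nlinarith
  have h1 := abs_pr_sub_qq_le T hM' hξ (lev_coarse T hM) hY hne (mem_avail_of hav hadj)
  have h2 := abs_qq_sub_pp_le T (fun j => le_trans (by exact_mod_cast hY j) hM') a v (Y := Y)
  have e : L ^ 14 * (L ^ 7 / √n) / √n = L ^ 21 / n := by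
    rw [mul_div_assoc, div_div, hs2]; ring
  rw [e] at h1
  change |pr d Y a v - pp d a v| ≤ _
  refine (abs_sub_le _ _ _).trans ((add_le_add h1 h2).trans ?_)
  rw [← add_div]
  gcongr
  have : L ^ 4 ≤ L ^ 21 := pow_le_pow_right₀ T.one_le (by norm_num)
  nlinarith [pow_pos hL 21]

/-- The edge probability of an available pair, up to `n ^ (-3/2)`. -/
lemma abs_pr_sub_qq_le_fine (T : Tame d L) (hM : ((M + 8 : ℕ) : ℝ) ≤ L)
    (hY : ∀ j, deg Y j ≤ M) (hne : (cls d Y).Nonempty) {v : Fin n} (hav : a ≠ v)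
    (hadj : ¬ Y.Adj a v) : |pr d Y a v - qq d Y a v| ≤ L ^ 36 / (n * √n) := by
  have hL := T.Lpos
  have hn := T.npos
  have hs := T.sqrt_pos
  have hM' : (M : ℝ) ≤ L := by push_cast at hM; linarith
  have h := abs_pr_sub_qq_le T hM' (ξ := L ^ 22 / n)
    (by gcongr; exact one_le_pow₀ T.one_le) (lev_fine T (M := M + 4) (by exact_mod_cast hM)) hY hne
    (mem_avail_of hav hadj)
  refine h.trans (le_of_eq ?_)
  field_simp

end refined

section telescoping

variable {n : ℕ} {d : Fin n → ℕ} {L : ℝ} {M : ℕ} {Y : SimpleGraph (Fin n)} {a v : Fin n}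

lemma card_cls_sup_edge (hne : (cls d Y).Nonempty) (hav : a ≠ v) :
    ((cls d (Y ⊔ SimpleGraph.edge a v)).card : ℝ) = (cls d Y).card * pr d Y a v := by
  have h0 : ((cls d Y).card : ℝ) ≠ 0 := by exact_mod_cast hne.card_pos.ne'
  rw [cls_sup_edge d Y hav, pr, ev, mul_div_cancel₀ _ h0]
  simp only [ind]
  rw [Finset.sum_boole]

lemma exists_eq_sup_edge {Y : SimpleGraph (Fin n)} (h : Y ≠ ⊥) :
    ∃ (X : SimpleGraph (Fin n)) (a v : Fin n), X < Y ∧ a ≠ v ∧ ¬ X.Adj a v ∧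
      X ⊔ SimpleGraph.edge a v = Y := by
  obtain ⟨a, v, hav⟩ := SimpleGraph.ne_bot_iff_exists_adj.1 h
  have hne := hav.ne
  have e : Y.deleteEdges {s(a, v)} ⊔ SimpleGraph.edge a v = Y := by
    ext x y
    simp only [SimpleGraph.sup_adj, SimpleGraph.deleteEdges_adj, Set.mem_singleton_iff,
      SimpleGraph.edge_adj, Sym2.eq_iff]
    constructor
    · rintro (h | ⟨⟨rfl, rfl⟩ | ⟨rfl, rfl⟩, _⟩)
      · exact h.1
      · exact hav
      · exact hav.symm
    · intro h
      by_cases h' : x = a ∧ y = v ∨ x = v ∧ y = a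
      · exact Or.inr ⟨h', h.ne⟩
      · exact Or.inl ⟨h, h'⟩
  have hn : ¬ (Y.deleteEdges {s(a, v)}).Adj a v := by simp
  refine ⟨Y.deleteEdges {s(a, v)}, a, v, ?_, hne, hn, e⟩
  refine lt_of_le_of_ne (SimpleGraph.deleteEdges_le _) fun h' => hn ?_
  rw [h']; exact hav

/-- The number of edges. -/
noncomputable def ee (Y : SimpleGraph (Fin n)) : ℝ := (∑ j, (deg Y j : ℝ)) / 2

/-- The quadratic form of the degree deviations along the edges. -/
noncomputable def quad (d : Fin n → ℕ) (Y : SimpleGraph (Fin n)) : ℝ :=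
  ∑ j, ∑ k, ind Y j k * (dl d j * dl d k)

/-- The predicted logarithm of the probability of containing `Y`. -/
noncomputable def psi (d : Fin n → ℕ) (Y : SimpleGraph (Fin n)) : ℝ :=
  ee Y * Real.log (lam n d) + (∑ j, dl d j * deg Y j) / (lam n d * n) -
    (1 - lam n d) / (lam n d * n) *
      ((∑ j, (deg Y j : ℝ) * (deg Y j - 1)) / 2 - ee Y * (ee Y - 1) / n) -
    (∑ j, dl d j ^ 2 * deg Y j) / (2 * lam n d ^ 2 * n ^ 2) -
    quad d Y / (2 * (lam n d * (1 - lam n d)) * n ^ 2)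

lemma sum_two_points (f : Fin n → ℝ) :
    ∑ j, f j * ((if j = a then 1 else 0) + (if j = v then 1 else 0)) = f a + f v := by
  simp [mul_add, Finset.sum_add_distrib]

lemma cast_deg_sup_edge (hav : a ≠ v) (hadj : ¬ Y.Adj a v) (j : Fin n) :
    (deg (Y ⊔ SimpleGraph.edge a v) j : ℝ) =
      deg Y j + ((if j = a then 1 else 0) + (if j = v then 1 else 0)) := by
  rw [deg_sup_edge hav hadj]; push_cast; ring

lemma ind_sup_edge (hav : a ≠ v) (hadj : ¬ Y.Adj a v) (j k : Fin n) :
    ind (Y ⊔ SimpleGraph.edge a v) j k = ind Y j k +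
      ((if j = a then 1 else 0) * (if k = v then 1 else 0) +
        (if j = v then 1 else 0) * (if k = a then 1 else 0)) := by
  have hadj' : ¬ Y.Adj v a := fun h => hadj h.symm
  simp only [ind, SimpleGraph.sup_adj, SimpleGraph.edge_adj]
  by_cases h1 : j = a <;> by_cases h2 : k = v <;> by_cases h3 : j = v <;> by_cases h4 : k = a <;>
    simp_all

lemma quad_sup_edge (hav : a ≠ v) (hadj : ¬ Y.Adj a v) :
    quad d (Y ⊔ SimpleGraph.edge a v) = quad d Y + 2 * (dl d a * dl d v) := by
  simp only [quad, ind_sup_edge hav hadj, add_mul, Finset.sum_add_distrib]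
  have h (x y : Fin n) : ∑ j, ∑ k, (if j = x then (1 : ℝ) else 0) * (if k = y then 1 else 0) *
      (dl d j * dl d k) = dl d x * dl d y := by
    have : ∀ j k, (if j = x then (1 : ℝ) else 0) * (if k = y then 1 else 0) *
      (dl d j * dl d k) = (if j = x then dl d j else 0) * (if k = y then dl d k else 0) := by
      intro j k; split_ifs <;> simp
    simp only [this, ← Finset.mul_sum, Finset.sum_ite_eq', Finset.mem_univ, if_true,
      ← Finset.sum_mul]
  rw [h, h]; ring

lemma ee_sup_edge (hav : a ≠ v) (hadj : ¬ Y.Adj a v) :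
    ee (Y ⊔ SimpleGraph.edge a v) = ee Y + 1 := by
  simp only [ee, cast_deg_sup_edge hav hadj, Finset.sum_add_distrib]
  have := sum_two_points (a := a) (v := v) fun _ => 1
  simp only [one_mul, Finset.sum_add_distrib] at this
  rw [this]; ring

lemma psi_sup_edge (hn : 0 < (n : ℝ)) (hlam : 0 < lam n d) (hlam' : 0 < 1 - lam n d)
    (hav : a ≠ v) (hadj : ¬ Y.Adj a v) :
    psi d (Y ⊔ SimpleGraph.edge a v) = psi d Y + (Real.log (lam n d) +
      (((dl d a + dl d v) / n + (qq d Y a v - pp d a v)) / lam n d -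
        ((dl d a + dl d v) / n) ^ 2 / (2 * lam n d ^ 2)) +
        (kap d * (dl d a * dl d v) - tau d v * dl d a * n) / (lam n d * n ^ 2)) := by
  have h1 : ∑ j, dl d j * deg (Y ⊔ SimpleGraph.edge a v) j =
      ∑ j, dl d j * deg Y j + (dl d a + dl d v) := by
    simp only [cast_deg_sup_edge hav hadj, mul_add _ (deg Y _ : ℝ), Finset.sum_add_distrib]
    rw [sum_two_points]
  have h2 : ∑ j, dl d j ^ 2 * deg (Y ⊔ SimpleGraph.edge a v) j =
      ∑ j, dl d j ^ 2 * deg Y j + (dl d a ^ 2 + dl d v ^ 2) := by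
    simp only [cast_deg_sup_edge hav hadj, mul_add _ (deg Y _ : ℝ), Finset.sum_add_distrib]
    rw [sum_two_points fun j => dl d j ^ 2]
  have h3 : ∑ j, (deg (Y ⊔ SimpleGraph.edge a v) j : ℝ) *
      (deg (Y ⊔ SimpleGraph.edge a v) j - 1) =
      ∑ j, (deg Y j : ℝ) * (deg Y j - 1) + 2 * (deg Y a + deg Y v) := by
    have e : ∀ j, (deg (Y ⊔ SimpleGraph.edge a v) j : ℝ) *
        (deg (Y ⊔ SimpleGraph.edge a v) j - 1) = (deg Y j : ℝ) * (deg Y j - 1) +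
        2 * (deg Y j * ((if j = a then 1 else 0) + (if j = v then 1 else 0))) := by
      intro j
      rw [cast_deg_sup_edge hav hadj]
      by_cases h1 : j = a
      · have h2 : j ≠ v := fun h => hav (h1.symm.trans h)
        rw [if_pos h1, if_neg h2]; ring
      · by_cases h2 : j = v
        · rw [if_neg h1, if_pos h2]; ring
        · rw [if_neg h1, if_neg h2]; ring
    simp only [e, Finset.sum_add_distrib]
    rw [← Finset.mul_sum, sum_two_points fun j => (deg Y j : ℝ)]
  have h4 : ybar Y = 2 * ee Y / n := by unfold ybar ee; ring
  unfold psi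
  rw [h1, h2, h3, quad_sup_edge hav hadj, ee_sup_edge hav hadj]
  unfold qq pp kap
  rw [h4]
  field_simp
  ring

set_option maxHeartbeats 1000000 in
lemma log_bound {L r n l A D η p : ℝ} (hL : 1000 ≤ L) (hr : L ^ 50 ≤ r) (hn : r * r = n)
    (hl : 1 / L ≤ l) (hA : |A| ≤ 2 * L / r) (hD : |D| ≤ L ^ 4 / n)
    (hη : |η| ≤ L ^ 36 / (n * r)) (hp : p = l + A + D + η) :
    0 < p ∧ |Real.log p - (Real.log l + ((A + D) / l - A ^ 2 / (2 * l ^ 2)))| ≤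
      L ^ 38 / (n * r) := by
  have hL0 : 0 < L := by linarith
  have hL1 : 1 ≤ L := by linarith
  have hr0 : 0 < r := lt_of_lt_of_le (by positivity) hr
  have hn0 : 0 < n := by rw [← hn]; positivity
  have hl0 : 0 < l := lt_of_lt_of_le (by positivity) hl
  have hr1 : 1 ≤ r := (one_le_pow₀ hL1).trans hr
  have hil : |1 / l| ≤ L := by
    rw [abs_of_pos (by positivity), div_le_comm₀ hl0 hL0]; exact hl
  have hpow (k : ℕ) (hk : k ≤ 50) : L ^ k ≤ r := (pow_le_pow_right₀ hL1 hk).trans hr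
  have hη' : |η| ≤ 1 / n := by
    refine hη.trans ?_
    rw [div_le_div_iff₀ (by positivity) hn0]
    nlinarith [hpow 36 (by norm_num)]
  have hDη : |D + η| ≤ 2 * L ^ 4 / n := by
    refine (abs_add_le _ _).trans ((add_le_add hD hη').trans ?_)
    rw [← add_div]
    gcongr
    have : 1 ≤ L ^ 4 := one_le_pow₀ hL1
    linarith
  have hDr : 2 * L ^ 4 / n ≤ L / r := by
    rw [div_le_div_iff₀ hn0 hr0, ← hn]
    have : 2 * L ^ 4 ≤ L * r := by
      have := hpow 5 (by norm_num)
      have : L ^ 5 = L * L ^ 4 := by ring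
      nlinarith [pow_pos hL0 4]
    nlinarith
  have hx : |(A + D + η) * (1 / l)| ≤ 3 * L / r * L := by
    refine abs_mul_le_mul ?_ hil
    rw [add_assoc]
    refine (abs_add_le _ _).trans ((add_le_add hA (hDη.trans hDr)).trans (le_of_eq ?_))
    ring
  set x := -((A + D + η) * (1 / l)) with hxdef
  have hx1 : |x| ≤ L ^ 3 / r := by
    rw [hxdef, abs_neg]
    refine hx.trans ?_
    rw [div_mul_eq_mul_div]
    gcongr
    nlinarith [pow_pos hL0 2]
  have hx2 : |x| ≤ 1 / 2 := by
    refine hx1.trans ?_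
    rw [div_le_div_iff₀ hr0 (by norm_num)]
    have := hpow 4 (by norm_num)
    nlinarith [pow_pos hL0 3]
  have hpx : p = l * (1 - x) := by rw [hp, hxdef]; field_simp; ring
  have hx3 : 0 < 1 - x := by linarith [(abs_le.1 hx2).2]
  refine ⟨by rw [hpx]; positivity, ?_⟩
  have hlog := Real.abs_log_sub_add_sum_range_le (x := x) (by linarith) 2
  rw [Finset.sum_range_succ, Finset.sum_range_one] at hlog
  norm_num at hlog
  have hlog' : |x + x ^ 2 / 2 + Real.log (1 - x)| ≤ 2 * L ^ 9 / (n * r) := by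
    refine hlog.trans ?_
    have h1 : |x| ^ 3 ≤ (L ^ 3 / r) ^ 3 := pow_le_pow_left₀ (abs_nonneg _) hx1 3
    have h2 : (L ^ 3 / r) ^ 3 = L ^ 9 / (n * r) := by rw [← hn]; field_simp
    rw [div_le_iff₀ (by linarith)]
    have h3 : 0 ≤ L ^ 9 / (n * r) := by positivity
    have h4 : 2 * L ^ 9 / (n * r) = 2 * (L ^ 9 / (n * r)) := by ring
    rw [h4]
    nlinarith
  have e1 : Real.log p = Real.log l + Real.log (1 - x) := by
    rw [hpx, Real.log_mul hl0.ne' hx3.ne']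
  have e2 : Real.log p - (Real.log l + ((A + D) / l - A ^ 2 / (2 * l ^ 2))) =
      (x + x ^ 2 / 2 + Real.log (1 - x)) + η * (1 / l) -
        (D + η) * (2 * A + (D + η)) * ((1 / l) * (1 / l)) / 2 := by
    rw [e1, hxdef]; field_simp; ring
  have b1 := abs_mul_le_mul hη hil
  have b2 : |(D + η) * (2 * A + (D + η)) * ((1 / l) * (1 / l))| ≤
      2 * L ^ 4 / n * (5 * L / r) * (L * L) := by
    refine abs_mul_le_mul (abs_mul_le_mul hDη ?_) (abs_mul_le_mul hil hil)
    refine (abs_add_le _ _).trans ?_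
    rw [abs_mul, abs_two]
    refine (add_le_add (mul_le_mul_of_nonneg_left hA zero_le_two) (hDη.trans hDr)).trans
      (le_of_eq ?_)
    ring
  have b3 : L ^ 36 / (n * r) * L = L ^ 37 * (1 / (n * r)) := by ring
  have b4 : 2 * L ^ 4 / n * (5 * L / r) * (L * L) = 10 * L ^ 7 * (1 / (n * r)) := by
    field_simp; ring
  have b5 : 2 * L ^ 9 / (n * r) = 2 * L ^ 9 * (1 / (n * r)) := by ring
  have b6 : L ^ 37 * (1 / (n * r)) + 5 * L ^ 7 * (1 / (n * r)) + 2 * L ^ 9 * (1 / (n * r)) ≤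
      L ^ 38 / (n * r) := by
    rw [← add_mul, ← add_mul, ← div_eq_mul_one_div]
    gcongr
    have g1 : L ^ 7 ≤ L ^ 37 := pow_le_pow_right₀ hL1 (by norm_num)
    have g2 : L ^ 9 ≤ L ^ 37 := pow_le_pow_right₀ hL1 (by norm_num)
    have g3 : 8 * L ^ 37 ≤ L * L ^ 37 :=
      mul_le_mul_of_nonneg_right (by linarith only [hL]) (by positivity)
    have g4 : L * L ^ 37 = L ^ 38 := by ring
    linarith only [g1, g2, g3, g4]
  rw [b3] at b1
  rw [b4] at b2
  rw [b5] at hlog'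
  rw [e2]
  generalize (D + η) * (2 * A + (D + η)) * ((1 / l) * (1 / l)) = W at *
  generalize η * (1 / l) = W' at *
  generalize x + x ^ 2 / 2 + Real.log (1 - x) = W'' at *
  rw [abs_le] at hlog' b1 b2 ⊢
  constructor <;> linarith only [hlog'.1, hlog'.2, b1.1, b1.2, b2.1, b2.2, b6]

lemma telescoping (T : Tame d L) (hM : ((M + 8 : ℕ) : ℝ) ≤ L) (h0 : (cls d ⊥).Nonempty)
    (Y : SimpleGraph (Fin n)) (hY : ∀ j, deg Y j ≤ M) :
    (cls d Y).Nonempty ∧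
      |Real.log ((cls d Y).card / (cls d ⊥).card) - psi d Y| ≤ ee Y * (L ^ 38 / (n * √n)) := by
  have hL := T.Lpos
  have hn := T.npos
  have hs := T.sqrt_pos
  induction Y using WellFoundedLT.induction with
  | ind Y ih =>
    by_cases hb : Y = ⊥
    · subst hb
      refine ⟨h0, ?_⟩
      have h1 : ((cls d ⊥).card : ℝ) ≠ 0 := by exact_mod_cast h0.card_pos.ne'
      have h2 : ∀ j : Fin n, deg (⊥ : SimpleGraph (Fin n)) j = 0 := fun j => by simp [deg]
      have h3 : psi d (⊥ : SimpleGraph (Fin n)) = 0 := by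
        simp [psi, ee, h2, quad, ind]
      rw [div_self h1, h3]
      simp [ee, h2]
    · obtain ⟨X, a, v, hlt, hav, hadj, rfl⟩ := exists_eq_sup_edge hb
      have hX : ∀ j, deg X j ≤ M := fun j => by
        have := hY j
        rw [deg_sup_edge hav hadj] at this
        omega
      obtain ⟨hne, hX2⟩ := ih X hlt hX
      have hM' : (M : ℝ) ≤ L := by push_cast at hM; linarith
      have hpr := abs_pr_sub_qq_le_fine T hM hX hne hav hadj
      have hqp := abs_qq_sub_pp_le T (Y := X) (fun j => le_trans (by exact_mod_cast hX j) hM') a v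
      have hA : |(dl d a + dl d v) / n| ≤ 2 * L / √n := by
        rw [abs_div, Nat.abs_cast, div_le_div_iff₀ hn hs]
        have : |dl d a + dl d v| ≤ 2 * L * √n := (abs_add_le _ _).trans (by
          linarith [abs_dl_le T a, abs_dl_le T v])
        calc |dl d a + dl d v| * √n ≤ 2 * L * √n * √n := by gcongr
          _ = 2 * L * n := by rw [mul_assoc, T.sqrt_mul]
      obtain ⟨hp0, hlog⟩ := log_bound (l := lam n d) (A := (dl d a + dl d v) / n)
        (D := qq d X a v - pp d a v) (η := pr d X a v - qq d X a v) (p := pr d X a v) T.hL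
        (T.pow_le_sqrt (k := 50) le_rfl) T.sqrt_mul T.lo hA hqp hpr (by unfold pp; ring)
      have hcard := card_cls_sup_edge hne hav (d := d) (Y := X)
      have hX0 : (0 : ℝ) < (cls d X).card := by exact_mod_cast hne.card_pos
      have h00 : (0 : ℝ) < (cls d ⊥).card := by exact_mod_cast h0.card_pos
      constructor
      · rw [← Finset.card_pos]
        have : (0 : ℝ) < (cls d (X ⊔ SimpleGraph.edge a v)).card := by rw [hcard]; positivity
        exact_mod_cast this
      · rw [hcard, mul_div_right_comm, Real.log_mul (by positivity) hp0.ne',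
          psi_sup_edge hn (lam_pos T) (one_sub_lam_pos T) hav hadj, ee_sup_edge hav hadj]
        have e : (kap d * (dl d a * dl d v) - tau d v * dl d a * n) / (lam n d * n ^ 2) = 0 := by
          rw [tau]; field_simp; ring
        rw [e]
        rw [abs_le] at hX2 hlog ⊢
        constructor <;> linarith [hX2.1, hX2.2, hlog.1, hlog.2]

end telescoping

section exchange

variable {n : ℕ} {H : SimpleGraph (Fin n)} {h : ℕ} {f : Fin n → ℝ}

/-- The quadratic form of the adjacency matrix. -/
noncomputable def qf (H : SimpleGraph (Fin n)) (f : Fin n → ℝ) : ℝ :=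
  ∑ j, ∑ k, ind H j k * (f j * f k)

/-- The action of the adjacency matrix. -/
noncomputable def nbr (H : SimpleGraph (Fin n)) (f : Fin n → ℝ) (j : Fin n) : ℝ :=
  ∑ k, ind H j k * f k

lemma qf_eq (H : SimpleGraph (Fin n)) (f : Fin n → ℝ) : qf H f = ∑ j, f j * nbr H f j := by
  simp only [qf, nbr, Finset.mul_sum]
  exact Finset.sum_congr rfl fun j _ => Finset.sum_congr rfl fun k _ => by ring

lemma sum_mul_nbr_comm (H : SimpleGraph (Fin n)) (f g : Fin n → ℝ) :
    ∑ j, f j * nbr H g j = ∑ j, g j * nbr H f j := by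
  simp only [nbr, Finset.mul_sum]
  rw [Finset.sum_comm]
  exact Finset.sum_congr rfl fun j _ => Finset.sum_congr rfl fun k _ => by
    rw [ind_comm H k j]; ring

lemma nbr_add_mul (H : SimpleGraph (Fin n)) (f g : Fin n → ℝ) (t : ℝ) (j : Fin n) :
    nbr H (fun i => f i + t * g i) j = nbr H f j + t * nbr H g j := by
  simp only [nbr, mul_add, Finset.sum_add_distrib, Finset.mul_sum]
  congr 1
  exact Finset.sum_congr rfl fun k _ => by ring

lemma qf_add_mul (H : SimpleGraph (Fin n)) (f g : Fin n → ℝ) (t : ℝ) :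
    qf H (fun i => f i + t * g i) = qf H f + 2 * t * ∑ j, g j * nbr H f j + t ^ 2 * qf H g := by
  simp only [qf_eq, nbr_add_mul]
  have : ∀ j, (f j + t * g j) * (nbr H f j + t * nbr H g j) =
      f j * nbr H f j + t * (f j * nbr H g j) + t * (g j * nbr H f j) +
        t ^ 2 * (g j * nbr H g j) := fun j => by ring
  simp only [this, Finset.sum_add_distrib, ← Finset.mul_sum]
  rw [sum_mul_nbr_comm H f g]; ring

lemma qf_swap (H : SimpleGraph (Fin n)) (f : Fin n → ℝ) (x y : Fin n) :
    qf H (fun i => f (Equiv.swap x y i)) = qf H f +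
      2 * (f y - f x) * (nbr H f x - nbr H f y) - 2 * (f y - f x) ^ 2 * ind H x y := by
  by_cases hxy : x = y
  · subst hxy; simp
  set g : Fin n → ℝ := fun i => (if i = x then 1 else 0) - (if i = y then 1 else 0) with hg
  have e : (fun i => f (Equiv.swap x y i)) = fun i => f i + (f y - f x) * g i := by
    funext i
    by_cases h1 : i = x
    · subst h1; simp [hg, hxy]
    · by_cases h2 : i = y
      · subst h2; simp [hg, h1]
      · rw [Equiv.swap_apply_of_ne_of_ne h1 h2]; simp [hg, h1, h2]
  have s1 (u : Fin n → ℝ) : ∑ j, g j * u j = u x - u y := by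
    simp [hg, sub_mul, Finset.sum_sub_distrib]
  have s2 (j : Fin n) : nbr H g j = ind H j x - ind H j y := by
    rw [nbr, ← s1 fun k => ind H j k]
    exact Finset.sum_congr rfl fun k _ => mul_comm _ _
  rw [e, qf_add_mul, s1, qf_eq H g, s1, s2, s2, ind_self, ind_self, ind_comm H y x]
  ring

lemma sum_nbr (hH : ∀ j, deg H j = h) (f : Fin n → ℝ) : ∑ j, nbr H f j = h * ∑ j, f j := by
  have := sum_mul_nbr_comm H (fun _ => 1) f
  simp only [one_mul] at this
  rw [this]
  have e : ∀ j, nbr H (fun _ => 1) j = h := fun j => by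
    simp [nbr, sum_ind, hH]
  simp only [e, ← Finset.sum_mul]
  ring

lemma sum_qf_swap (hH : ∀ j, deg H j = h) (hf : ∑ j, f j = 0) :
    ∑ x, ∑ y, (qf H (fun i => f (Equiv.swap x y i)) - qf H f) =
      -4 * ((n : ℝ) - 1) * qf H f - 4 * h * ∑ j, f j ^ 2 := by
  have e : ∀ x y, qf H (fun i => f (Equiv.swap x y i)) - qf H f =
      2 * (f y * nbr H f x) - 2 * (f y * nbr H f y) - 2 * (f x * nbr H f x) +
        2 * (f x * nbr H f y) - 2 * (ind H x y * f y ^ 2) - 2 * (f x ^ 2 * ind H x y) +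
        4 * (ind H x y * (f x * f y)) := fun x y => by rw [qf_swap]; ring
  have e1 : ∑ x, ∑ y, ind H x y * f y ^ 2 = h * ∑ j, f j ^ 2 :=
    sum_nbr hH fun j => f j ^ 2
  have e2 : ∑ x, ∑ y, f x ^ 2 * ind H x y = h * ∑ j, f j ^ 2 := by
    simp only [← Finset.mul_sum, sum_ind, hH, ← Finset.sum_mul]; ring
  have e3 : ∑ x, ∑ y, f y * nbr H f x = 0 := by
    simp only [← Finset.sum_mul, hf, zero_mul, Finset.sum_const_zero]
  have e4 : ∑ x, ∑ y, f x * nbr H f y = 0 := by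
    simp only [← Finset.mul_sum, ← Finset.sum_mul, hf, zero_mul]
  have e5 : ∑ x : Fin n, ∑ y, f y * nbr H f y = n * qf H f := by
    rw [← qf_eq]; simp
  have e6 : ∑ x, ∑ _y : Fin n, f x * nbr H f x = n * qf H f := by
    simp only [Finset.sum_const, Finset.card_univ, Fintype.card_fin, nsmul_eq_mul]
    rw [← Finset.mul_sum, ← qf_eq]
  simp only [e, Finset.sum_add_distrib, Finset.sum_sub_distrib, ← Finset.mul_sum]
  simp only [Finset.mul_sum] at *
  simp only [← Finset.mul_sum] at *
  rw [e1, e2, e3, e4, e5, e6, ← qf]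
  ring

lemma abs_qf_swap_sub_le (hH : ∀ j, deg H j = h) (hh : 1 ≤ h) {B : ℝ} (hf : ∀ j, |f j| ≤ B)
    (x y : Fin n) :
    |qf H (fun i => f (Equiv.swap x y i)) - qf H f| ≤ 16 * h * B ^ 2 := by
  have hB : 0 ≤ B := (abs_nonneg _).trans (hf x)
  have hu : ∀ j, |nbr H f j| ≤ h * B := fun j => by
    rw [← hH j, ← sum_ind, Finset.sum_mul]
    refine (Finset.abs_sum_le_sum_abs _ _).trans (Finset.sum_le_sum fun k _ => ?_)
    rw [abs_mul, abs_of_nonneg (ind_nonneg H j k)]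
    exact mul_le_mul_of_nonneg_left (hf k) (ind_nonneg H j k)
  have h1 : |f y - f x| ≤ 2 * B := (abs_sub _ _).trans (by linarith [hf x, hf y])
  have h2 : |nbr H f x - nbr H f y| ≤ 2 * (h * B) :=
    (abs_sub _ _).trans (by linarith [hu x, hu y])
  have h3 : |ind H x y| ≤ 1 := by
    rw [abs_of_nonneg (ind_nonneg H x y)]; exact ind_le_one H x y
  have h4 := abs_mul_le_mul h1 h2
  have h5 := abs_mul_le_mul (abs_mul_le_mul h1 h1) h3
  have h6 : (1 : ℝ) ≤ h := by exact_mod_cast hh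
  have e : qf H (fun i => f (Equiv.swap x y i)) - qf H f =
      2 * ((f y - f x) * (nbr H f x - nbr H f y)) -
        2 * ((f y - f x) * (f y - f x) * ind H x y) := by
    rw [qf_swap]; ring
  rw [e]
  refine (abs_sub _ _).trans ?_
  rw [abs_mul, abs_mul (2 : ℝ), abs_two]
  nlinarith [sq_nonneg B]

lemma abs_exp_sub_exp_le (x y : ℝ) :
    |Real.exp x - Real.exp y| ≤ |x - y| * (Real.exp x + Real.exp y) := by
  have h1 (x y : ℝ) : Real.exp x - Real.exp y ≤ |x - y| * (Real.exp x + Real.exp y) := by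
    have e : Real.exp x - Real.exp y = Real.exp x * (1 - Real.exp (y - x)) := by
      rw [mul_sub, ← Real.exp_add]; ring_nf
    have h2 : 1 - Real.exp (y - x) ≤ x - y := by linarith [Real.add_one_le_exp (y - x)]
    rw [e]
    calc Real.exp x * (1 - Real.exp (y - x)) ≤ Real.exp x * |x - y| := by
          gcongr; exact h2.trans (le_abs_self _)
      _ ≤ _ := by nlinarith [abs_nonneg (x - y), Real.exp_pos x, Real.exp_pos y]
  rw [abs_le]
  constructor
  · have := h1 y x
    rw [abs_sub_comm] at this
    linarith
  · exact h1 x y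

/-- The quadratic form after relabelling by a permutation. -/
noncomputable def qp (H : SimpleGraph (Fin n)) (f : Fin n → ℝ) (π : Equiv.Perm (Fin n)) : ℝ :=
  qf H fun i => f (π i)

lemma sum_perm_swap (x y : Fin n) (φ : Equiv.Perm (Fin n) → ℝ) :
    ∑ π, φ (π * Equiv.swap x y) = ∑ π, φ π :=
  Equiv.sum_comp (Equiv.mulRight (Equiv.swap x y)) φ

lemma stein_identity (hH : ∀ j, deg H j = h) (hf : ∑ j, f j = 0)
    (g : Equiv.Perm (Fin n) → ℝ) :
    ∑ π, (-4 * ((n : ℝ) - 1) * qp H f π - 4 * h * ∑ j, f j ^ 2) * g π =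
      (1 / 2) * ∑ x, ∑ y, ∑ π, (qp H f (π * Equiv.swap x y) - qp H f π) *
        (g π - g (π * Equiv.swap x y)) := by
  have e1 : ∀ π, -4 * ((n : ℝ) - 1) * qp H f π - 4 * h * ∑ j, f j ^ 2 =
      ∑ x, ∑ y, (qp H f (π * Equiv.swap x y) - qp H f π) := by
    intro π
    have h1 := sum_qf_swap (f := fun i => f (π i)) hH (by rw [Equiv.sum_comp π f, hf])
    rw [Equiv.sum_comp π fun i => f i ^ 2] at h1
    exact h1.symm
  simp only [e1, Finset.sum_mul]
  rw [Finset.sum_comm, Finset.mul_sum]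
  refine Finset.sum_congr rfl fun x _ => ?_
  rw [Finset.sum_comm, Finset.mul_sum]
  refine Finset.sum_congr rfl fun y _ => ?_
  have h2 := sum_perm_swap x y fun π => (qp H f (π * Equiv.swap x y) - qp H f π) * g π
  simp only [mul_assoc, Equiv.swap_mul_self, mul_one] at h2
  have h3 : ∑ π, (qp H f (π * Equiv.swap x y) - qp H f π) * (g π - g (π * Equiv.swap x y)) =
      ∑ π, (qp H f (π * Equiv.swap x y) - qp H f π) * g π +
      ∑ π, (qp H f π - qp H f (π * Equiv.swap x y)) * g (π * Equiv.swap x y) := by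
    rw [← Finset.sum_add_distrib]
    exact Finset.sum_congr rfl fun π _ => by ring
  rw [h3, h2]; ring

lemma abs_sum_qp_exp_le (hH : ∀ j, deg H j = h) (hh : 1 ≤ h) (hf : ∑ j, f j = 0)
    {B : ℝ} (hB : ∀ j, |f j| ≤ B) (c : ℝ) (hn : 1 < (n : ℝ)) :
    |∑ π, qp H f π * Real.exp (c * qp H f π)| ≤
      (h * (n * B ^ 2) + 64 * |c| * n ^ 2 * (h * B ^ 2) ^ 2) / (n - 1) *
        ∑ π, Real.exp (c * qp H f π) := by
  set A := ∑ π, Real.exp (c * qp H f π) with hA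
  have hA0 : 0 ≤ A := Finset.sum_nonneg fun π _ => (Real.exp_pos _).le
  have hQ : ∑ j, f j ^ 2 ≤ n * B ^ 2 := by
    calc ∑ j, f j ^ 2 ≤ ∑ _j : Fin n, B ^ 2 := Finset.sum_le_sum fun j _ => by
          rw [← sq_abs]; exact pow_le_pow_left₀ (abs_nonneg _) (hB j) 2
      _ = n * B ^ 2 := by simp
  have hQ0 : 0 ≤ ∑ j, f j ^ 2 := Finset.sum_nonneg fun j _ => sq_nonneg _
  have hst := stein_identity hH hf fun π => Real.exp (c * qp H f π)
  have hdiff : ∀ x y π, |qp H f (π * Equiv.swap x y) - qp H f π| ≤ 16 * h * B ^ 2 :=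
    fun x y π => abs_qf_swap_sub_le (f := fun i => f (π i)) hH hh (fun j => hB _) x y
  have hterm : ∀ x y, |∑ π, (qp H f (π * Equiv.swap x y) - qp H f π) *
      (Real.exp (c * qp H f π) - Real.exp (c * qp H f (π * Equiv.swap x y)))| ≤
      2 * |c| * (16 * h * B ^ 2) ^ 2 * A := by
    intro x y
    have h1 : ∀ π, |(qp H f (π * Equiv.swap x y) - qp H f π) *
      (Real.exp (c * qp H f π) - Real.exp (c * qp H f (π * Equiv.swap x y)))| ≤
      |c| * (16 * h * B ^ 2) ^ 2 * (Real.exp (c * qp H f π) +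
        Real.exp (c * qp H f (π * Equiv.swap x y))) := by
      intro π
      have h2 : |Real.exp (c * qp H f π) - Real.exp (c * qp H f (π * Equiv.swap x y))| ≤
          |c| * (16 * h * B ^ 2) * (Real.exp (c * qp H f π) +
            Real.exp (c * qp H f (π * Equiv.swap x y))) := by
        refine (abs_exp_sub_exp_le _ _).trans ?_
        refine mul_le_mul_of_nonneg_right ?_ (by positivity)
        rw [← mul_sub, abs_mul, abs_sub_comm]
        exact mul_le_mul_of_nonneg_left (hdiff x y π) (abs_nonneg _)
      refine (abs_mul_le_mul (hdiff x y π) h2).trans (le_of_eq (by ring))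
    refine (Finset.abs_sum_le_sum_abs _ _).trans ((Finset.sum_le_sum fun π _ => h1 π).trans ?_)
    rw [← Finset.mul_sum, Finset.sum_add_distrib,
      sum_perm_swap x y fun π => Real.exp (c * qp H f π), ← hA]
    apply le_of_eq; ring
  have hsum : |∑ x : Fin n, ∑ y : Fin n, ∑ π, (qp H f (π * Equiv.swap x y) - qp H f π) *
      (Real.exp (c * qp H f π) - Real.exp (c * qp H f (π * Equiv.swap x y)))| ≤
      n * (n * (2 * |c| * (16 * h * B ^ 2) ^ 2 * A)) := by
    refine (Finset.abs_sum_le_sum_abs _ _).trans ?_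
    have h1 : ∀ x : Fin n, |∑ y : Fin n, ∑ π, (qp H f (π * Equiv.swap x y) - qp H f π) *
      (Real.exp (c * qp H f π) - Real.exp (c * qp H f (π * Equiv.swap x y)))| ≤
      n * (2 * |c| * (16 * h * B ^ 2) ^ 2 * A) := fun x => by
      refine (Finset.abs_sum_le_sum_abs _ _).trans
        ((Finset.sum_le_sum fun y _ => hterm x y).trans (le_of_eq ?_))
      simp
    refine (Finset.sum_le_sum fun x _ => h1 x).trans (le_of_eq ?_)
    simp
  have e1 : ∑ π, (-4 * ((n : ℝ) - 1) * qp H f π - 4 * h * ∑ j, f j ^ 2) *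
      Real.exp (c * qp H f π) =
      -4 * ((n : ℝ) - 1) * (∑ π, qp H f π * Real.exp (c * qp H f π)) -
        4 * h * (∑ j, f j ^ 2) * A := by
    rw [hA]
    generalize ∑ j, f j ^ 2 = Q
    rw [Finset.mul_sum, Finset.mul_sum, ← Finset.sum_sub_distrib]
    exact Finset.sum_congr rfl fun π _ => by ring
  rw [e1] at hst
  have hn1 : 0 < (n : ℝ) - 1 := by linarith
  have habs : ∀ x : ℝ, |x| * ((n : ℝ) - 1) = |x * ((n : ℝ) - 1)| := fun x => by
    rw [abs_mul, abs_of_pos hn1]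
  rw [div_mul_eq_mul_div, le_div_iff₀ hn1, habs]
  set X := ∑ π, qp H f π * Real.exp (c * qp H f π) with hX
  have e2 : X * ((n : ℝ) - 1) = -(h * (∑ j, f j ^ 2) * A) - (1 / 8) *
      ∑ x : Fin n, ∑ y : Fin n, ∑ π, (qp H f (π * Equiv.swap x y) - qp H f π) *
      (Real.exp (c * qp H f π) - Real.exp (c * qp H f (π * Equiv.swap x y))) := by
    linear_combination (-1 / 4) * hst
  rw [e2]
  refine (abs_sub _ _).trans ?_
  rw [abs_neg, abs_mul (1 / 8), abs_of_pos (by norm_num : (0 : ℝ) < 1 / 8),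
    abs_of_nonneg (by positivity : 0 ≤ h * (∑ j, f j ^ 2) * A)]
  have h3 : h * (∑ j, f j ^ 2) * A ≤ h * (n * B ^ 2) * A := by gcongr
  have h4 : (1 / 8) * ((n : ℝ) * (n * (2 * |c| * (16 * h * B ^ 2) ^ 2 * A))) =
      64 * |c| * n ^ 2 * (h * B ^ 2) ^ 2 * A := by ring
  rw [add_mul]
  linarith

/-- The exponential moment of the relabelled quadratic form is close to one. -/
lemma abs_avg_exp_sub_one_le (hH : ∀ j, deg H j = h) (hh : 1 ≤ h) (hf : ∑ j, f j = 0)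
    {B : ℝ} (hB : ∀ j, |f j| ≤ B) (c : ℝ) (hn : 1 < (n : ℝ)) {θ : ℝ}
    (hθ : |c| * ((h * (n * B ^ 2) + 64 * |c| * n ^ 2 * (h * B ^ 2) ^ 2) / (n - 1)) ≤ θ)
    (hθ1 : θ ≤ 1 / 2) :
    |(∑ π, Real.exp (c * qp H f π)) / (n.factorial : ℝ) - 1| ≤ 2 * θ := by
  have hn1 : 0 < (n : ℝ) - 1 := by linarith
  have hfac : (0 : ℝ) < n.factorial := by exact_mod_cast n.factorial_pos
  have hcard : ∑ _π : Equiv.Perm (Fin n), (1 : ℝ) = n.factorial := by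
    simp [Fintype.card_perm]
  set A := ∑ π, Real.exp (c * qp H f π) with hA
  have hA0 : 0 ≤ A := Finset.sum_nonneg fun π _ => (Real.exp_pos _).le
  have h1 := abs_sum_qp_exp_le hH hh hf hB c hn
  have h2 := abs_sum_qp_exp_le hH hh hf hB 0 hn
  simp only [zero_mul, Real.exp_zero, mul_one, abs_zero, mul_zero, add_zero] at h2
  rw [hcard] at h2
  rw [← hA] at h1
  have h3 : |c * ∑ π, qp H f π| ≤ θ * n.factorial := by
    rw [abs_mul]
    calc |c| * |∑ π, qp H f π| ≤ |c| * (h * (n * B ^ 2) / (n - 1) * n.factorial) := by gcongr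
      _ = |c| * ((h * (n * B ^ 2)) / (n - 1)) * n.factorial := by ring
      _ ≤ |c| * ((h * (n * B ^ 2) + 64 * |c| * n ^ 2 * (h * B ^ 2) ^ 2) / (n - 1)) *
          n.factorial := by
        gcongr
        have : 0 ≤ 64 * |c| * n ^ 2 * (h * B ^ 2) ^ 2 := by positivity
        linarith
      _ ≤ _ := by gcongr
  have h4 : |c * ∑ π, qp H f π * Real.exp (c * qp H f π)| ≤ θ * A := by
    rw [abs_mul]
    calc _ ≤ |c| * ((h * (n * B ^ 2) + 64 * |c| * n ^ 2 * (h * B ^ 2) ^ 2) / (n - 1) * A) := by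
          gcongr
      _ = |c| * ((h * (n * B ^ 2) + 64 * |c| * n ^ 2 * (h * B ^ 2) ^ 2) / (n - 1)) * A := by ring
      _ ≤ _ := by gcongr
  have h5 : c * ∑ π, qp H f π + n.factorial ≤ A := by
    rw [hA, ← hcard, Finset.mul_sum, ← Finset.sum_add_distrib]
    exact Finset.sum_le_sum fun π _ => Real.add_one_le_exp _
  have h6 : A - n.factorial ≤ c * ∑ π, qp H f π * Real.exp (c * qp H f π) := by
    rw [hA, ← hcard, Finset.mul_sum, ← Finset.sum_sub_distrib]
    refine Finset.sum_le_sum fun π _ => ?_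
    have h7 := Real.add_one_le_exp (-(c * qp H f π))
    have h8 : Real.exp (-(c * qp H f π)) * Real.exp (c * qp H f π) = 1 := by
      rw [← Real.exp_add]; simp
    nlinarith [Real.exp_pos (c * qp H f π)]
  have hθ0 : 0 ≤ θ := le_trans (by positivity) hθ
  have h3' := (abs_le.1 h3).1
  have h4' := (abs_le.1 h4).2
  have h9 : A ≤ 2 * n.factorial := by nlinarith
  rw [abs_le, le_sub_iff_add_le, sub_le_iff_le_add, le_div_iff₀ hfac, div_le_iff₀ hfac]
  constructor <;> nlinarith

end exchange

section copies

variable {n : ℕ} {d : Fin n → ℕ} {L : ℝ} {H : SimpleGraph (Fin n)} {h : ℕ}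

lemma card_comap_eq {K : SimpleGraph (Fin n)} (hK : Nonempty (K ≃g H)) :
    (Finset.univ.filter fun π : Equiv.Perm (Fin n) => H.comap π = K).card = autCard H := by
  obtain ⟨σ⟩ := hK
  have hσ : ∀ u v, H.Adj (σ u) (σ v) ↔ K.Adj u v := fun u v => σ.map_adj_iff
  set s : Equiv.Perm (Fin n) := σ.toEquiv with hs
  have hs' : ∀ u, s u = σ u := fun u => rfl
  unfold autCard
  refine Finset.card_nbij' (fun π => π * s⁻¹) (fun α => α * s) ?_ ?_ ?_ ?_
  · intro π hπ
    simp only [Finset.coe_filter, Finset.mem_univ, true_and, Set.mem_ofPred_eq] at hπ ⊢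
    intro i j
    have h1 : H.Adj (π (s⁻¹ i)) (π (s⁻¹ j)) ↔ K.Adj (s⁻¹ i) (s⁻¹ j) := by rw [← hπ]; rfl
    rw [Equiv.Perm.mul_apply, Equiv.Perm.mul_apply, h1, ← hσ, ← hs', ← hs',
      ← Equiv.Perm.mul_apply, ← Equiv.Perm.mul_apply, mul_inv_cancel, Equiv.Perm.one_apply,
      Equiv.Perm.one_apply]
  · intro α hα
    simp only [Finset.coe_filter, Finset.mem_univ, true_and, Set.mem_ofPred_eq] at hα ⊢
    ext u v
    rw [SimpleGraph.comap_adj, Equiv.Perm.mul_apply, Equiv.Perm.mul_apply, hα, hs', hs', hσ]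
  · intro π _; simp
  · intro α _; simp

lemma copyCount_mul_autCard (H G : SimpleGraph (Fin n)) :
    copyCount H G * autCard H =
      (Finset.univ.filter fun π : Equiv.Perm (Fin n) => H.comap π ≤ G).card := by
  unfold copyCount
  rw [Finset.card_eq_sum_card_fiberwise (f := fun π : Equiv.Perm (Fin n) => H.comap π)
    (t := Finset.univ.filter fun K : SimpleGraph (Fin n) => K ≤ G ∧ Nonempty (K ≃g H))]
  · rw [Finset.sum_congr rfl (g := fun _ => autCard H), Finset.sum_const, smul_eq_mul]
    intro K hK
    obtain ⟨h1, h2⟩ := (Finset.mem_filter.1 hK).2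
    rw [← card_comap_eq h2, Finset.filter_filter]
    congr 1
    ext π
    simp only [Finset.mem_filter, Finset.mem_univ, true_and]
    exact ⟨fun h => h.2, fun h => ⟨h ▸ h1, h⟩⟩
  · intro π hπ
    simp only [Finset.coe_filter, Finset.mem_univ, true_and, Set.mem_ofPred_eq] at hπ ⊢
    exact ⟨hπ, ⟨⟨π, by intro u v; rfl⟩⟩⟩

lemma autCard_pos (H : SimpleGraph (Fin n)) : 0 < autCard H :=
  Finset.card_pos.2 ⟨1, by simp⟩

lemma degFinset_eq_cls : degFinset n d = cls d ⊥ := by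
  ext G; simp [degFinset, cls]

lemma expCopies_eq (d : Fin n → ℕ) (H : SimpleGraph (Fin n)) :
    expCopies n d H = (1 / (autCard H : ℝ)) *
      ∑ π : Equiv.Perm (Fin n), ((cls d (H.comap π)).card : ℝ) / (cls d ⊥).card := by
  have h1 : (∑ G ∈ degFinset n d, copyCount H G) * autCard H =
      ∑ π : Equiv.Perm (Fin n), (cls d (H.comap π)).card := by
    rw [Finset.sum_mul, Finset.sum_congr rfl fun G _ => copyCount_mul_autCard H G]
    simp only [Finset.card_filter, cls, degFinset]
    rw [Finset.sum_comm]
    refine Finset.sum_congr rfl fun π _ => ?_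
    rw [Finset.sum_filter]
    refine Finset.sum_congr rfl fun G _ => ?_
    by_cases hG : ∀ j, deg G j = d j <;> simp [hG]
  have h2 : (∑ G ∈ degFinset n d, (copyCount H G : ℝ)) * autCard H =
      ∑ π : Equiv.Perm (Fin n), ((cls d (H.comap π)).card : ℝ) := by exact_mod_cast h1
  have hA : (autCard H : ℝ) ≠ 0 := by exact_mod_cast (autCard_pos H).ne'
  rw [← Finset.sum_div, ← h2, expCopies, degFinset_eq_cls]
  field_simp

lemma deg_comap (π : Equiv.Perm (Fin n)) (j : Fin n) : deg (H.comap π) j = deg H (π j) := by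
  unfold deg
  refine Finset.card_bij (fun k _ => π k) ?_ ?_ ?_
  · intro k hk; simpa using hk
  · intro k _ l _ hkl; exact π.injective hkl
  · intro k hk
    exact ⟨π.symm k, by simpa using hk, by simp⟩

lemma quad_comap (π : Equiv.Perm (Fin n)) : quad d (H.comap π) = qp H (dl d) π⁻¹ := by
  unfold quad qp qf
  symm
  rw [← Equiv.sum_comp π]
  refine Finset.sum_congr rfl fun j _ => ?_
  rw [← Equiv.sum_comp π]
  refine Finset.sum_congr rfl fun k _ => ?_
  simp [ind]

/-- The main term of the logarithm of the expected number of copies. -/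
noncomputable def base (d : Fin n → ℕ) (h : ℕ) : ℝ :=
  -((1 - lam n d) / (4 * lam n d)) * (h * ((h : ℝ) - 2)) -
    Rpar n d * h / (2 * (lam n d) ^ 2 * n)

lemma psi_regular (T : Tame d L) {Y : SimpleGraph (Fin n)} (hY : ∀ j, deg Y j = h) :
    psi d Y = n * h / 2 * Real.log (lam n d) + base d h -
      (1 - lam n d) * h / (2 * lam n d * n) -
      quad d Y / (2 * (lam n d * (1 - lam n d)) * n ^ 2) := by
  have hn := T.npos
  have hl := lam_pos T
  have he : ee Y = n * h / 2 := by simp [ee, hY]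
  have h1 : ∑ j, dl d j * (deg Y j : ℝ) = 0 := by
    simp only [hY]; rw [← Finset.sum_mul, sum_dl T, zero_mul]
  have h2 : ∑ j, (deg Y j : ℝ) * (deg Y j - 1) = n * (h * (h - 1)) := by simp [hY]
  have h3 : ∑ j, dl d j ^ 2 * (deg Y j : ℝ) = n * Rpar n d * h := by
    simp only [hY]; rw [← Finset.sum_mul, Rpar]
    field_simp
    exact mul_comm _ _
  unfold psi base
  rw [he, h1, h2, h3]
  generalize quad d Y / (2 * (lam n d * (1 - lam n d)) * n ^ 2) = q
  generalize Real.log (lam n d) = l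
  field_simp
  ring

end copies

section combine

variable {n : ℕ} {d : Fin n → ℕ} {L : ℝ} {H : SimpleGraph (Fin n)} {h : ℕ}

/-- The coefficient of the quadratic form in the logarithm of a containment probability. -/
noncomputable def coef (d : Fin n → ℕ) : ℝ := -1 / (2 * (lam n d * (1 - lam n d)) * n ^ 2)

lemma abs_coef_le (T : Tame d L) : |coef d| ≤ L / n ^ 2 := by
  have hn := T.npos
  have hL := T.Lpos
  have h1 := lam_mul_ge T
  rw [div_le_iff₀ (by positivity)] at h1
  have h2 : 0 < lam n d * (1 - lam n d) := mul_pos (lam_pos T) (one_sub_lam_pos T)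
  unfold coef
  generalize lam n d * (1 - lam n d) = s at *
  rw [abs_div, abs_neg, abs_one, abs_of_pos (by positivity : 0 < 2 * s * (n : ℝ) ^ 2),
    div_le_div_iff₀ (by positivity) (by positivity)]
  have : (1 : ℝ) * n ^ 2 ≤ (s * (2 * L)) * n ^ 2 := by gcongr
  linarith

lemma abs_log_ratio_sub_le (T : Tame d L) (hh : ((h + 8 : ℕ) : ℝ) ≤ L)
    (h0 : (cls d ⊥).Nonempty) {Y : SimpleGraph (Fin n)} (hY : ∀ j, deg Y j = h) {m : ℕ}
    (hm : n * h = 2 * m) :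
    (cls d Y).Nonempty ∧
      |Real.log ((cls d Y).card / (cls d ⊥).card) -
        (m * Real.log (lam n d) + base d h + coef d * quad d Y)| ≤ L ^ 39 / √n := by
  have hn := T.npos
  have hL := T.Lpos
  have hs := T.sqrt_pos
  have hl := lam_pos T
  have hl1 := one_sub_lam_pos T
  obtain ⟨h1, h2⟩ := telescoping T hh h0 Y fun j => (hY j).le
  refine ⟨h1, ?_⟩
  have hhL : (h : ℝ) ≤ L := by push_cast at hh; linarith
  have hm' : (n : ℝ) * h / 2 = m := by
    have : (n : ℝ) * h = 2 * m := by exact_mod_cast hm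
    linarith
  have he : ee Y = n * h / 2 := by simp [ee, hY]
  have h3 := psi_regular T hY
  have h4 : psi d Y = (m * Real.log (lam n d) + base d h + coef d * quad d Y) -
      (1 - lam n d) * h / (2 * lam n d * n) := by
    rw [h3, hm', coef]; ring
  have h5 : ee Y * (L ^ 38 / (n * √n)) ≤ L ^ 39 / √n / 2 := by
    rw [he]
    have : (n : ℝ) * h / 2 * (L ^ 38 / (n * √n)) = h * L ^ 38 / √n / 2 := by field_simp
    rw [this]
    gcongr
    calc (h : ℝ) * L ^ 38 ≤ L * L ^ 38 := by gcongr
      _ = L ^ 39 := by ring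
  have h6 : |(1 - lam n d) * h / (2 * lam n d * n)| ≤ L ^ 39 / √n / 2 := by
    rw [abs_of_nonneg (by positivity)]
    have hlo := T.lo
    rw [div_le_iff₀ hL] at hlo
    have hsn : √(n : ℝ) ≤ n := by
      have h1n : (1 : ℝ) ≤ n := by have := T.n_ge; linarith
      nlinarith [T.sqrt_mul, Real.one_le_sqrt.2 h1n]
    rw [div_div, div_le_div_iff₀ (by positivity) (by positivity)]
    have hb : (1 - lam n d) * h ≤ L * lam n d * L := by
      calc (1 - lam n d) * h ≤ 1 * h := by gcongr; linarith
        _ ≤ (lam n d * L) * L := by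
          refine mul_le_mul hlo hhL (by positivity) (by positivity)
        _ = _ := by ring
    have hp : L ^ 2 ≤ L ^ 39 := pow_le_pow_right₀ T.one_le (by norm_num)
    calc (1 - lam n d) * h * (√n * 2) ≤ L * lam n d * L * (n * 2) := by gcongr
      _ = L ^ 2 * (2 * lam n d * n) := by ring
      _ ≤ _ := by gcongr
  rw [h4] at h2
  generalize m * Real.log (lam n d) + base d h + coef d * quad d Y = x at *
  rw [abs_le] at *
  constructor <;> linarith [h2.1, h2.2, h6.1, h6.2]

lemma abs_log_le_of_abs_sub_one_le {A t : ℝ} (ht : t ≤ 1 / 2) (hA : |A - 1| ≤ t) :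
    0 < A ∧ |Real.log A| ≤ 2 * t := by
  rw [abs_le] at hA
  have hA0 : 0 < A := by linarith [hA.1]
  refine ⟨hA0, abs_le.2 ⟨?_, by linarith [Real.log_le_sub_one_of_pos hA0, hA.2]⟩⟩
  refine le_trans ?_ (Real.one_sub_inv_le_log_of_pos hA0)
  have : A⁻¹ ≤ 1 + 2 * t := by
    rw [inv_le_comm₀ hA0 (by linarith)]
    rw [inv_le_iff_one_le_mul₀ (by linarith)]
    nlinarith
  linarith

/-- The exponential moment of the quadratic form is close to one. -/
lemma abs_log_avg_exp_le (T : Tame d L) (hh : 1 ≤ h) (hhL : (h : ℝ) ≤ L)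
    (hH : ∀ j, deg H j = h) :
    0 < (∑ π, Real.exp (coef d * qp H (dl d) π)) / (n.factorial : ℝ) ∧
    |Real.log ((∑ π, Real.exp (coef d * qp H (dl d) π)) / (n.factorial : ℝ))| ≤
      L ^ 10 / n := by
  have hn := T.npos
  have hL := T.Lpos
  have hL1 := T.one_le
  have hng := T.n_ge
  have hn1 : (0 : ℝ) < n - 1 := by linarith
  have hc := abs_coef_le T
  have hB2 : (L * √(n : ℝ)) ^ 2 = L ^ 2 * n := by rw [mul_pow, Real.sq_sqrt hn.le]
  have hθ : |coef d| * ((h * (n * (L * √n) ^ 2) +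
      64 * |coef d| * n ^ 2 * (h * (L * √n) ^ 2) ^ 2) / (n - 1)) ≤ L ^ 9 / n := by
    rw [hB2]
    calc |coef d| * ((h * (n * (L ^ 2 * n)) +
          64 * |coef d| * n ^ 2 * (h * (L ^ 2 * n)) ^ 2) / (n - 1))
        ≤ L / n ^ 2 * ((L * (n * (L ^ 2 * n)) +
          64 * (L / n ^ 2) * n ^ 2 * (L * (L ^ 2 * n)) ^ 2) / (n / 2)) := by
          gcongr; linarith
      _ = (2 * L ^ 4 + 128 * L ^ 8) / n := by field_simp; ring
      _ ≤ L ^ 9 / n := by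
          gcongr
          have h1 : L ^ 4 ≤ L ^ 8 := pow_le_pow_right₀ hL1 (by norm_num)
          have h2 : (1000 : ℝ) * L ^ 8 ≤ L * L ^ 8 := by gcongr; exact T.hL
          have h3 : (0 : ℝ) ≤ L ^ 8 := by positivity
          have h4 : L * L ^ 8 = L ^ 9 := by ring
          linarith
  have hθ4 : L ^ 9 / n ≤ 1 / 4 := by
    rw [div_le_iff₀ hn]
    have h1 := T.pow_le (k := 10) (by norm_num)
    have h2 : (1000 : ℝ) * L ^ 9 ≤ L * L ^ 9 := by gcongr; exact T.hL
    have h3 : L * L ^ 9 = L ^ 10 := by ring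
    have h4 : (0 : ℝ) ≤ L ^ 9 := by positivity
    linarith
  have h1 := abs_avg_exp_sub_one_le hH hh (sum_dl T) (abs_dl_le T) (coef d) (by linarith) hθ
    (by linarith)
  obtain ⟨h2, h3⟩ := abs_log_le_of_abs_sub_one_le (by linarith) h1
  refine ⟨h2, h3.trans ?_⟩
  calc 2 * (2 * (L ^ 9 / n)) = 4 * L ^ 9 / n := by ring
    _ ≤ L * L ^ 9 / n := by gcongr; linarith [T.hL]
    _ = L ^ 10 / n := by ring

/-- The expected number of copies of a regular graph, for tame degree sequences. -/
theorem expCopies_regular (T : Tame d L) (hh1 : 1 ≤ h) (hh : ((h + 8 : ℕ) : ℝ) ≤ L)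
    (h0 : (cls d ⊥).Nonempty) (hH : ∀ j, deg H j = h) {m : ℕ} (hm : n * h = 2 * m) :
    ∃ E : ℝ, |E| ≤ L ^ 40 / √n ∧
      expCopies n d H = ((n.factorial : ℝ) / autCard H) * lam n d ^ m *
        Real.exp (base d h + E) := by
  have hn := T.npos
  have hL := T.Lpos
  have hs := T.sqrt_pos
  have hl := lam_pos T
  have hfac : (0 : ℝ) < n.factorial := by exact_mod_cast n.factorial_pos
  have hhL : (h : ℝ) ≤ L := by push_cast at hh; linarith
  have h0' : (0 : ℝ) < (cls d ⊥).card := by exact_mod_cast h0.card_pos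
  obtain ⟨hA0, hA⟩ := abs_log_avg_exp_le T hh1 hhL hH
  set A := (∑ π, Real.exp (coef d * qp H (dl d) π)) / (n.factorial : ℝ) with hAdef
  set η := L ^ 39 / √(n : ℝ) with hη
  set D := lam n d ^ m * Real.exp (base d h) with hD
  have hDpos : 0 < D := by positivity
  have hη0 : 0 < η := by positivity
  set S := ∑ π : Equiv.Perm (Fin n), ((cls d (H.comap π)).card : ℝ) / (cls d ⊥).card with hS
  clear_value A η D S
  have hsum : ∑ π : Equiv.Perm (Fin n), Real.exp (coef d * qp H (dl d) π⁻¹) =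
      A * n.factorial := by
    rw [hAdef, div_mul_cancel₀ _ hfac.ne',
      ← Equiv.sum_comp (Equiv.inv (Equiv.Perm (Fin n))) fun π =>
        Real.exp (coef d * qp H (dl d) π)]
    rfl
  have hpt : ∀ π : Equiv.Perm (Fin n),
      D * Real.exp (coef d * qp H (dl d) π⁻¹) * Real.exp (-η) ≤
        ((cls d (H.comap π)).card : ℝ) / (cls d ⊥).card ∧
      ((cls d (H.comap π)).card : ℝ) / (cls d ⊥).card ≤
        D * Real.exp (coef d * qp H (dl d) π⁻¹) * Real.exp η := by
    intro π
    obtain ⟨h1, h2⟩ := abs_log_ratio_sub_le T hh h0 (Y := H.comap π)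
      (fun j => by rw [deg_comap, hH]) hm
    have h1' : (0 : ℝ) < (cls d (H.comap π)).card := by exact_mod_cast h1.card_pos
    rw [quad_comap, abs_le, ← hη] at h2
    have hDe : D = Real.exp (m * Real.log (lam n d) + base d h) := by
      rw [Real.exp_add, mul_comm (m : ℝ), Real.exp_mul, Real.exp_log hl, Real.rpow_natCast,
        hD]
    rw [hDe, ← Real.exp_add, ← Real.exp_add, ← Real.exp_add,
      ← Real.exp_log (div_pos h1' h0')]
    simp only [Real.exp_le_exp]
    constructor <;> linarith [h2.1, h2.2]
  have hlo : D * (A * n.factorial) * Real.exp (-η) ≤ S := by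
    rw [hS, ← hsum, Finset.mul_sum, Finset.sum_mul]
    exact Finset.sum_le_sum fun π _ => (hpt π).1
  have hhi : S ≤ D * (A * n.factorial) * Real.exp η := by
    rw [hS, ← hsum, Finset.mul_sum, Finset.sum_mul]
    exact Finset.sum_le_sum fun π _ => (hpt π).2
  have hSpos : 0 < S := lt_of_lt_of_le (by positivity) hlo
  have hW : 0 < S / (D * n.factorial) := by positivity
  refine ⟨Real.log (S / (D * n.factorial)), ?_, ?_⟩
  · have h1 : Real.log A - η ≤ Real.log (S / (D * n.factorial)) := by
      have : Real.log A - η = Real.log (A * Real.exp (-η)) := by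
        rw [Real.log_mul hA0.ne' (Real.exp_pos _).ne', Real.log_exp, sub_eq_add_neg]
      rw [this]
      refine Real.log_le_log (by positivity) ?_
      rw [le_div_iff₀ (by positivity)]
      linarith
    have h2 : Real.log (S / (D * n.factorial)) ≤ Real.log A + η := by
      have : Real.log A + η = Real.log (A * Real.exp η) := by
        rw [Real.log_mul hA0.ne' (Real.exp_pos _).ne', Real.log_exp]
      rw [this]
      refine Real.log_le_log hW ?_
      rw [div_le_iff₀ (by positivity)]
      linarith
    have h3 : L ^ 10 / n ≤ η := by
      rw [hη, div_le_div_iff₀ hn hs]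
      have hsn : √(n : ℝ) ≤ n := by
        have h1n : (1 : ℝ) ≤ n := by have := T.n_ge; linarith
        nlinarith [T.sqrt_mul, Real.one_le_sqrt.2 h1n]
      have := pow_le_pow_right₀ T.one_le (by norm_num : 10 ≤ 39)
      gcongr
    have h4 : 2 * η ≤ L ^ 40 / √n := by
      calc 2 * η ≤ L * η := by
            have : 0 ≤ η := by positivity
            gcongr; linarith [T.hL]
        _ = L ^ 40 / √n := by rw [hη]; ring
    rw [abs_le] at hA ⊢
    constructor <;> linarith [hA.1, hA.2]
  · have hA' : (autCard H : ℝ) ≠ 0 := by exact_mod_cast (autCard_pos H).ne'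
    rw [expCopies_eq, ← hS, Real.exp_add, Real.exp_log hW, hD]
    field_simp

end combine

lemma tame_of_bounds {n : ℕ} {d : Fin n → ℕ} {L A : ℝ} (hL : 1000 ≤ L) (hn : L ^ 100 ≤ n)
    (hdev : deltaPar n d ≤ L * √n) (hA : 0 < A) (hAL : A ≤ L)
    (hmin : min (dbar n d) ((n : ℝ) - dbar n d - 1) ≥ (n : ℝ) / A) : Tame d L := by
  have hn1 : (1 : ℝ) < n := by
    have : L ^ 1 ≤ L ^ 100 := pow_le_pow_right₀ (by linarith) (by norm_num)
    linarith
  have hn2 : (0 : ℝ) < n - 1 := by linarith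
  have hL0 : 0 < L := by linarith
  have h1 : (n - 1 : ℝ) / L ≤ n / A := by gcongr; linarith
  have h2 := (h1.trans hmin).trans (min_le_left _ _)
  have h3 := (h1.trans hmin).trans (min_le_right _ _)
  refine ⟨hL, hn, ?_, ?_, fun j => (le_trans ?_ hdev)⟩
  · rw [lam, le_div_iff₀ hn2]
    linarith [one_div_mul_eq_div L ((n : ℝ) - 1)]
  · rw [lam, div_le_iff₀ hn2, sub_mul, one_mul]
    linarith [one_div_mul_eq_div L ((n : ℝ) - 1)]
  · exact le_ciSup (f := fun j => |(d j : ℝ) - dbar n d|) (Set.finite_range _).bddAbove j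

theorem statement12 (a b C₀ : ℝ) (ha : 0 < a) (hb : 0 < b) (hab : a + b < 1 / 2)
    (hC₀ : 0 < C₀) :
    ∃ ε : ℝ, 0 < ε ∧ ∃ C : ℝ, 0 < C ∧ ∃ N : ℕ, ∀ n : ℕ, N ≤ n →
      ∀ d : Fin n → ℕ, (degFinset n d).Nonempty →
        deltaPar n d ≤ C₀ * (n : ℝ) ^ ((1 : ℝ) / 2 + ε) →
        min (dbar n d) ((n : ℝ) - dbar n d - 1) ≥ (n : ℝ) / (3 * a * Real.log n) →
        ∀ h : ℕ, 0 < h → (h : ℝ) ≤ C₀ * (n : ℝ) ^ (2 * ε) →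
          ∀ m : ℕ, n * h = 2 * m →
            ∀ H : SimpleGraph (Fin n), (∀ j, deg H j = h) →
              ∃ E : ℝ, |E| ≤ C * (n : ℝ) ^ (-b) ∧
                expCopies n d H =
                  ((Nat.factorial n : ℝ) / (autCard H : ℝ)) * (lam n d) ^ m *
                    Real.exp (
                      -((1 - lam n d) / (4 * lam n d)) * (h * ((h : ℝ) - 2))
                      - Rpar n d * h / (2 * (lam n d) ^ 2 * n)
                      + E) := by
  set η : ℝ := min (1 / 100) ((1 / 2 - b) / 40) with hη
  have hη0 : 0 < η := lt_min (by norm_num) (by linarith)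
  have hη1 : η ≤ 1 / 100 := min_le_left _ _
  have hη2 : η ≤ (1 / 2 - b) / 40 := min_le_right _ _
  clear_value η
  have hlim := ((tendsto_rpow_atTop (by positivity : 0 < η / 4)).comp
    (tendsto_natCast_atTop_atTop (R := ℝ))).eventually_ge_atTop (C₀ + 10 + 12 * a / η)
  obtain ⟨N, hN⟩ := Filter.eventually_atTop.1 (hlim.and (Filter.eventually_ge_atTop 2))
  refine ⟨η / 4, by positivity, 1, one_pos, N, ?_⟩
  intro n hn d hd hdel hmin h hh0 hh m hm H hH
  obtain ⟨hX, hn2⟩ := hN n hn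
  have hn0 : (0 : ℝ) < n := by exact_mod_cast (by omega : 0 < n)
  have hn1 : (1 : ℝ) < n := by exact_mod_cast (by omega : 1 < n)
  simp only [Function.comp_apply] at hX
  set X : ℝ := (n : ℝ) ^ (η / 4) with hXdef
  have ha' : 0 < 12 * a / η := by positivity
  have hX10 : 10 ≤ X := by linarith
  have hL : (n : ℝ) ^ η = X ^ 4 := by
    rw [hXdef, ← Real.rpow_natCast, ← Real.rpow_mul hn0.le]
    congr 1; push_cast; ring
  have hX2 : (n : ℝ) ^ (2 * (η / 4)) = X ^ 2 := by
    rw [hXdef, ← Real.rpow_natCast, ← Real.rpow_mul hn0.le]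
    congr 1; push_cast; ring
  have hX1 : (n : ℝ) ^ ((1 : ℝ) / 2 + η / 4) = √n * X := by
    rw [Real.rpow_add hn0, Real.sqrt_eq_rpow]
  have hlog : 0 < Real.log n := Real.log_pos hn1
  have hlogX : 3 * a * Real.log n ≤ X ^ 4 := by
    have h1 : Real.log n ≤ X / (η / 4) := Real.log_le_rpow_div hn0.le (by positivity)
    have h2 : 3 * a * (X / (η / 4)) = 12 * a / η * X := by field_simp; ring
    calc 3 * a * Real.log n ≤ 3 * a * (X / (η / 4)) := by gcongr
      _ = 12 * a / η * X := h2
      _ ≤ X * X := by gcongr; linarith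
      _ = X ^ 2 := by ring
      _ ≤ X ^ 4 := pow_le_pow_right₀ (by linarith) (by norm_num)
  have hT : Tame d (X ^ 4) := by
    refine tame_of_bounds ?_ ?_ ?_ (by positivity) hlogX hmin
    · calc (1000 : ℝ) ≤ 10 ^ 4 := by norm_num
        _ ≤ X ^ 4 := by gcongr
    · rw [← hL, ← Real.rpow_natCast, ← Real.rpow_mul hn0.le]
      calc (n : ℝ) ^ (η * (100 : ℕ)) ≤ (n : ℝ) ^ (1 : ℝ) :=
            Real.rpow_le_rpow_of_exponent_le hn1.le (by push_cast; linarith)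
        _ = n := Real.rpow_one _
    · rw [hX1] at hdel
      calc deltaPar n d ≤ C₀ * (√n * X) := hdel
        _ ≤ X * (√n * X) := by gcongr; linarith
        _ = X ^ 2 * √n := by ring
        _ ≤ X ^ 4 * √n := by
          gcongr
          · linarith
          · norm_num
  have hhX : ((h + 8 : ℕ) : ℝ) ≤ X ^ 4 := by
    rw [hX2] at hh
    push_cast
    have h1 : (1 : ℝ) ≤ X ^ 2 := one_le_pow₀ (by linarith)
    have h2 : C₀ + 8 ≤ X ^ 2 := by nlinarith
    calc (h : ℝ) + 8 ≤ C₀ * X ^ 2 + 8 * X ^ 2 := by linarith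
      _ = (C₀ + 8) * X ^ 2 := by ring
      _ ≤ X ^ 2 * X ^ 2 := by gcongr
      _ = X ^ 4 := by ring
  obtain ⟨E, hE, hexp⟩ := expCopies_regular hT hh0 hhX (degFinset_eq_cls (d := d) ▸ hd) hH hm
  refine ⟨E, hE.trans ?_, hexp⟩
  rw [← hL, one_mul, Real.sqrt_eq_rpow, ← Real.rpow_natCast, ← Real.rpow_mul hn0.le,
    ← Real.rpow_sub hn0]
  refine Real.rpow_le_rpow_of_exponent_le hn1.le ?_
  push_cast
  linarith

end Stmt12
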